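/- Let θ ∈ (0,1] and let u be a C^{2,1} function on B_4 × [0, 1/R^2] satisfying |Δu + ∂_t u| ≤ R^2|u| + R|∇u|, ‖u‖_{L^∞(B_4 × [0,1/R^2])} ≤ 1, ‖∇u‖_{L^∞(B_4 × [0,1/R^2])} ≤ R, and ‖u(·,0)‖_{L^2(B_1)} ≥ θ R^{-n/2}. Then there is a constant N = N(n,θ), depending only on the dimension n and on θ, such that: (i) ‖u(·,0) e^{-R^2|x|^2/ε}‖_{L^2(B_4)} ≥ e^{-N R^2 log(1/ε)} whenever 0 < ε ≤ 1/(3N) and R ≥ N, and (ii) ‖u(·,0)‖_{L^2(B_r)} ≥ e^{-N R^2 log(N/r)} whenever 0 < r ≤ 1/2 and R ≥ N. -/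

import Mathlib

open MeasureTheory Real Set Metric

/-- The spatial Laplacian of `f : ℝⁿ → ℝ`. -/
noncomputable def slap {n : ℕ} (f : EuclideanSpace ℝ (Fin n) → ℝ)
    (x : EuclideanSpace ℝ (Fin n)) : ℝ :=
  ∑ i : Fin n, fderiv ℝ (fun y => fderiv ℝ f y (EuclideanSpace.single i 1)) x
    (EuclideanSpace.single i 1)

open scoped ContDiff Topology

/-- The partial derivative of `f : ℝⁿ → ℝ` in the `i`-th coordinate direction. -/
noncomputable def pd {n : ℕ} (i : Fin n) (f : EuclideanSpace ℝ (Fin n) → ℝ)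
    (x : EuclideanSpace ℝ (Fin n)) : ℝ :=
  fderiv ℝ f x (EuclideanSpace.single i 1)

section Calculus

variable {n : ℕ}

local notation "E" => EuclideanSpace ℝ (Fin n)

theorem slap_eq_sum_pd (f : E → ℝ) (x : E) : slap f x = ∑ i, pd i (pd i f) x := rfl

theorem pd_add {f g : E → ℝ} {x : E} (i : Fin n) (hf : DifferentiableAt ℝ f x)
    (hg : DifferentiableAt ℝ g x) : pd i (fun y => f y + g y) x = pd i f x + pd i g x := by
  simp [pd, fderiv_fun_add hf hg]

theorem pd_sub {f g : E → ℝ} {x : E} (i : Fin n) (hf : DifferentiableAt ℝ f x)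
    (hg : DifferentiableAt ℝ g x) : pd i (fun y => f y - g y) x = pd i f x - pd i g x := by
  simp [pd, fderiv_fun_sub hf hg]

theorem pd_neg {f : E → ℝ} {x : E} (i : Fin n) : pd i (fun y => -f y) x = -pd i f x := by
  simp [pd, fderiv_fun_neg]

theorem pd_mul {f g : E → ℝ} {x : E} (i : Fin n) (hf : DifferentiableAt ℝ f x)
    (hg : DifferentiableAt ℝ g x) :
    pd i (fun y => f y * g y) x = pd i f x * g x + f x * pd i g x := by
  simp [pd, fderiv_fun_mul hf hg]; ring

theorem pd_const_mul {f : E → ℝ} {x : E} (i : Fin n) (c : ℝ) (hf : DifferentiableAt ℝ f x) :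
    pd i (fun y => c * f y) x = c * pd i f x := by
  simp [pd, fderiv_const_mul hf]

theorem pd_sum {ι : Type*} {s : Finset ι} {f : ι → E → ℝ} {x : E} (i : Fin n)
    (hf : ∀ j ∈ s, DifferentiableAt ℝ (f j) x) :
    pd i (fun y => ∑ j ∈ s, f j y) x = ∑ j ∈ s, pd i (f j) x := by
  simp [pd, fderiv_fun_sum hf]

theorem pd_coord (i j : Fin n) (x : E) : pd i (fun y : E => y j) x = if j = i then 1 else 0 := by
  have : HasFDerivAt (fun y : E => y j) (EuclideanSpace.proj j : E →L[ℝ] ℝ) x :=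
    (EuclideanSpace.proj j : E →L[ℝ] ℝ).hasFDerivAt
  rw [pd, this.fderiv]
  simp

theorem pd_congr {f g : E → ℝ} {x : E} (i : Fin n) (h : f =ᶠ[𝓝 x] g) : pd i f x = pd i g x := by
  rw [pd, pd, h.fderiv_eq]

theorem slap_congr {f g : E → ℝ} {x : E} (h : f =ᶠ[𝓝 x] g) : slap f x = slap g x := by
  refine Finset.sum_congr rfl fun i _ => pd_congr i ?_
  filter_upwards [h.eventuallyEq_nhds] with y hy
  exact pd_congr i hy

theorem ContDiff.pd {f : E → ℝ} {k m : WithTop ℕ∞} (hf : ContDiff ℝ k f) (i : Fin n)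
    (hm : m + 1 ≤ k) : ContDiff ℝ m (pd i f) :=
  (hf.fderiv_right hm).clm_apply contDiff_const

theorem ContDiffAt.pd {f : E → ℝ} {x : E} {k m : WithTop ℕ∞} (hf : ContDiffAt ℝ k f x) (i : Fin n)
    (hm : m + 1 ≤ k) : ContDiffAt ℝ m (pd i f) x :=
  (hf.fderiv_right hm).clm_apply contDiffAt_const

theorem HasCompactSupport.pd {f : E → ℝ} (hf : HasCompactSupport f) (i : Fin n) :
    HasCompactSupport (pd i f) :=
  hf.fderiv_apply ℝ _

theorem pd_comm {f : E → ℝ} (hf : ContDiff ℝ 2 f) (i j : Fin n) (x : E) :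
    pd i (pd j f) x = pd j (pd i f) x := by
  have h := (hf.contDiffAt (x := x)).isSymmSndFDerivAt (by simp)
  have hd : DifferentiableAt ℝ (fderiv ℝ f) x :=
    ((hf.fderiv_right (m := 1) (by norm_num)).differentiable (by norm_num)) x
  have key : ∀ i j : Fin n, pd i (pd j f) x =
      fderiv ℝ (fderiv ℝ f) x (EuclideanSpace.single i 1) (EuclideanSpace.single j 1) := by
    intro i j
    have := fderiv_clm_apply hd (differentiableAt_const (EuclideanSpace.single j (1 : ℝ)))
    change fderiv ℝ (fun y => fderiv ℝ f y (EuclideanSpace.single j 1)) x _ = _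
    rw [this]; simp
  rw [key, key, h.eq]

theorem sum_pd_sq (f : E → ℝ) (x : E) : ∑ i, pd i f x ^ 2 = ‖fderiv ℝ f x‖ ^ 2 := by
  have h : ∀ i, pd i f x = gradient f x i := by
    intro i
    have := InnerProductSpace.toDual_symm_apply (𝕜 := ℝ) (x := EuclideanSpace.single i (1 : ℝ))
      (y := fderiv ℝ f x)
    rw [pd, ← this, gradient, real_inner_comm, EuclideanSpace.inner_single_left]
    simp
  have h2 : ‖gradient f x‖ = ‖fderiv ℝ f x‖ := by simp [gradient]
  rw [← h2, EuclideanSpace.norm_sq_eq]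
  simp [h]

theorem integral_pd_eq_zero {F : E → ℝ} (hF : ContDiff ℝ 1 F) (hc : HasCompactSupport F)
    (i : Fin n) : ∫ x, pd i F x = 0 := by
  have h := integral_mul_fderiv_eq_neg_fderiv_mul_of_integrable (μ := (volume : Measure E))
    (f := fun _ => (1 : ℝ)) (g := F) (v := EuclideanSpace.single i 1) (by simp)
    (by
      simp only [one_mul]
      exact (hF.pd i (m := 0) (by norm_num)).continuous.integrable_of_hasCompactSupport (hc.pd i))
    (by
      simp only [one_mul]
      exact hF.continuous.integrable_of_hasCompactSupport hc)
    (fun x _ => differentiableAt_const _) (fun x _ => hF.differentiable (by norm_num) x)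
  simpa [pd] using h

theorem integral_sum_pd_eq_zero {F : Fin n → E → ℝ} (hF : ∀ i, ContDiff ℝ 1 (F i))
    (hc : ∀ i, HasCompactSupport (F i)) : ∫ x, ∑ i, pd i (F i) x = 0 := by
  rw [integral_finsetSum]
  · simp [integral_pd_eq_zero (hF _) (hc _)]
  · exact fun i _ => ((hF i).pd i (m := 0) (by norm_num)).continuous.integrable_of_hasCompactSupport
      ((hc i).pd i)

/-- The unnormalised Gaussian `exp (-|x|² / (4τ))`. -/
noncomputable def gauss (τ : ℝ) (x : E) : ℝ := Real.exp (-‖x‖ ^ 2 / (4 * τ))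

theorem contDiff_gauss (τ : ℝ) {k : WithTop ℕ∞} : ContDiff ℝ k (gauss τ : E → ℝ) := by
  unfold gauss
  exact ((contDiff_norm_sq ℝ).neg.div_const _).exp

theorem pd_gauss (τ : ℝ) (i : Fin n) (x : E) :
    pd i (gauss τ) x = -(x i / (2 * τ)) * gauss τ x := by
  have h1 : HasFDerivAt (fun y : E => ‖y‖ ^ 2) (2 • innerSL ℝ x) x :=
    (hasStrictFDerivAt_norm_sq x).hasFDerivAt
  have h2 := (h1.mul_const (-(4 * τ)⁻¹)).exp
  have h3 : (gauss τ : E → ℝ) = fun y : E => Real.exp (‖y‖ ^ 2 * -(4 * τ)⁻¹) := by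
    ext y; simp [gauss, div_eq_mul_inv]
  have h4 : inner ℝ x (EuclideanSpace.single i (1 : ℝ)) = x i := by
    rw [EuclideanSpace.inner_single_right]; simp
  rw [pd, h3, h2.fderiv]
  simp [h4]
  by_cases h : τ = 0
  · simp [h]
  · field_simp; ring

end Calculus

section Static

variable {n : ℕ}

local notation "E" => EuclideanSpace ℝ (Fin n)

/-- The Ornstein-Uhlenbeck operator symmetric with respect to `gauss τ`. -/
noncomputable def ouOp (τ : ℝ) (f : E → ℝ) (x : E) : ℝ :=
  slap f x - (∑ i, x i * pd i f x) / (2 * τ)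

theorem norm_sq_eq_sum (x : E) : ‖x‖ ^ 2 = ∑ i, x i ^ 2 := by
  rw [EuclideanSpace.norm_sq_eq]; simp

theorem contDiff_slap {f : E → ℝ} (hf : ContDiff ℝ ∞ f) : ContDiff ℝ ∞ (slap f) := by
  have : slap f = fun x => ∑ i, pd i (pd i f) x := rfl
  rw [this]
  exact ContDiff.sum fun i _ => (hf.pd i (m := ∞) (by simp)).pd i (by simp)

theorem contDiff_coord (i : Fin n) {k : WithTop ℕ∞} : ContDiff ℝ k (fun y : E => y i) :=
  (EuclideanSpace.proj i : E →L[ℝ] ℝ).contDiff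

theorem integral_eq_of_sub_eq_sum_pd {A B : E → ℝ} {F : Fin n → E → ℝ}
    (hF : ∀ i, ContDiff ℝ 1 (F i)) (hc : ∀ i, HasCompactSupport (F i))
    (hA : Continuous A) (hAc : HasCompactSupport A) (hB : Continuous B) (hBc : HasCompactSupport B)
    (h : ∀ x, A x - B x = ∑ i, pd i (F i) x) : ∫ x, A x = ∫ x, B x := by
  rw [← sub_eq_zero, ← integral_sub (hA.integrable_of_hasCompactSupport hAc)
    (hB.integrable_of_hasCompactSupport hBc), ← integral_sum_pd_eq_zero hF hc]
  exact integral_congr_ae (Filter.Eventually.of_forall h)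

theorem pd_eq_zero_of_notMem_tsupport {f : E → ℝ} {x : E} (hx : x ∉ tsupport f) (i : Fin n) :
    pd i f x = 0 := by
  have : f =ᶠ[𝓝 x] fun _ => 0 := notMem_tsupport_iff_eventuallyEq.mp hx
  rw [pd_congr i this]; simp [pd]

theorem slap_eq_zero_of_notMem_tsupport {f : E → ℝ} {x : E} (hx : x ∉ tsupport f) :
    slap f x = 0 := by
  have : f =ᶠ[𝓝 x] fun _ => 0 := notMem_tsupport_iff_eventuallyEq.mp hx
  rw [slap_congr this]; simp [slap]

theorem integral_gauss_energy {f φ : E → ℝ} (hf : ContDiff ℝ ∞ f) (hφ : ContDiff ℝ ∞ φ)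
    (hc : HasCompactSupport f) {τ : ℝ} (hτ : 0 < τ) :
    ∫ x, (2 * f x * φ x + f x ^ 2 * (‖x‖ ^ 2 / (4 * τ ^ 2))) * gauss τ x =
      ∫ x, (2 * f x * (φ x + slap f x) + 2 * ∑ i, pd i f x ^ 2 + n / (2 * τ) * f x ^ 2) *
        gauss τ x := by
  have hG : ContDiff ℝ ∞ (gauss τ : E → ℝ) := contDiff_gauss τ
  have hp : ∀ i, ContDiff ℝ ∞ (pd i f) := fun i => hf.pd i (by simp)
  have hx : ∀ i, ContDiff ℝ ∞ (fun y : E => y i) := fun i => contDiff_coord i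
  have hdf : Differentiable ℝ f := hf.differentiable (by simp)
  have hdG : Differentiable ℝ (gauss τ : E → ℝ) := hG.differentiable (by simp)
  have hdp : ∀ i, Differentiable ℝ (pd i f) := fun i => (hp i).differentiable (by simp)
  have hdx : ∀ i, Differentiable ℝ (fun y : E => y i) := fun i => (hx i).differentiable (by simp)
  have hs := (contDiff_slap hf).continuous
  have hcp : ∀ i, Continuous (pd i f) := fun i => (hp i).continuous
  have hcf := hf.continuous
  have hcφ := hφ.continuous
  have hcG := hG.continuous
  have hz : ∀ x ∉ tsupport f, f x = 0 := fun x hx => image_eq_zero_of_notMem_tsupport hx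
  refine integral_eq_of_sub_eq_sum_pd
    (F := fun i x => (-(2 * (f x * pd i f x)) + -(1 / (2 * τ)) * (x i * (f x * f x))) * gauss τ x)
    (fun i => ?_) (fun i => ?_) (by fun_prop) ?_ (by fun_prop) ?_ ?_
  · exact ContDiff.of_le (by fun_prop) (m := 1) (n := ∞) (by norm_cast)
  · exact HasCompactSupport.intro hc fun x hx => by simp [hz x hx]
  · exact HasCompactSupport.intro hc fun x hx => by simp [hz x hx]
  · exact HasCompactSupport.intro hc fun x hx => by
      simp [hz x hx, pd_eq_zero_of_notMem_tsupport hx]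
  intro x
  have key : ∀ i, pd i (fun x => (-(2 * (f x * pd i f x)) +
      -(1 / (2 * τ)) * (x i * (f x * f x))) * gauss τ x) x =
      -(2 * f x * gauss τ x) * pd i (pd i f) x - 2 * gauss τ x * pd i f x ^ 2
        + f x ^ 2 * gauss τ x / (4 * τ ^ 2) * x i ^ 2 - f x ^ 2 * gauss τ x / (2 * τ) := by
    intro i
    rw [pd_mul i (by fun_prop) (by fun_prop), pd_add i (by fun_prop) (by fun_prop), pd_neg,
      pd_const_mul i _ (by fun_prop), pd_const_mul i _ (by fun_prop),
      pd_mul i (by fun_prop) (by fun_prop), pd_mul i (by fun_prop) (by fun_prop),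
      pd_mul i (by fun_prop) (by fun_prop), pd_coord, pd_gauss]
    simp
    field_simp
    ring
  simp_rw [key]
  simp only [Finset.sum_sub_distrib, Finset.sum_add_distrib, ← Finset.mul_sum, Finset.sum_const,
    Finset.card_univ, Fintype.card_fin, nsmul_eq_mul, ← norm_sq_eq_sum, ← slap_eq_sum_pd]
  field_simp
  ring

theorem integral_gauss_dirichlet {f φ : E → ℝ} (hf : ContDiff ℝ ∞ f) (hφ : ContDiff ℝ ∞ φ)
    (hc : HasCompactSupport f) {τ : ℝ} (hτ : 0 < τ) :
    ∫ x, (2 * ∑ i, pd i f x * pd i φ x + (∑ i, pd i f x ^ 2) * (‖x‖ ^ 2 / (4 * τ ^ 2))) *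
        gauss τ x =
      ∫ x, (2 * ouOp τ f x ^ 2 - (∑ i, pd i f x ^ 2) / τ - 2 * ouOp τ f x * (φ x + slap f x) +
        n / (2 * τ) * ∑ i, pd i f x ^ 2) * gauss τ x := by
  have hG : ContDiff ℝ ∞ (gauss τ : E → ℝ) := contDiff_gauss τ
  have hp : ∀ i, ContDiff ℝ ∞ (pd i f) := fun i => hf.pd i (by simp)
  have hpp : ∀ i, ContDiff ℝ ∞ (pd i φ) := fun i => hφ.pd i (by simp)
  have hx : ∀ i, ContDiff ℝ ∞ (fun y : E => y i) := fun i => contDiff_coord i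
  have hdφ : Differentiable ℝ φ := hφ.differentiable (by simp)
  have hdG : Differentiable ℝ (gauss τ : E → ℝ) := hG.differentiable (by simp)
  have hdp : ∀ i, Differentiable ℝ (pd i f) := fun i => (hp i).differentiable (by simp)
  have hdx : ∀ i, Differentiable ℝ (fun y : E => y i) := fun i => (hx i).differentiable (by simp)
  have hs := (contDiff_slap hf).continuous
  have hcp : ∀ i, Continuous (pd i f) := fun i => (hp i).continuous
  have hcpp : ∀ i, Continuous (pd i φ) := fun i => (hpp i).continuous
  have hcx : ∀ i, Continuous (fun y : E => y i) := fun i => (hx i).continuous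
  have hcφ := hφ.continuous
  have hcG := hG.continuous
  have hz : ∀ x ∉ tsupport f, ∀ i, pd i f x = 0 := fun x hx i => pd_eq_zero_of_notMem_tsupport hx i
  have hou : Continuous (ouOp τ f) := by unfold ouOp; fun_prop
  refine integral_eq_of_sub_eq_sum_pd
    (F := fun i x => (2 * (φ x * pd i f x) + 1 / τ * ((∑ j, x j * pd j f x) * pd i f x) +
      -(1 / (2 * τ)) * (x i * ∑ j, pd j f x * pd j f x)) * gauss τ x)
    (fun i => ?_) (fun i => ?_) (by fun_prop) ?_ (by fun_prop) ?_ ?_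
  · exact ContDiff.of_le (by fun_prop) (m := 1) (n := ∞) (by norm_cast)
  · exact HasCompactSupport.intro hc fun x hx => by simp [hz x hx]
  · exact HasCompactSupport.intro hc fun x hx => by simp [hz x hx]
  · exact HasCompactSupport.intro hc fun x hx => by
      simp [ouOp, hz x hx, slap_eq_zero_of_notMem_tsupport hx]
  intro x
  have key : ∀ i, pd i (fun x => (2 * (φ x * pd i f x) +
      1 / τ * ((∑ j, x j * pd j f x) * pd i f x) +
      -(1 / (2 * τ)) * (x i * ∑ j, pd j f x * pd j f x)) * gauss τ x) x =
      (2 * gauss τ x) * (pd i f x * pd i φ x) + 2 * φ x * gauss τ x * pd i (pd i f) x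
        - φ x * gauss τ x / τ * (x i * pd i f x)
        + gauss τ x / τ * pd i f x ^ 2
        + gauss τ x / τ * (∑ j, x j * pd i (pd j f) x * pd i f x)
        + gauss τ x / τ * (∑ j, x j * pd j f x) * pd i (pd i f) x
        - gauss τ x / (2 * τ ^ 2) * (∑ j, x j * pd j f x) * (x i * pd i f x)
        - gauss τ x / (2 * τ) * (∑ j, pd j f x ^ 2)
        - gauss τ x / τ * (∑ j, x i * pd i (pd j f) x * pd j f x)
        + gauss τ x / (4 * τ ^ 2) * (∑ j, pd j f x ^ 2) * x i ^ 2 := by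
    intro i
    rw [pd_mul i (by fun_prop) (by fun_prop), pd_add i (by fun_prop) (by fun_prop),
      pd_add i (by fun_prop) (by fun_prop),
      pd_const_mul i _ (by fun_prop), pd_const_mul i _ (by fun_prop),
      pd_const_mul i _ (by fun_prop),
      pd_mul i (by fun_prop) (by fun_prop), pd_mul i (by fun_prop) (by fun_prop),
      pd_mul i (by fun_prop) (by fun_prop), pd_coord, pd_gauss,
      pd_sum i (fun j _ => by fun_prop), pd_sum i (fun j _ => by fun_prop)]
    have h1 : ∀ j, pd i (fun y : E => y j * pd j f y) x =
        (if j = i then pd j f x else 0) + x j * pd i (pd j f) x := by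
      intro j
      rw [pd_mul i (by fun_prop) (by fun_prop), pd_coord]
      simp
    have h2 : ∀ j, pd i (fun y : E => pd j f y * pd j f y) x =
        2 * (pd i (pd j f) x * pd j f x) := by
      intro j
      rw [pd_mul i (by fun_prop) (by fun_prop)]
      ring
    simp_rw [h1, h2]
    rw [Finset.sum_add_distrib, ← Finset.mul_sum, ← Finset.sum_mul]
    simp_rw [mul_assoc (x i), ← Finset.mul_sum, ← pow_two]
    simp
    field_simp
    ring
  have hsymm : ∑ i, ∑ j, x j * pd i (pd j f) x * pd i f x =
      ∑ i, ∑ j, x i * pd i (pd j f) x * pd j f x := by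
    rw [Finset.sum_comm]
    refine Finset.sum_congr rfl fun i _ => Finset.sum_congr rfl fun j _ => ?_
    rw [pd_comm (hf.of_le (by norm_cast))]
  simp_rw [key]
  simp only [Finset.sum_sub_distrib, Finset.sum_add_distrib, ← Finset.mul_sum, Finset.sum_const,
    Finset.card_univ, Fintype.card_fin, nsmul_eq_mul, ← norm_sq_eq_sum, ← slap_eq_sum_pd]
  rw [hsymm]
  simp only [ouOp]
  field_simp
  ring

theorem integral_gauss_parts {f : E → ℝ} (hf : ContDiff ℝ ∞ f)
    (hc : HasCompactSupport f) {τ : ℝ} (hτ : 0 < τ) :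
    ∫ x, f x * ouOp τ f x * gauss τ x = ∫ x, -(∑ i, pd i f x ^ 2) * gauss τ x := by
  have hG : ContDiff ℝ ∞ (gauss τ : E → ℝ) := contDiff_gauss τ
  have hp : ∀ i, ContDiff ℝ ∞ (pd i f) := fun i => hf.pd i (by simp)
  have hdf : Differentiable ℝ f := hf.differentiable (by simp)
  have hdG : Differentiable ℝ (gauss τ : E → ℝ) := hG.differentiable (by simp)
  have hdp : ∀ i, Differentiable ℝ (pd i f) := fun i => (hp i).differentiable (by simp)
  have hs := (contDiff_slap hf).continuous
  have hcp : ∀ i, Continuous (pd i f) := fun i => (hp i).continuous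
  have hcf := hf.continuous
  have hcG := hG.continuous
  have hz : ∀ x ∉ tsupport f, f x = 0 := fun x hx => image_eq_zero_of_notMem_tsupport hx
  have hou : Continuous (ouOp τ f) := by unfold ouOp; fun_prop
  refine integral_eq_of_sub_eq_sum_pd (F := fun i x => (f x * pd i f x) * gauss τ x)
    (fun i => ?_) (fun i => ?_) (by fun_prop) ?_ (by fun_prop) ?_ ?_
  · exact ContDiff.of_le (by fun_prop) (m := 1) (n := ∞) (by norm_cast)
  · exact HasCompactSupport.intro hc fun x hx => by simp [hz x hx]
  · exact HasCompactSupport.intro hc fun x hx => by simp [hz x hx]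
  · exact HasCompactSupport.intro hc fun x hx => by
      simp [pd_eq_zero_of_notMem_tsupport hx]
  intro x
  have key : ∀ i, pd i (fun x => (f x * pd i f x) * gauss τ x) x =
      (f x * gauss τ x) * pd i (pd i f) x + gauss τ x * pd i f x ^ 2
        - f x * gauss τ x / (2 * τ) * (x i * pd i f x) := by
    intro i
    rw [pd_mul i (by fun_prop) (by fun_prop), pd_mul i (by fun_prop) (by fun_prop), pd_gauss]
    field_simp
    ring
  simp_rw [key]
  simp only [Finset.sum_sub_distrib, Finset.sum_add_distrib, ← Finset.mul_sum, ← slap_eq_sum_pd,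
    ouOp]
  field_simp
  ring

end Static

section Evolution

variable {n : ℕ}

local notation "E" => EuclideanSpace ℝ (Fin n)

theorem hasDerivAt_integral_of_compact {F F' : E → ℝ → ℝ} {t δ r : ℝ} (hδ : 0 < δ)
    (hF : ∀ s, Continuous fun x => F x s)
    (hF' : ContinuousOn (fun z : E × ℝ => F' z.1 z.2) (univ ×ˢ closedBall t δ))
    (h0 : ∀ x s, r < ‖x‖ → F x s = 0) (h0' : ∀ x s, r < ‖x‖ → F' x s = 0)
    (hd : ∀ x, ∀ s ∈ ball t δ, HasDerivAt (F x) (F' x s) s) :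
    HasDerivAt (fun s => ∫ x, F x s) (∫ x, F' x t) t := by
  have hK : IsCompact (closedBall (0 : E) r ×ˢ closedBall t δ) :=
    (isCompact_closedBall _ _).prod (isCompact_closedBall _ _)
  obtain ⟨C, hC⟩ := hK.exists_bound_of_continuousOn (hF'.mono (prod_mono_left (subset_univ _)))
  have hc' : Continuous fun x => F' x t := by
    have : Continuous fun x : E => ((x, t) : E × ℝ) := by fun_prop
    exact hF'.comp_continuous this fun x => ⟨mem_univ _, by simp [hδ.le]⟩
  refine (hasDerivAt_integral_of_dominated_loc_of_deriv_le
    (F := fun s x => F x s) (F' := fun s x => F' x s)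
    (bound := (closedBall (0 : E) r).indicator fun _ => C) (ball_mem_nhds t hδ)
    (Filter.Eventually.of_forall fun s => (hF s).aestronglyMeasurable) ?_
    hc'.aestronglyMeasurable ?_ ?_ ?_).2
  · refine (hF t).integrable_of_hasCompactSupport
      (HasCompactSupport.intro (isCompact_closedBall 0 r) fun x hx => h0 x t ?_)
    simpa using hx
  · refine Filter.Eventually.of_forall fun x s hs => ?_
    by_cases hx : ‖x‖ ≤ r
    · rw [indicator_of_mem (by simpa using hx)]
      exact hC (x, s) ⟨by simpa using hx, ball_subset_closedBall hs⟩
    · rw [indicator_of_notMem (by simpa using hx), h0' x s (not_le.mp hx)]; simp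
  · exact (integrable_indicator_iff measurableSet_closedBall).2
      (integrableOn_const (isCompact_closedBall (0 : E) r).measure_lt_top.ne)
  · exact Filter.Eventually.of_forall fun x s hs => hd x s hs

theorem hasDerivAt_gauss {τ : ℝ} (hτ : τ ≠ 0) (x : E) :
    HasDerivAt (fun s => gauss s x) (‖x‖ ^ 2 / (4 * τ ^ 2) * gauss τ x) τ := by
  have h1 : HasDerivAt (fun s : ℝ => -‖x‖ ^ 2 / (4 * s)) (‖x‖ ^ 2 / (4 * τ ^ 2)) τ := by
    have := ((hasDerivAt_inv hτ).const_mul (-‖x‖ ^ 2 / 4))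
    refine (this.congr_deriv ?_).congr_of_eventuallyEq (Filter.Eventually.of_forall fun s => ?_)
    · field_simp
    · simp only
      by_cases hs : s = 0
      · simp [hs]
      · field_simp
  refine h1.exp.congr_deriv ?_
  rw [gauss]; ring

theorem continuousOn_gauss {s : Set (E × ℝ)} (hs : ∀ z ∈ s, z.2 ≠ 0) :
    ContinuousOn (fun z : E × ℝ => gauss z.2 z.1) s := by
  unfold gauss
  refine Real.continuous_exp.comp_continuousOn (ContinuousOn.div (by fun_prop) (by fun_prop) ?_)
  intro z hz
  simpa using hs z hz

/-- The derivative of `U : ℝⁿ × ℝ → ℝ` in the direction `a`. -/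
noncomputable def dd (a : E × ℝ) (U : E × ℝ → ℝ) (z : E × ℝ) : ℝ := fderiv ℝ U z a

theorem ContDiff.dd {U : E × ℝ → ℝ} (hU : ContDiff ℝ ∞ U) (a : E × ℝ) :
    ContDiff ℝ ∞ (dd a U) :=
  (hU.fderiv_right (m := ∞) (by simp)).clm_apply contDiff_const

theorem dd_comm {U : E × ℝ → ℝ} (hU : ContDiff ℝ ∞ U) (a b : E × ℝ) (z : E × ℝ) :
    dd a (dd b U) z = dd b (dd a U) z := by
  have h := (hU.contDiffAt (x := z)).isSymmSndFDerivAt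
    (by rw [minSmoothness_of_isRCLikeNormedField]; norm_cast)
  have hd : DifferentiableAt ℝ (fderiv ℝ U) z :=
    ((hU.fderiv_right (m := 1) (by norm_cast)).differentiable (by norm_num)) z
  have key : ∀ a b : E × ℝ, dd a (dd b U) z = fderiv ℝ (fderiv ℝ U) z a b := by
    intro a b
    have := fderiv_clm_apply hd (differentiableAt_const b)
    change fderiv ℝ (fun y => fderiv ℝ U y b) z _ = _
    rw [this]; simp
  rw [key, key, h.eq]

theorem pd_slice {U : E × ℝ → ℝ} (hU : ContDiff ℝ ∞ U) (i : Fin n) (x : E) (t : ℝ) :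
    pd i (fun y => U (y, t)) x = dd (EuclideanSpace.single i 1, 0) U (x, t) := by
  have h1 : HasFDerivAt U (fderiv ℝ U (x, t)) (x, t) :=
    (hU.differentiable (by simp) (x, t)).hasFDerivAt
  have h2 : HasFDerivAt (fun y : E => (y, t)) (ContinuousLinearMap.inl ℝ E ℝ) x :=
    hasFDerivAt_prodMk_left x t
  have h3 : fderiv ℝ (fun y => U (y, t)) x = _ := (h1.comp x h2).fderiv
  rw [pd, h3, dd]
  simp

theorem hasDerivAt_slice {U : E × ℝ → ℝ} (hU : ContDiff ℝ ∞ U) (x : E) (t : ℝ) :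
    HasDerivAt (fun s => U (x, s)) (dd (0, 1) U (x, t)) t := by
  have h1 : HasFDerivAt U (fderiv ℝ U (x, t)) (x, t) :=
    (hU.differentiable (by simp) (x, t)).hasFDerivAt
  have h2 : HasDerivAt (fun s : ℝ => ((x, s) : E × ℝ)) (0, 1) t :=
    (hasDerivAt_const t x).prodMk (hasDerivAt_id t)
  exact h1.comp_hasDerivAt t h2

theorem dd_eq_zero {U : E × ℝ → ℝ} {r : ℝ} (h0 : ∀ x t, r < ‖x‖ → U (x, t) = 0) (a : E × ℝ)
    (x : E) (t : ℝ) (hx : r < ‖x‖) : dd a U (x, t) = 0 := by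
  have : U =ᶠ[𝓝 (x, t)] fun _ => 0 := by
    have ho : IsOpen {z : E × ℝ | r < ‖z.1‖} := isOpen_lt (by fun_prop) (by fun_prop)
    filter_upwards [ho.mem_nhds (show (x, t) ∈ {z : E × ℝ | r < ‖z.1‖} from hx)] with z hz
    exact h0 z.1 z.2 hz
  rw [dd, this.fderiv_eq]; simp

theorem contDiff_slice {U : E × ℝ → ℝ} (hU : ContDiff ℝ ∞ U) (t : ℝ) :
    ContDiff ℝ ∞ fun x => U (x, t) := hU.comp (by fun_prop)

theorem hasCompactSupport_slice {U : E × ℝ → ℝ} {r : ℝ} (h0 : ∀ x t, r < ‖x‖ → U (x, t) = 0)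
    (t : ℝ) : HasCompactSupport fun x => U (x, t) :=
  HasCompactSupport.intro (isCompact_closedBall 0 r) fun x hx => h0 x t (by simpa using hx)

/-- The backward heat operator applied to `U`. -/
noncomputable def bheat (U : E × ℝ → ℝ) (t : ℝ) (x : E) : ℝ :=
  dd (0, 1) U (x, t) + slap (fun y => U (y, t)) x

/-- The Gaussian-weighted mass of `U` at time `t`. -/
noncomputable def gMass (τ₀ : ℝ) (U : E × ℝ → ℝ) (t : ℝ) : ℝ :=
  ∫ x, U (x, t) ^ 2 * gauss (t + τ₀) x

/-- The Gaussian-weighted Dirichlet energy of `U` at time `t`. -/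
noncomputable def gDir (τ₀ : ℝ) (U : E × ℝ → ℝ) (t : ℝ) : ℝ :=
  ∫ x, (∑ i, pd i (fun y => U (y, t)) x ^ 2) * gauss (t + τ₀) x

theorem hasDerivAt_integral_mul_gauss {Q : E × ℝ → ℝ} (hQ : ContDiff ℝ ∞ Q) {r : ℝ}
    (h0 : ∀ x t, r < ‖x‖ → Q (x, t) = 0) {τ₀ t : ℝ} (ht : 0 < t + τ₀) :
    HasDerivAt (fun s => ∫ x, Q (x, s) * gauss (s + τ₀) x)
      (∫ x, (dd (0, 1) Q (x, t) + Q (x, t) * (‖x‖ ^ 2 / (4 * (t + τ₀) ^ 2))) *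
        gauss (t + τ₀) x) t := by
  have hpos : ∀ s ∈ closedBall t ((t + τ₀) / 2), s + τ₀ ≠ 0 := by
    intro s hs
    rw [mem_closedBall, Real.dist_eq, abs_le] at hs
    linarith
  refine hasDerivAt_integral_of_compact (δ := (t + τ₀) / 2) (r := r)
    (F := fun x s => Q (x, s) * gauss (s + τ₀) x)
    (F' := fun x s => (dd (0, 1) Q (x, s) + Q (x, s) * (‖x‖ ^ 2 / (4 * (s + τ₀) ^ 2))) *
        gauss (s + τ₀) x) (by linarith) ?_ ?_ ?_ ?_ ?_
  · intro s
    exact (contDiff_slice hQ s).continuous.mul (contDiff_gauss (k := 0) _).continuous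
  · refine ContinuousOn.mul ?_ ?_
    · refine (hQ.dd _).continuous.continuousOn.add (hQ.continuous.continuousOn.mul ?_)
      refine ContinuousOn.div (by fun_prop) (by fun_prop) ?_
      rintro ⟨x, s⟩ hz
      have := hpos s hz.2
      positivity
    · have : ContinuousOn (fun z : E × ℝ => gauss z.2 z.1) {z | z.2 ≠ 0} :=
        continuousOn_gauss fun z hz => hz
      exact this.comp (f := fun z : E × ℝ => (z.1, z.2 + τ₀)) (by fun_prop)
        fun z hz => hpos z.2 hz.2
  · intro x s hx; simp [h0 x s hx]
  · intro x s hx; simp [h0 x s hx, dd_eq_zero h0 _ x s hx]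
  · intro x s hs
    have hg := (hasDerivAt_gauss (hpos s (ball_subset_closedBall hs)) x).comp_add_const s τ₀
    refine ((hasDerivAt_slice hQ x s).mul hg).congr_deriv ?_
    ring

theorem hasDerivAt_gMass {U : E × ℝ → ℝ} (hU : ContDiff ℝ ∞ U) {r : ℝ}
    (h0 : ∀ x t, r < ‖x‖ → U (x, t) = 0) {τ₀ t : ℝ} (ht : 0 < t + τ₀) :
    HasDerivAt (gMass τ₀ U) (∫ x, (2 * U (x, t) * bheat U t x +
      2 * ∑ i, pd i (fun y => U (y, t)) x ^ 2 + n / (2 * (t + τ₀)) * U (x, t) ^ 2) *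
        gauss (t + τ₀) x) t := by
  have h := hasDerivAt_integral_mul_gauss (Q := fun z => U z ^ 2) (by fun_prop) (r := r)
    (fun x t hx => by simp [h0 x t hx]) ht
  refine h.congr_deriv ?_
  have hs := integral_gauss_energy (contDiff_slice hU t) (contDiff_slice (hU.dd (0, 1)) t)
    (hasCompactSupport_slice h0 t) ht
  unfold bheat
  rw [← hs]
  congr 1
  ext x
  have h1 : dd (0, 1) (fun z => U z ^ 2) (x, t) = 2 * U (x, t) * dd (0, 1) U (x, t) := by
    have := (hasDerivAt_slice (U := fun z => U z ^ 2) (by fun_prop) x t).unique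
      ((hasDerivAt_slice hU x t).pow 2)
    simpa using this
  rw [h1]

theorem hasDerivAt_gDir {U : E × ℝ → ℝ} (hU : ContDiff ℝ ∞ U) {r : ℝ}
    (h0 : ∀ x t, r < ‖x‖ → U (x, t) = 0) {τ₀ t : ℝ} (ht : 0 < t + τ₀) :
    HasDerivAt (gDir τ₀ U) (∫ x, (2 * ouOp (t + τ₀) (fun y => U (y, t)) x ^ 2 -
      (∑ i, pd i (fun y => U (y, t)) x ^ 2) / (t + τ₀) -
      2 * ouOp (t + τ₀) (fun y => U (y, t)) x * bheat U t x +
      n / (2 * (t + τ₀)) * ∑ i, pd i (fun y => U (y, t)) x ^ 2) * gauss (t + τ₀) x) t := by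
  have hsm : ∀ i : Fin n, ContDiff ℝ ∞ (dd (EuclideanSpace.single i 1, 0) U) := fun i => hU.dd _
  have h := hasDerivAt_integral_mul_gauss
    (Q := fun z => ∑ i : Fin n, dd (EuclideanSpace.single i 1, 0) U z ^ 2) (by fun_prop) (r := r)
    (fun x t hx => by simp [dd_eq_zero h0 _ x t hx]) ht
  have hfun : gDir τ₀ U = fun s => ∫ x, (∑ i : Fin n,
      dd (EuclideanSpace.single i 1, 0) U (x, s) ^ 2) * gauss (s + τ₀) x := by
    ext s; simp only [gDir, pd_slice hU]
  rw [hfun]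
  refine h.congr_deriv ?_
  have hs := integral_gauss_dirichlet (contDiff_slice hU t) (contDiff_slice (hU.dd (0, 1)) t)
    (hasCompactSupport_slice h0 t) ht
  unfold bheat
  rw [← hs]
  congr 1
  ext x
  have h1 : dd (0, 1) (fun z => ∑ i : Fin n, dd (EuclideanSpace.single i 1, 0) U z ^ 2) (x, t) =
      2 * ∑ i : Fin n, dd (EuclideanSpace.single i 1, 0) U (x, t) *
        dd (0, 1) (dd (EuclideanSpace.single i 1, 0) U) (x, t) := by
    have := (hasDerivAt_slice (U := fun z => ∑ i : Fin n,
      dd (EuclideanSpace.single i 1, 0) U z ^ 2) (by fun_prop) x t).unique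
      (HasDerivAt.fun_sum fun i _ => (hasDerivAt_slice (hsm i) x t).pow 2)
    rw [this, Finset.mul_sum]
    refine Finset.sum_congr rfl fun i _ => ?_
    simp; ring
  rw [h1]
  simp only [pd_slice hU, pd_slice (hU.dd _), dd_comm hU (0, 1)]

end Evolution

section Monotonicity

variable {n : ℕ}

local notation "E" => EuclideanSpace ℝ (Fin n)

theorem add_mul_le_of_hasDerivAt {f f' : ℝ → ℝ} {a b c : ℝ} (hab : a ≤ b)
    (hd : ∀ t ∈ Icc a b, HasDerivAt f (f' t) t) (hc : ∀ t ∈ Icc a b, c ≤ f' t) :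
    f a + c * (b - a) ≤ f b := by
  have h := (convex_Icc a b).mul_sub_le_image_sub_of_le_deriv (f := f) (C := c)
    (fun t ht => (hd t ht).continuousAt.continuousWithinAt)
    (fun t ht => (hd t (interior_subset ht)).differentiableAt.differentiableWithinAt)
    (fun t ht => by rw [(hd t (interior_subset ht)).deriv]; exact hc t (interior_subset ht))
    a (left_mem_Icc.2 hab) b (right_mem_Icc.2 hab) hab
  linarith

theorem integral_comb_four {f₁ f₂ f₃ f₄ : E → ℝ} (h₁ : Integrable f₁) (h₂ : Integrable f₂)
    (h₃ : Integrable f₃) (h₄ : Integrable f₄) (c₁ c₂ c₃ c₄ : ℝ) :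
    ∫ x, (c₁ * f₁ x + c₂ * f₂ x + c₃ * f₃ x + c₄ * f₄ x) =
      c₁ * (∫ x, f₁ x) + c₂ * (∫ x, f₂ x) + c₃ * (∫ x, f₃ x) + c₄ * ∫ x, f₄ x := by
  rw [integral_add (by fun_prop) (by fun_prop), integral_add (by fun_prop) (by fun_prop),
    integral_add (by fun_prop) (by fun_prop)]
  simp only [integral_const_mul]

theorem integrable_mul_gauss {f : E → ℝ} (hf : Continuous f) {r : ℝ}
    (h0 : ∀ x, r < ‖x‖ → f x = 0) (τ : ℝ) : Integrable fun x => f x * gauss τ x := by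
  refine (hf.mul (contDiff_gauss (k := 0) τ).continuous).integrable_of_hasCompactSupport
    (HasCompactSupport.intro (isCompact_closedBall 0 r) fun x hx => ?_)
  simp [h0 x (by simpa using hx)]

theorem gauss_pos (τ : ℝ) (x : E) : 0 < gauss τ x := Real.exp_pos _

theorem continuous_bheat {U : E × ℝ → ℝ} (hU : ContDiff ℝ ∞ U) (t : ℝ) : Continuous (bheat U t) :=
  (contDiff_slice (hU.dd (0, 1)) t).continuous.add (contDiff_slap (contDiff_slice hU t)).continuous

theorem notMem_tsupport_slice {U : E × ℝ → ℝ} {r : ℝ} (h0 : ∀ x t, r < ‖x‖ → U (x, t) = 0) {t : ℝ} {x : E}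
    (hx : r < ‖x‖) : x ∉ tsupport fun y => U (y, t) := by
  refine notMem_tsupport_iff_eventuallyEq.2 ?_
  have ho : IsOpen {z : E | r < ‖z‖} := isOpen_lt (by fun_prop) (by fun_prop)
  filter_upwards [ho.mem_nhds (show x ∈ {z : E | r < ‖z‖} from hx)] with z hz
  exact h0 z t hz

theorem bheat_eq_zero {U : E × ℝ → ℝ} {r : ℝ} (h0 : ∀ x t, r < ‖x‖ → U (x, t) = 0) (t : ℝ) {x : E} (hx : r < ‖x‖) :
    bheat U t x = 0 := by
  rw [bheat, dd_eq_zero h0 _ x t hx, slap_eq_zero_of_notMem_tsupport (notMem_tsupport_slice h0 hx),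
    add_zero]

/-- Differential inequality for `(t + τ₀) * gDir - a * (1 - 4 R² (t + τ₀)) * gMass`. -/
theorem exists_hasDerivAt_frequency {U : E × ℝ → ℝ} {r : ℝ} (hU : ContDiff ℝ ∞ U)
    (h0 : ∀ x t, r < ‖x‖ → U (x, t) = 0)
    {κ : E → ℝ} (hκ : Continuous κ) (hκ0 : ∀ x, r < ‖x‖ → κ x = 0) {R a τ₀ t : ℝ}
    (ha : 1 ≤ a) (ht : 0 < t + τ₀)
    (hL : ∀ x, |bheat U t x| ≤
      R ^ 2 * |U (x, t)| + R * ‖fderiv ℝ (fun y => U (y, t)) x‖ + κ x) :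
    ∃ d, HasDerivAt (fun s => (s + τ₀) * gDir τ₀ U s -
        a * (1 - 4 * R ^ 2 * (s + τ₀)) * gMass τ₀ U s) d t ∧
      a * R ^ 2 * gMass τ₀ U t - (t + τ₀) * ∫ x, κ x ^ 2 * gauss (t + τ₀) x ≤
        d + (-(2 * a + n / 2) / (t + τ₀) + (8 * a + 2) * R ^ 2) *
          ((t + τ₀) * gDir τ₀ U t - a * (1 - 4 * R ^ 2 * (t + τ₀)) * gMass τ₀ U t) := by
  have hd : HasDerivAt (fun s : ℝ => s + τ₀) 1 t := (hasDerivAt_id t).add_const τ₀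
  have hα : HasDerivAt (fun s : ℝ => a * (1 - 4 * R ^ 2 * (s + τ₀))) (a * -(4 * R ^ 2 * 1)) t :=
    ((hd.const_mul (4 * R ^ 2)).const_sub 1).const_mul a
  refine ⟨_, (hd.mul (hasDerivAt_gDir hU h0 ht)).sub (hα.mul (hasDerivAt_gMass hU h0 ht)), ?_⟩
  set τ := t + τ₀ with hτ
  set α := a * (1 - 4 * R ^ 2 * τ) with hα'
  set V : E → ℝ := fun y => U (y, t) with hV
  have hVs : ContDiff ℝ ∞ V := contDiff_slice hU t
  have hVc : Continuous V := hVs.continuous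
  have hpc : ∀ i, Continuous (pd i V) := fun i => (hVs.pd i (m := ∞) (by simp)).continuous
  have hLc : Continuous (bheat U t) := continuous_bheat hU t
  have hsc : Continuous (slap V) := (contDiff_slap hVs).continuous
  have hxc : ∀ i, Continuous fun y : E => y i := fun i => (contDiff_coord i (k := 0)).continuous
  have hoc : Continuous (ouOp τ V) := by unfold ouOp; fun_prop
  have hz : ∀ x, r < ‖x‖ → V x = 0 := fun x hx => h0 x t hx
  have hzp : ∀ x, r < ‖x‖ → ∀ i, pd i V x = 0 := fun x hx i =>
    pd_eq_zero_of_notMem_tsupport (notMem_tsupport_slice h0 hx) i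
  have hzo : ∀ x, r < ‖x‖ → ouOp τ V x = 0 := fun x hx => by
    have hs : slap V x = 0 := slap_eq_zero_of_notMem_tsupport (notMem_tsupport_slice h0 hx)
    simp [ouOp, hzp x hx, hs]
  have i1 : Integrable fun x => V x * ouOp τ V x * gauss τ x :=
    integrable_mul_gauss (r := r) (by fun_prop) (fun x hx => by simp [hz x hx]) τ
  have i2 : Integrable fun x => V x ^ 2 * gauss τ x :=
    integrable_mul_gauss (r := r) (by fun_prop) (fun x hx => by simp [hz x hx]) τ
  have i3 : Integrable fun x => (∑ i, pd i V x ^ 2) * gauss τ x :=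
    integrable_mul_gauss (r := r) (by fun_prop) (fun x hx => by simp [hzp x hx]) τ
  have i4 : Integrable fun x => κ x ^ 2 * gauss τ x :=
    integrable_mul_gauss (r := r) (by fun_prop) (fun x hx => by simp [hκ0 x hx]) τ
  have i5 : Integrable fun x => (2 * ouOp τ V x ^ 2 - (∑ i, pd i V x ^ 2) / τ -
      2 * ouOp τ V x * bheat U t x + n / (2 * τ) * ∑ i, pd i V x ^ 2) * gauss τ x :=
    integrable_mul_gauss (r := r) (by fun_prop) (fun x hx => by simp [hzp x hx, hzo x hx]) τ
  have i6 : Integrable fun x => (2 * V x * bheat U t x +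
      2 * ∑ i, pd i V x ^ 2 + n / (2 * τ) * V x ^ 2) * gauss τ x :=
    integrable_mul_gauss (r := r) (by fun_prop) (fun x hx => by simp [hzp x hx, hz x hx]) τ
  have hparts : ∫ x, V x * ouOp τ V x * gauss τ x = -gDir τ₀ U t := by
    rw [integral_gauss_parts hVs (hasCompactSupport_slice h0 t) ht, gDir, ← integral_neg]
    simp only [neg_mul, hV, hτ]
  have hmono := integral_mono
    (f := fun x => -4 * α * (V x * ouOp τ V x * gauss τ x) +
      (-2 * α ^ 2 / τ - 2 * τ * R ^ 4 - α * n / (2 * τ)) * (V x ^ 2 * gauss τ x) +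
      (-2 * τ * R ^ 2 - 1 + n / 2 - 2 * α) * ((∑ i, pd i V x ^ 2) * gauss τ x) +
      (-τ) * (κ x ^ 2 * gauss τ x))
    (g := fun x => τ * ((2 * ouOp τ V x ^ 2 - (∑ i, pd i V x ^ 2) / τ -
      2 * ouOp τ V x * bheat U t x + n / (2 * τ) * ∑ i, pd i V x ^ 2) * gauss τ x) -
      α * ((2 * V x * bheat U t x +
      2 * ∑ i, pd i V x ^ 2 + n / (2 * τ) * V x ^ 2) * gauss τ x))
    (by fun_prop) (by fun_prop) (fun x => ?_)
  · rw [integral_comb_four i1 i2 i3 i4, integral_sub (i5.const_mul _) (i6.const_mul _),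
      integral_const_mul, integral_const_mul, hparts] at hmono
    have e2 : ∫ x, V x ^ 2 * gauss τ x = gMass τ₀ U t := rfl
    have e3 : ∫ x, (∑ i, pd i V x ^ 2) * gauss τ x = gDir τ₀ U t := rfl
    rw [e2, e3] at hmono
    have hH : 0 ≤ gMass τ₀ U t :=
      integral_nonneg fun x => mul_nonneg (sq_nonneg _) (gauss_pos _ _).le
    have key : a * R ^ 2 * gMass τ₀ U t - τ * ∫ x, κ x ^ 2 * gauss τ x ≤
        gDir τ₀ U t + 4 * a * R ^ 2 * gMass τ₀ U t +
        (-4 * α * -gDir τ₀ U t + (-2 * α ^ 2 / τ - 2 * τ * R ^ 4 - α * n / (2 * τ)) * gMass τ₀ U t +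
          (-2 * τ * R ^ 2 - 1 + n / 2 - 2 * α) * gDir τ₀ U t +
          (-τ) * ∫ x, κ x ^ 2 * gauss τ x) +
        (-(2 * a + n / 2) / τ + (8 * a + 2) * R ^ 2) *
          (τ * gDir τ₀ U t - α * gMass τ₀ U t) := by
      have e : gDir τ₀ U t + 4 * a * R ^ 2 * gMass τ₀ U t +
        (-4 * α * -gDir τ₀ U t + (-2 * α ^ 2 / τ - 2 * τ * R ^ 4 - α * n / (2 * τ)) * gMass τ₀ U t +
          (-2 * τ * R ^ 2 - 1 + n / 2 - 2 * α) * gDir τ₀ U t +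
          (-τ) * ∫ x, κ x ^ 2 * gauss τ x) +
        (-(2 * a + n / 2) / τ + (8 * a + 2) * R ^ 2) *
          (τ * gDir τ₀ U t - α * gMass τ₀ U t) -
          (a * R ^ 2 * gMass τ₀ U t - τ * ∫ x, κ x ^ 2 * gauss τ x) =
          (a * R ^ 2 + (8 * a - 2) * τ * R ^ 4) * gMass τ₀ U t := by
        rw [hα']
        field_simp
        ring
      have : 0 ≤ (a * R ^ 2 + (8 * a - 2) * τ * R ^ 4) * gMass τ₀ U t := by
        have : 0 ≤ 8 * a - 2 := by linarith
        positivity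
      linarith
    refine key.trans ?_
    have e4 : gDir τ₀ U t + 4 * a * R ^ 2 * gMass τ₀ U t =
      1 * gDir τ₀ U t - a * -(4 * R ^ 2 * 1) * gMass τ₀ U t := by ring
    rw [e4]
    linarith
  · have hsum : ∑ i, pd i V x ^ 2 = ‖fderiv ℝ V x‖ ^ 2 := sum_pd_sq V x
    have hLx := hL x
    have hV' : U (x, t) = V x := rfl
    rw [hV'] at hLx
    simp only [hsum]
    generalize bheat U t x = L at *
    generalize ‖fderiv ℝ V x‖ = p at *
    generalize ouOp τ V x = o at *
    have hG := gauss_pos τ x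
    generalize gauss τ x = G at *
    generalize κ x = k at *
    generalize V x = v at *
    have hL2 : L ^ 2 ≤ 4 * R ^ 4 * v ^ 2 + 4 * R ^ 2 * p ^ 2 + 2 * k ^ 2 := by
      have h1 : L ^ 2 ≤ (R ^ 2 * |v| + R * p + k) ^ 2 := by
        rw [← sq_abs L]; exact pow_le_pow_left₀ (abs_nonneg _) hLx 2
      have h2 : v ^ 2 = |v| ^ 2 := (sq_abs v).symm
      rw [h2]
      nlinarith [sq_nonneg (R ^ 2 * |v| - R * p), sq_nonneg (R ^ 2 * |v| + R * p - k)]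
    have hsq : 0 ≤ 2 * τ * (o + α * v / τ - L / 2) ^ 2 := by positivity
    have e : τ * ((2 * o ^ 2 - p ^ 2 / τ - 2 * o * L + n / (2 * τ) * p ^ 2) * G) -
        α * ((2 * v * L + 2 * p ^ 2 + n / (2 * τ) * v ^ 2) * G) -
        (-4 * α * (v * o * G) + (-2 * α ^ 2 / τ - 2 * τ * R ^ 4 - α * n / (2 * τ)) * (v ^ 2 * G) +
        (-2 * τ * R ^ 2 - 1 + n / 2 - 2 * α) * (p ^ 2 * G) + (-τ) * (k ^ 2 * G)) =
        (2 * τ * (o + α * v / τ - L / 2) ^ 2 +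
          τ / 2 * (4 * R ^ 4 * v ^ 2 + 4 * R ^ 2 * p ^ 2 + 2 * k ^ 2 - L ^ 2)) * G := by
      field_simp
      ring
    have : 0 ≤ (2 * τ * (o + α * v / τ - L / 2) ^ 2 +
        τ / 2 * (4 * R ^ 4 * v ^ 2 + 4 * R ^ 2 * p ^ 2 + 2 * k ^ 2 - L ^ 2)) * G := by
      have : 0 ≤ 4 * R ^ 4 * v ^ 2 + 4 * R ^ 2 * p ^ 2 + 2 * k ^ 2 - L ^ 2 := by linarith
      positivity
    linarith

theorem exists_hasDerivAt_gMass_ge {U : E × ℝ → ℝ} {r : ℝ} (hU : ContDiff ℝ ∞ U)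
    (h0 : ∀ x t, r < ‖x‖ → U (x, t) = 0)
    {κ : E → ℝ} (hκ : Continuous κ) (hκ0 : ∀ x, r < ‖x‖ → κ x = 0) {R τ₀ t : ℝ}
    (hR : 0 < R) (ht : 0 < t + τ₀)
    (hL : ∀ x, |bheat U t x| ≤
      R ^ 2 * |U (x, t)| + R * ‖fderiv ℝ (fun y => U (y, t)) x‖ + κ x) :
    ∃ d, HasDerivAt (gMass τ₀ U) d t ∧
      -(4 * R ^ 2) * gMass τ₀ U t - 1 / R ^ 2 * ∫ x, κ x ^ 2 * gauss (t + τ₀) x ≤ d := by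
  refine ⟨_, hasDerivAt_gMass hU h0 ht, ?_⟩
  set τ := t + τ₀ with hτ
  set V : E → ℝ := fun y => U (y, t) with hV
  have hVs : ContDiff ℝ ∞ V := contDiff_slice hU t
  have hVc : Continuous V := hVs.continuous
  have hpc : ∀ i, Continuous (pd i V) := fun i => (hVs.pd i (m := ∞) (by simp)).continuous
  have hLc : Continuous (bheat U t) := continuous_bheat hU t
  have hz : ∀ x, r < ‖x‖ → V x = 0 := fun x hx => h0 x t hx
  have hzp : ∀ x, r < ‖x‖ → ∀ i, pd i V x = 0 := fun x hx i =>
    pd_eq_zero_of_notMem_tsupport (notMem_tsupport_slice h0 hx) i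
  have i2 : Integrable fun x => V x ^ 2 * gauss τ x :=
    integrable_mul_gauss (r := r) (by fun_prop) (fun x hx => by simp [hz x hx]) τ
  have i4 : Integrable fun x => κ x ^ 2 * gauss τ x :=
    integrable_mul_gauss (r := r) (by fun_prop) (fun x hx => by simp [hκ0 x hx]) τ
  have i6 : Integrable fun x => (2 * V x * bheat U t x +
      2 * ∑ i, pd i V x ^ 2 + n / (2 * τ) * V x ^ 2) * gauss τ x :=
    integrable_mul_gauss (r := r) (by fun_prop) (fun x hx => by simp [hzp x hx, hz x hx]) τ
  have e2 : ∫ x, V x ^ 2 * gauss τ x = gMass τ₀ U t := rfl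
  rw [← e2, ← integral_const_mul, ← integral_const_mul,
    ← integral_sub (i2.const_mul _) (i4.const_mul _)]
  refine integral_mono ((i2.const_mul _).sub (i4.const_mul _)) i6 fun x => ?_
  have hsum : ∑ i, pd i V x ^ 2 = ‖fderiv ℝ V x‖ ^ 2 := sum_pd_sq V x
  have hLx := hL x
  have hV' : U (x, t) = V x := rfl
  rw [hV'] at hLx
  simp only [hsum]
  change _ ≤ (2 * V x * bheat U t x + 2 * ‖fderiv ℝ V x‖ ^ 2 + n / (2 * τ) * V x ^ 2) * gauss τ x
  generalize bheat U t x = L at *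
  generalize ‖fderiv ℝ V x‖ = p at *
  have hG := gauss_pos τ x
  generalize gauss τ x = G at *
  generalize κ x = k at *
  generalize V x = v at *
  have h1 : -(|v| * (R ^ 2 * |v| + R * p + k)) ≤ v * L := by
    have := mul_le_mul_of_nonneg_left hLx (abs_nonneg v)
    rw [← abs_mul] at this
    linarith [neg_abs_le (v * L)]
  have h2 : |v| * |v| = v ^ 2 := by rw [← pow_two, sq_abs]
  have h3 : 2 * (|v| * (R * p)) ≤ R ^ 2 * v ^ 2 + p ^ 2 := by
    rw [← h2]; nlinarith [sq_nonneg (R * |v| - p)]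
  have h4 : 2 * (|v| * k) ≤ R ^ 2 * v ^ 2 + 1 / R ^ 2 * k ^ 2 := by
    have : 0 ≤ (R * |v| - k / R) ^ 2 := sq_nonneg _
    have e : (R * |v| - k / R) ^ 2 = R ^ 2 * (|v| * |v|) - 2 * (|v| * k) + 1 / R ^ 2 * k ^ 2 := by
      field_simp; ring
    rw [e, h2] at this
    linarith
  have h5 : 0 ≤ n / (2 * τ) * v ^ 2 := by positivity
  have h6 : -(4 * R ^ 2) * v ^ 2 - 1 / R ^ 2 * k ^ 2 ≤
      2 * v * L + 2 * p ^ 2 + n / (2 * τ) * v ^ 2 := by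
    have : |v| * (R ^ 2 * |v| + R * p + k) = R ^ 2 * (|v| * |v|) + |v| * (R * p) + |v| * k := by
      ring
    rw [this, h2] at h1
    nlinarith [sq_nonneg p]
  calc _ = (-(4 * R ^ 2) * v ^ 2 - 1 / R ^ 2 * k ^ 2) * G := by ring
    _ ≤ _ := mul_le_mul_of_nonneg_right h6 hG.le

end Monotonicity

section LowerBound

variable {n : ℕ}

local notation "E" => EuclideanSpace ℝ (Fin n)

theorem gauss_le_gauss {τ : ℝ} (hτ : 0 < τ) {s : ℝ} {x : E} (h : s ≤ ‖x‖ ^ 2) :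
    gauss τ x ≤ Real.exp (-s / (4 * τ)) := by
  unfold gauss
  gcongr

theorem exp_le_gauss {τ : ℝ} (hτ : 0 < τ) {s : ℝ} {x : E} (h : ‖x‖ ^ 2 ≤ s) :
    Real.exp (-s / (4 * τ)) ≤ gauss τ x := by
  unfold gauss
  gcongr

theorem gMass_nonneg (τ₀ : ℝ) (U : E × ℝ → ℝ) (t : ℝ) : 0 ≤ gMass τ₀ U t :=
  integral_nonneg fun _ => mul_nonneg (sq_nonneg _) (gauss_pos _ _).le

theorem gDir_nonneg (τ₀ : ℝ) (U : E × ℝ → ℝ) (t : ℝ) : 0 ≤ gDir τ₀ U t :=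
  integral_nonneg fun _ =>
    mul_nonneg (Finset.sum_nonneg fun _ _ => sq_nonneg _) (gauss_pos _ _).le

theorem exp_mul_setIntegral_le_gMass {U : E × ℝ → ℝ} (hU : ContDiff ℝ ∞ U) {r : ℝ}
    (h0 : ∀ x t, r < ‖x‖ → U (x, t) = 0) {τ₀ t ρ : ℝ} (ht : 0 < t + τ₀)
    {S : Set E} (hS : MeasurableSet S) (hSρ : ∀ x ∈ S, ‖x‖ ≤ ρ) :
    Real.exp (-ρ ^ 2 / (4 * (t + τ₀))) * ∫ x in S, U (x, t) ^ 2 ≤ gMass τ₀ U t := by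
  have hc := (contDiff_slice hU t).continuous
  have hi : Integrable fun x => U (x, t) ^ 2 :=
    (hc.pow 2).integrable_of_hasCompactSupport
      (HasCompactSupport.intro (isCompact_closedBall 0 r) fun x hx => by
        simp [h0 x t (by simpa using hx)])
  have hig : Integrable fun x => U (x, t) ^ 2 * gauss (t + τ₀) x :=
    integrable_mul_gauss (r := r) (hc.pow 2) (fun x hx => by simp [h0 x t hx]) _
  rw [← integral_const_mul]
  calc _ ≤ ∫ x in S, U (x, t) ^ 2 * gauss (t + τ₀) x := by
        refine setIntegral_mono_on (hi.integrableOn.const_mul _) hig.integrableOn hS fun x hx => ?_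
        rw [mul_comm]
        exact mul_le_mul_of_nonneg_left
          (exp_le_gauss ht (pow_le_pow_left₀ (norm_nonneg x) (hSρ x hx) 2)) (sq_nonneg _)
    _ ≤ _ := setIntegral_le_integral hig
        (Filter.Eventually.of_forall fun x => mul_nonneg (sq_nonneg _) (gauss_pos _ _).le)

theorem gMass_le_setIntegral_add {U : E × ℝ → ℝ} (hU : ContDiff ℝ ∞ U)
    (h0 : ∀ x t, 4 < ‖x‖ → U (x, t) = 0) {τ₀ t ρ : ℝ} (ht : 0 < t + τ₀) (hρ : 0 ≤ ρ)
    (h1 : ∀ x, |U (x, t)| ≤ 1) :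
    gMass τ₀ U t ≤ (∫ x in closedBall (0 : E) ρ, U (x, t) ^ 2) +
      Real.exp (-ρ ^ 2 / (4 * (t + τ₀))) * volume.real (closedBall (0 : E) 4) := by
  have hc := (contDiff_slice hU t).continuous
  have hi : Integrable fun x => U (x, t) ^ 2 :=
    (hc.pow 2).integrable_of_hasCompactSupport
      (HasCompactSupport.intro (isCompact_closedBall 0 4) fun x hx => by
        simp [h0 x t (by simpa using hx)])
  have hig : Integrable fun x => U (x, t) ^ 2 * gauss (t + τ₀) x :=
    integrable_mul_gauss (r := 4) (hc.pow 2) (fun x hx => by simp [h0 x t hx]) _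
  set c := Real.exp (-ρ ^ 2 / (4 * (t + τ₀)))
  have hic : Integrable ((closedBall (0 : E) 4).indicator fun _ => c) :=
    (integrable_indicator_iff measurableSet_closedBall).2
      (integrableOn_const (isCompact_closedBall (0 : E) 4).measure_lt_top.ne)
  have e : c * volume.real (closedBall (0 : E) 4) =
      ∫ x, (closedBall (0 : E) 4).indicator (fun _ => c) x := by
    rw [integral_indicator measurableSet_closedBall, setIntegral_const, smul_eq_mul, mul_comm]
  rw [e, ← integral_indicator measurableSet_closedBall,
    ← integral_add (hi.indicator measurableSet_closedBall) hic]
  refine integral_mono hig ((hi.indicator measurableSet_closedBall).add hic) fun x => ?_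
  have hU1 : U (x, t) ^ 2 ≤ 1 := by
    rw [← sq_abs]; exact pow_le_one₀ (abs_nonneg _) (h1 x)
  have hc0 : 0 ≤ c := (Real.exp_pos _).le
  have hg0 := (gauss_pos (t + τ₀) x).le
  have hg1 : gauss (t + τ₀) x ≤ 1 := Real.exp_le_one_iff.2
    (div_nonpos_of_nonpos_of_nonneg (neg_nonpos.2 (sq_nonneg _)) (by positivity))
  by_cases hx : ‖x‖ ≤ ρ
  · have : (closedBall (0 : E) ρ).indicator (fun x => U (x, t) ^ 2) x = U (x, t) ^ 2 :=
      indicator_of_mem (by simpa using hx) _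
    simp only [this]
    have h2 : 0 ≤ (closedBall (0 : E) 4).indicator (fun _ => c) x :=
      indicator_nonneg (fun _ _ => hc0) x
    nlinarith [sq_nonneg (U (x, t))]
  · have : (closedBall (0 : E) ρ).indicator (fun x => U (x, t) ^ 2) x = 0 :=
      indicator_of_notMem (by simpa using hx) _
    simp only [this, zero_add]
    by_cases hx4 : ‖x‖ ≤ 4
    · rw [indicator_of_mem (by simpa using hx4)]
      have hgc : gauss (t + τ₀) x ≤ c :=
        gauss_le_gauss ht (pow_le_pow_left₀ hρ (not_le.1 hx).le 2)
      nlinarith [sq_nonneg (U (x, t))]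
    · rw [h0 x t (not_le.1 hx4)]
      simpa using indicator_nonneg (fun _ _ => hc0) x

/-- The hypotheses on the smooth approximations: an approximate version of the differential
inequality, with an error `κ` that is small in the Gaussian-weighted norms. -/
structure Approx (R C τ₀ : ℝ) (U : E × ℝ → ℝ) (κ : E → ℝ) : Prop where
  smooth : ContDiff ℝ ∞ U
  zero : ∀ x t, 4 < ‖x‖ → U (x, t) = 0
  cont : Continuous κ
  zero' : ∀ x, 5 < ‖x‖ → κ x = 0
  bound : ∀ t ∈ Icc (0 : ℝ) (1 / (4 * R ^ 2)), ∀ x, |bheat U t x| ≤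
    R ^ 2 * |U (x, t)| + R * ‖fderiv ℝ (fun y => U (y, t)) x‖ + κ x
  small : ∀ τ, τ₀ ≤ τ → ∫ x, κ x ^ 2 * gauss τ x ≤ C * R ^ 2 * Real.exp (-9 / (4 * τ))
  le_one : ∀ t ∈ Icc (0 : ℝ) (1 / (4 * R ^ 2)), ∀ x, |U (x, t)| ≤ 1
  gDir_le : ∀ t ∈ Icc (0 : ℝ) (1 / (4 * R ^ 2)), gDir τ₀ U t ≤ C * R ^ 2

theorem mass_propagation {R C τ₀ : ℝ} {U : E × ℝ → ℝ} {κ : E → ℝ} (h : Approx R C τ₀ U κ)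
    (hR : 1 ≤ R) (hC : 0 ≤ C) (hτ₀ : τ₀ ≤ 1 / R ^ 2) {t : ℝ} (ht : t ∈ Icc 0 (1 / (4 * R ^ 2))) :
    gMass (1 / R ^ 2) U 0 - C * Real.exp (-(9 / 5) * R ^ 2) ≤
      Real.exp 1 * gMass (1 / R ^ 2) U t := by
  have hR0 : 0 < R := by linarith
  have hR2 : 0 < R ^ 2 := by positivity
  have hτ : ∀ s ∈ Icc 0 t, 0 < s + 1 / R ^ 2 := fun s hs => by
    have : 0 < 1 / R ^ 2 := by positivity
    linarith [hs.1]
  have hs' : ∀ s ∈ Icc 0 t, s ∈ Icc 0 (1 / (4 * R ^ 2)) := fun s hs => ⟨hs.1, hs.2.trans ht.2⟩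
  have H : ∀ s ∈ Icc 0 t, ∃ d, HasDerivAt (gMass (1 / R ^ 2) U) d s ∧
      -(4 * R ^ 2) * gMass (1 / R ^ 2) U s - 1 / R ^ 2 *
        ∫ x, κ x ^ 2 * gauss (s + 1 / R ^ 2) x ≤ d := fun s hs =>
    exists_hasDerivAt_gMass_ge h.smooth (r := 5) (fun x t hx => h.zero x t (by linarith)) h.cont
      h.zero' hR0 (hτ s hs) (h.bound s (hs' s hs))
  choose! d hd hd' using H
  have hexp : ∀ s, HasDerivAt (fun s => Real.exp (4 * R ^ 2 * s))
      (Real.exp (4 * R ^ 2 * s) * (4 * R ^ 2)) s := fun s => by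
    simpa using ((hasDerivAt_id s).const_mul (4 * R ^ 2)).exp
  have key := add_mul_le_of_hasDerivAt (c := -(Real.exp 1 * C * Real.exp (-(9 / 5) * R ^ 2))) ht.1
    (fun s hs => (hexp s).mul (hd s hs)) (fun s hs => ?_)
  · simp only [Pi.mul_apply, mul_zero, Real.exp_zero, one_mul, sub_zero] at key
    have h1 : Real.exp (4 * R ^ 2 * t) ≤ Real.exp 1 := by
      gcongr
      have := ht.2
      rw [le_div_iff₀ (by positivity)] at this
      linarith
    have h2 := mul_le_mul_of_nonneg_right h1 (gMass_nonneg (1 / R ^ 2) U t)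
    have h3 : Real.exp 1 * t ≤ 1 := by
      have h4 : Real.exp 1 ≤ 3 := Real.exp_one_lt_three.le
      have h5 : t ≤ 1 / 4 := ht.2.trans (by
        rw [div_le_div_iff₀ (by positivity) (by norm_num)]
        nlinarith)
      nlinarith [ht.1]
    have h6 : 0 ≤ C * Real.exp (-(9 / 5) * R ^ 2) := by positivity
    nlinarith
  · have hsm := h.small (s + 1 / R ^ 2) (by linarith [hs.1])
    have h1 : Real.exp (4 * R ^ 2 * s) ≤ Real.exp 1 := by
      gcongr
      have := (hs' s hs).2
      rw [le_div_iff₀ (by positivity)] at this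
      linarith
    have h2 : Real.exp (-9 / (4 * (s + 1 / R ^ 2))) ≤ Real.exp (-(9 / 5) * R ^ 2) := by
      gcongr
      rw [div_le_iff₀ (by have := hτ s hs; positivity)]
      have h3 := (hs' s hs).2
      rw [le_div_iff₀ (by positivity)] at h3
      have : R ^ 2 * (1 / R ^ 2) = 1 := by field_simp
      nlinarith
    have h3 : 1 / R ^ 2 * ∫ x, κ x ^ 2 * gauss (s + 1 / R ^ 2) x ≤
        C * Real.exp (-(9 / 5) * R ^ 2) := by
      calc _ ≤ 1 / R ^ 2 * (C * R ^ 2 * Real.exp (-(9 / 5) * R ^ 2)) := by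
            gcongr
            exact hsm.trans (by gcongr)
        _ = _ := by field_simp
    have h4 := hd' s hs
    have h5 : -(C * Real.exp (-(9 / 5) * R ^ 2)) ≤ 4 * R ^ 2 * gMass (1 / R ^ 2) U s + d s := by
      linarith
    have h6 : 0 ≤ C * Real.exp (-(9 / 5) * R ^ 2) := by positivity
    have h7 : 0 < Real.exp (4 * R ^ 2 * s) := Real.exp_pos _
    nlinarith

/-- The Gaussian mass at positive times, for large `R`. -/
theorem gMass_ge_of_large {R C τ₀ θ : ℝ} {U : E × ℝ → ℝ} {κ : E → ℝ} (h : Approx R C τ₀ U κ)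
    (hR : 1 ≤ R) (hC : volume.real (closedBall (0 : E) 4) ≤ C) (hτp : 0 < τ₀)
    (hτ₀ : τ₀ ≤ 1 / R ^ 2)
    (hmass : θ ^ 2 / 2 * (R ^ n)⁻¹ ≤ ∫ x in ball (0 : E) 1, U (x, 0) ^ 2)
    (hlarge : (1 + 2 * C) * R ^ n ≤ θ ^ 2 / 6 * Real.exp (R ^ 2 / 12))
    {t : ℝ} (ht : t ∈ Icc 0 (1 / (4 * R ^ 2))) :
    Real.exp (-1 / (2 * (t + τ₀))) * Real.exp (-R ^ 2 / 3) ≤ gMass τ₀ U t := by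
  have hR0 : 0 < R := by linarith
  have hR2 : 0 < R ^ 2 := by positivity
  have hC0 : 0 ≤ C := measureReal_nonneg.trans hC
  have htτ : 0 < t + 1 / R ^ 2 := by have := ht.1; positivity
  have htτ' : 0 < t + τ₀ := by have := ht.1; positivity
  have h1 := mass_propagation h hR hC0 hτ₀ ht
  have h2 : Real.exp (-R ^ 2 / 4) * (θ ^ 2 / 2 * (R ^ n)⁻¹) ≤ gMass (1 / R ^ 2) U 0 := by
    have hS : ∀ x ∈ ball (0 : E) 1, ‖x‖ ≤ 1 := fun x hx => (mem_ball_zero_iff.1 hx).le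
    have h0 : 0 < 0 + 1 / R ^ 2 := by positivity
    have h2 := exp_mul_setIntegral_le_gMass h.smooth h.zero h0 measurableSet_ball hS
    have e : -1 ^ 2 / (4 * (0 + 1 / R ^ 2)) = -R ^ 2 / 4 := by field_simp; norm_num
    rw [e] at h2
    exact (mul_le_mul_of_nonneg_left hmass (Real.exp_pos _).le).trans h2
  have h3 := gMass_le_setIntegral_add h.smooth h.zero (ρ := 7 / 5) htτ (by norm_num)
    (h.le_one t ht)
  have h4 : Real.exp (-(7 / 5) ^ 2 / (4 * (t + 1 / R ^ 2))) ≤ Real.exp (-R ^ 2 / 3) := by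
    refine Real.exp_le_exp.2 ?_
    rw [div_le_iff₀ (by positivity)]
    have h3 := ht.2
    rw [le_div_iff₀ (by positivity)] at h3
    have : R ^ 2 * (1 / R ^ 2) = 1 := by field_simp
    nlinarith
  have h5 : Real.exp (-(9 / 5) * R ^ 2) ≤ Real.exp (-R ^ 2 / 3) :=
    Real.exp_le_exp.2 (by linarith)
  have h6 : (1 + 2 * C) * Real.exp (-R ^ 2 / 3) * 3 ≤
      Real.exp (-R ^ 2 / 4) * (θ ^ 2 / 2 * (R ^ n)⁻¹) := by
    have e : Real.exp (-R ^ 2 / 4) = Real.exp (R ^ 2 / 12) * Real.exp (-R ^ 2 / 3) := by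
      rw [← Real.exp_add]; ring_nf
    have hRn : 0 < R ^ n := by positivity
    rw [e]
    have : (1 + 2 * C) ≤ θ ^ 2 / 6 * Real.exp (R ^ 2 / 12) * (R ^ n)⁻¹ := by
      rw [← div_eq_mul_inv, le_div_iff₀ hRn]; exact hlarge
    have hpos := Real.exp_pos (-R ^ 2 / 3)
    nlinarith
  have hM : Real.exp (-R ^ 2 / 3) ≤ ∫ x in closedBall (0 : E) (7 / 5), U (x, t) ^ 2 := by
    have he1 : 1 ≤ Real.exp 1 := Real.one_le_exp zero_le_one
    have he3 : Real.exp 1 ≤ 3 := Real.exp_one_lt_three.le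
    set X := Real.exp (-R ^ 2 / 3)
    have hX : 0 < X := Real.exp_pos _
    have h7 : C * Real.exp (-(9 / 5) * R ^ 2) ≤ C * X := by gcongr
    have h8 : Real.exp (-(7 / 5) ^ 2 / (4 * (t + 1 / R ^ 2))) *
        volume.real (closedBall (0 : E) 4) ≤ X * C := by gcongr
    have h9 : (1 + C) * X * 3 ≤ Real.exp 1 * gMass (1 / R ^ 2) U t := by nlinarith
    have h10 : (1 + C) * X ≤ gMass (1 / R ^ 2) U t := by
      have := gMass_nonneg (1 / R ^ 2) U t
      nlinarith
    nlinarith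
  have hS : ∀ x ∈ closedBall (0 : E) (7 / 5), ‖x‖ ≤ 7 / 5 := fun x hx => mem_closedBall_zero_iff.1 hx
  have h11 := exp_mul_setIntegral_le_gMass h.smooth h.zero htτ' measurableSet_closedBall hS
  refine le_trans (mul_le_mul ?_ hM (Real.exp_pos _).le (Real.exp_pos _).le) h11
  refine Real.exp_le_exp.2 ?_
  rw [div_le_div_iff₀ (by positivity) (by positivity)]
  nlinarith

end LowerBound

section Doubling

variable {n : ℕ}

local notation "E" => EuclideanSpace ℝ (Fin n)

/-- The weighted frequency-type quantity that is almost monotone in time. -/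
noncomputable def freq (R a τ₀ : ℝ) (U : E × ℝ → ℝ) (t : ℝ) : ℝ :=
  Real.exp ((8 * a + 2) * R ^ 2 * t - (2 * a + n / 2) * Real.log (t + τ₀)) *
    ((t + τ₀) * gDir τ₀ U t - a * (1 - 4 * R ^ 2 * (t + τ₀)) * gMass τ₀ U t)

theorem Approx.exists_hasDerivAt_freq {R C τ₀ a : ℝ} {U : E × ℝ → ℝ} {κ : E → ℝ}
    (h : Approx R C τ₀ U κ) (hτ₀ : 0 < τ₀) (ha : 1 ≤ a) {t : ℝ}
    (ht : t ∈ Icc 0 (1 / (4 * R ^ 2))) :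
    ∃ d, HasDerivAt (freq R a τ₀ U) d t ∧
      Real.exp ((8 * a + 2) * R ^ 2 * t - (2 * a + n / 2) * Real.log (t + τ₀)) *
        (a * R ^ 2 * gMass τ₀ U t -
          (t + τ₀) * (C * R ^ 2 * Real.exp (-9 / (4 * (t + τ₀))))) ≤ d := by
  have hτ : 0 < t + τ₀ := by linarith [ht.1]
  obtain ⟨d, hd, hd'⟩ := exists_hasDerivAt_frequency h.smooth (r := 5)
    (fun x t hx => h.zero x t (by linarith)) h.cont h.zero' ha hτ (h.bound t ht)
  have h1 : HasDerivAt (fun s : ℝ => s + τ₀) 1 t := (hasDerivAt_id t).add_const τ₀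
  have h2 := (((hasDerivAt_id t).const_mul ((8 * a + 2) * R ^ 2)).sub
    ((h1.log hτ.ne').const_mul (2 * a + n / 2))).exp
  refine ⟨_, h2.mul hd, ?_⟩
  simp only [Pi.sub_apply, id]
  set m := Real.exp ((8 * a + 2) * R ^ 2 * t - (2 * a + n / 2) * Real.log (t + τ₀))
  have hm : 0 < m := Real.exp_pos _
  have hsm := h.small (t + τ₀) (by linarith [ht.1])
  have h3 := mul_le_mul_of_nonneg_left hsm hτ.le
  have h4 := mul_le_mul_of_nonneg_left (show _ ≤ _ from
    (sub_le_sub_left h3 (a * R ^ 2 * gMass τ₀ U t)).trans hd') hm.le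
  refine h4.trans (le_of_eq ?_)
  ring

theorem mul_log_inv_le {p τ q : ℝ} (hp : 0 < p) (hτ : 0 < τ) (hq : 0 < q) :
    -(p * Real.log τ) ≤ p / (q * τ) - p + p * Real.log q := by
  have h := Real.log_le_sub_one_of_pos (show 0 < 1 / (q * τ) by positivity)
  rw [one_div, Real.log_inv, Real.log_mul hq.ne' hτ.ne'] at h
  have := mul_le_mul_of_nonneg_left h hp.le
  rw [div_eq_mul_inv]
  linarith

set_option maxHeartbeats 2000000 in
theorem Approx.gMass_zero_ge {R C θ ε : ℝ} {U : E × ℝ → ℝ} {κ : E → ℝ}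
    (h : Approx R C (ε / (8 * R ^ 2)) U κ) (hR : 1 ≤ R)
    (hC : volume.real (closedBall (0 : E) 4) ≤ C)
    (hmass : θ ^ 2 / 2 * (R ^ n)⁻¹ ≤ ∫ x in ball (0 : E) 1, U (x, 0) ^ 2)
    (hn : (n : ℝ) / 2 ≤ R ^ 2)
    (hlarge : (1 + 2 * C) * R ^ n ≤ θ ^ 2 / 6 * Real.exp (R ^ 2 / 12))
    (hlarge' : 5 * (1 + 2 * C) * R ^ 2 ≤ Real.exp (2 * R ^ 2 / 3))
    (hε : 0 < ε) (hε' : ε ≤ 1 / 600) :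
    Real.exp ((2000 * R ^ 2 + n / 2) * Real.log ε) ≤ gMass (ε / (8 * R ^ 2)) U 0 := by
  have hR0 : 0 < R := by linarith
  have hR2 : 1 ≤ R ^ 2 := one_le_pow₀ hR
  have hC0 : 0 ≤ C := measureReal_nonneg.trans hC
  set τ₀ := ε / (8 * R ^ 2) with hτ₀
  set a := 1000 * R ^ 2 with ha
  set p := 2 * a + n / 2 with hp
  have hn0 : (0 : ℝ) ≤ n := n.cast_nonneg
  have hpl : 2000 * R ^ 2 ≤ p := by rw [hp, ha]; linarith
  have hpu : p ≤ 2001 * R ^ 2 := by rw [hp, ha]; linarith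
  have hp0 : 0 < p := by linarith
  have hτ₀0 : 0 < τ₀ := by positivity
  have hτ₀R : τ₀ ≤ 1 / R ^ 2 := by
    rw [hτ₀, div_le_div_iff₀ (by positivity) (by positivity)]; nlinarith
  have hτ₀p : τ₀ ≤ 1 / (2 * p) := by
    rw [hτ₀, div_le_div_iff₀ (by positivity) (by positivity)]; nlinarith
  have hpR : 20 / p ≤ 1 / (100 * R ^ 2) := by
    rw [div_le_div_iff₀ (by positivity) (by positivity)]; nlinarith
  have hpR' : 1 / (100 * R ^ 2) ≤ 1 / (4 * R ^ 2) := by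
    rw [div_le_div_iff₀ (by positivity) (by positivity)]; nlinarith
  have hp1 : 1 / (2 * p) + 1 / (2 * p) = 1 / p := by field_simp; norm_num
  have hp2 : 20 / p = 20 * (1 / p) := by ring
  have hp3 : 0 < 1 / (2 * p) := by positivity
  have hp4 : 20 / p ≤ 1 := hpR.trans (by
    rw [div_le_one (by positivity)]; nlinarith)
  have ht : ∀ t, 0 ≤ t → t ≤ 20 / p - τ₀ → t ∈ Icc 0 (1 / (4 * R ^ 2)) := fun t h0 h1 =>
    ⟨h0, by linarith⟩
  have hgrow : ∀ t, t ≤ 20 / p - τ₀ → (8 * a + 2) * R ^ 2 * t ≤ p / 20 := fun t h1 => by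
    have h2 : t ≤ 1 / (100 * R ^ 2) := by linarith
    rw [le_div_iff₀ (by positivity)] at h2
    rw [ha]
    have h3 : 0 < 8 * (1000 * R ^ 2) + 2 := by positivity
    nlinarith
  set X := Real.exp (p * Real.log p - p) with hX
  set Y := Real.exp (-p / 2) with hY
  have hX0 : 0 < X := Real.exp_pos _
  have hY0 : 0 < Y := Real.exp_pos _
  have hD : ∀ t, 0 ≤ t → t ≤ 20 / p - τ₀ → ∃ d, HasDerivAt (freq R a τ₀ U) d t ∧
      Real.exp ((8 * a + 2) * R ^ 2 * t - p * Real.log (t + τ₀)) * (a * R ^ 2 * gMass τ₀ U t) -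
        C * R ^ 2 * (X * Y) ≤ d := by
    intro t h0 h1
    obtain ⟨d, hd, hd'⟩ := h.exists_hasDerivAt_freq (a := a) hτ₀0 (by linarith) (ht t h0 h1)
    refine ⟨d, hd, le_trans ?_ hd'⟩
    have hτ : 0 < t + τ₀ := by linarith
    have hτ1 : t + τ₀ ≤ 1 := by linarith
    have h2 : Real.exp ((8 * a + 2) * R ^ 2 * t - p * Real.log (t + τ₀)) *
        Real.exp (-9 / (4 * (t + τ₀))) ≤ X * Y := by
      rw [hX, hY, ← Real.exp_add, ← Real.exp_add]
      refine Real.exp_le_exp.2 ?_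
      have h3 := mul_log_inv_le hp0 hτ (show 0 < 4 * p / 9 by positivity)
      have h4 : p / (4 * p / 9 * (t + τ₀)) = -(-9 / (4 * (t + τ₀))) := by field_simp
      have h5 : Real.log (4 * p / 9) ≤ Real.log p - 5 / 9 := by
        have : Real.log (4 * p / 9) = Real.log p + Real.log (4 / 9) := by
          rw [← Real.log_mul hp0.ne' (by norm_num)]; ring_nf
        have h6 := Real.log_le_sub_one_of_pos (show (0 : ℝ) < 4 / 9 by norm_num)
        rw [this]; linarith
      have h6 := mul_le_mul_of_nonneg_left h5 hp0.le
      have h7 := hgrow t h1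
      rw [h4] at h3
      have h8 : p * (Real.log p - 5 / 9) = p * Real.log p - p * (5 / 9) := by ring
      linarith
    have h3 : 0 ≤ C * R ^ 2 := by positivity
    have h4 : (t + τ₀) * (Real.exp ((8 * a + 2) * R ^ 2 * t - p * Real.log (t + τ₀)) *
        Real.exp (-9 / (4 * (t + τ₀)))) ≤ X * Y :=
      (mul_le_of_le_one_left (by positivity) hτ1).trans h2
    have h5 := mul_le_mul_of_nonneg_left h4 h3
    linarith
  have hm0 : ∀ t, 0 ≤ Real.exp ((8 * a + 2) * R ^ 2 * t - p * Real.log (t + τ₀)) *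
      (a * R ^ 2 * gMass τ₀ U t) := fun t => by
    have := gMass_nonneg τ₀ U t
    positivity
  choose! d hd hd' using hD
  have s1 : freq R a τ₀ U 0 + -(C * R ^ 2 * (X * Y)) * (1 / (2 * p) - τ₀ - 0) ≤
      freq R a τ₀ U (1 / (2 * p) - τ₀) :=
    add_mul_le_of_hasDerivAt (by linarith) (fun t ht => hd t ht.1 (by linarith [ht.2]))
      fun t ht => by linarith [hd' t ht.1 (by linarith [ht.2]), hm0 t]
  have s3 : freq R a τ₀ U (1 / p - τ₀) + -(C * R ^ 2 * (X * Y)) * (20 / p - τ₀ - (1 / p - τ₀)) ≤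
      freq R a τ₀ U (20 / p - τ₀) :=
    add_mul_le_of_hasDerivAt (by linarith)
      (fun t ht => hd t (by linarith [ht.1]) (by linarith [ht.2]))
      fun t ht => by linarith [hd' t (by linarith [ht.1]) (by linarith [ht.2]), hm0 t]
  have s2 : freq R a τ₀ U (1 / (2 * p) - τ₀) +
      (X * (a * R ^ 2 * Real.exp (-R ^ 2 / 3)) - C * R ^ 2 * (X * Y)) *
        (1 / p - τ₀ - (1 / (2 * p) - τ₀)) ≤ freq R a τ₀ U (1 / p - τ₀) := by
    refine add_mul_le_of_hasDerivAt (by linarith)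
      (fun t ht => hd t (by linarith [ht.1]) (by linarith [ht.2])) fun t ht' => ?_
    have ht0 : 0 ≤ t := by linarith [ht'.1]
    have ht1 : t ≤ 20 / p - τ₀ := by linarith [ht'.2]
    have hτ : 0 < t + τ₀ := by linarith
    refine le_trans (sub_le_sub_right ?_ _) (hd' t ht0 ht1)
    have h1 := gMass_ge_of_large h hR hC hτ₀0 hτ₀R hmass hlarge (ht t ht0 ht1)
    have h2 : X ≤ Real.exp ((8 * a + 2) * R ^ 2 * t - p * Real.log (t + τ₀)) *
        Real.exp (-1 / (2 * (t + τ₀))) := by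
      rw [hX, ← Real.exp_add]
      refine Real.exp_le_exp.2 ?_
      have h3 : Real.log (t + τ₀) ≤ -Real.log p := by
        rw [← Real.log_inv]
        refine Real.log_le_log hτ ?_
        rw [← one_div]; linarith [ht'.2]
      have h4 : -p ≤ -1 / (2 * (t + τ₀)) := by
        rw [neg_div, neg_le_neg_iff, div_le_iff₀ (by positivity)]
        have : 1 / (2 * p) ≤ t + τ₀ := by linarith [ht'.1]
        rw [div_le_iff₀ (by positivity)] at this
        linarith
      have h5 := mul_le_mul_of_nonneg_left h3 hp0.le
      have h6 : 0 ≤ (8 * a + 2) * R ^ 2 * t := by positivity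
      linarith
    have h3 : 0 ≤ a * R ^ 2 := by positivity
    calc _ ≤ (Real.exp ((8 * a + 2) * R ^ 2 * t - p * Real.log (t + τ₀)) *
        Real.exp (-1 / (2 * (t + τ₀)))) * (a * R ^ 2 * Real.exp (-R ^ 2 / 3)) := by gcongr
      _ = Real.exp ((8 * a + 2) * R ^ 2 * t - p * Real.log (t + τ₀)) *
        (a * R ^ 2 * (Real.exp (-1 / (2 * (t + τ₀))) * Real.exp (-R ^ 2 / 3))) := by ring
      _ ≤ _ := by gcongr
  have s4 : freq R a τ₀ U (20 / p - τ₀) ≤ C * R ^ 2 * (X * Y) := by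
    have hmem := ht (20 / p - τ₀) (by linarith) le_rfl
    have h1 := h.gDir_le _ hmem
    have h2 := gDir_nonneg τ₀ U (20 / p - τ₀)
    have h3 := gMass_nonneg τ₀ U (20 / p - τ₀)
    have h4 : Real.exp ((8 * a + 2) * R ^ 2 * (20 / p - τ₀) - p * Real.log (20 / p)) ≤ X * Y := by
      rw [hX, hY, ← Real.exp_add]
      refine Real.exp_le_exp.2 ?_
      have h5 := hgrow _ (le_refl (20 / p - τ₀))
      have h6 : Real.log (20 / p) = Real.log 20 - Real.log p :=
        Real.log_div (by norm_num) hp0.ne'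
      have h7 : 2 ≤ Real.log 20 := by
        rw [Real.le_log_iff_exp_le (by norm_num), show (2 : ℝ) = 1 + 1 by norm_num, Real.exp_add]
        nlinarith [Real.exp_one_lt_three, Real.exp_pos 1]
      rw [h6]
      nlinarith
    have h5 : 0 ≤ a * (1 - 4 * R ^ 2 * (20 / p)) := by
      have := (le_div_iff₀ (by positivity)).1 hpR
      have : 0 ≤ 1 - 4 * R ^ 2 * (20 / p) := by linarith
      positivity
    unfold freq
    rw [sub_add_cancel]
    change Real.exp ((8 * a + 2) * R ^ 2 * (20 / p - τ₀) - p * Real.log (20 / p)) * _ ≤ _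
    have h6 : 20 / p * gDir τ₀ U (20 / p - τ₀) -
        a * (1 - 4 * R ^ 2 * (20 / p)) * gMass τ₀ U (20 / p - τ₀) ≤ C * R ^ 2 := by
      have := mul_nonneg h5 h3
      have := mul_le_of_le_one_left h2 hp4
      linarith
    calc _ ≤ Real.exp ((8 * a + 2) * R ^ 2 * (20 / p - τ₀) - p * Real.log (20 / p)) *
          (C * R ^ 2) := by gcongr
      _ ≤ (X * Y) * (C * R ^ 2) := by gcongr
      _ = _ := by ring
  have s0 : -(Real.exp (-(p * Real.log τ₀)) * (a * gMass τ₀ U 0)) ≤ freq R a τ₀ U 0 := by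
    have h2 := gDir_nonneg τ₀ U 0
    have h3 := gMass_nonneg τ₀ U 0
    unfold freq
    rw [zero_add, mul_zero, zero_sub, ← mul_neg]
    refine mul_le_mul_of_nonneg_left ?_ (Real.exp_pos _).le
    have h4 : 0 ≤ τ₀ * gDir τ₀ U 0 := by positivity
    have h5 : 0 ≤ a * (4 * R ^ 2 * τ₀) * gMass τ₀ U 0 := by positivity
    linarith
  have hmain : X * Real.exp (-R ^ 2) ≤ Real.exp (-(p * Real.log τ₀)) * (a * gMass τ₀ U 0) := by
    have h1 : X * (a * R ^ 2 * Real.exp (-R ^ 2 / 3)) * (1 / (2 * p)) -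
        C * R ^ 2 * (X * Y) * (20 / p - τ₀) - C * R ^ 2 * (X * Y) ≤
        Real.exp (-(p * Real.log τ₀)) * (a * gMass τ₀ U 0) := by
      rw [← hp1] at *
      linarith
    have h2 : C * R ^ 2 * (X * Y) * (20 / p - τ₀) ≤ C * R ^ 2 * (X * Y) :=
      mul_le_of_le_one_right (by positivity) (by linarith)
    have h3 : 1 / 5 ≤ a * R ^ 2 * (1 / (2 * p)) := by
      rw [mul_one_div, le_div_iff₀ (by positivity), ha]
      nlinarith
    have h4 : X * (1 / 5 * Real.exp (-R ^ 2 / 3)) ≤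
        X * (a * R ^ 2 * Real.exp (-R ^ 2 / 3)) * (1 / (2 * p)) := by
      have := mul_le_mul_of_nonneg_right h3 (Real.exp_pos (-R ^ 2 / 3)).le
      have := mul_le_mul_of_nonneg_left this hX0.le
      linarith
    have h5 : Y ≤ Real.exp (-R ^ 2) := Real.exp_le_exp.2 (by linarith)
    have h6 : (1 + 2 * C) * R ^ 2 * Real.exp (-R ^ 2) * 5 ≤ Real.exp (-R ^ 2 / 3) := by
      have e : Real.exp (-R ^ 2 / 3) = Real.exp (2 * R ^ 2 / 3) * Real.exp (-R ^ 2) := by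
        rw [← Real.exp_add]; ring_nf
      rw [e]
      have := mul_le_mul_of_nonneg_right hlarge' (Real.exp_pos (-R ^ 2)).le
      linarith
    have h7 : X * (Real.exp (-R ^ 2) + 2 * (C * R ^ 2 * Y)) ≤
        X * (1 / 5 * Real.exp (-R ^ 2 / 3)) := by
      refine mul_le_mul_of_nonneg_left ?_ hX0.le
      have h8 : C * R ^ 2 * Y ≤ C * R ^ 2 * Real.exp (-R ^ 2) := by gcongr
      have h9 : Real.exp (-R ^ 2) ≤ R ^ 2 * Real.exp (-R ^ 2) :=
        le_mul_of_one_le_left (Real.exp_pos _).le hR2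
      linarith
    linarith
  have hlog : Real.log ε + 5 ≤ Real.log p + Real.log τ₀ := by
    rw [← Real.log_mul hp0.ne' hτ₀0.ne']
    have h1 : 5 ≤ Real.log 250 := by
      rw [Real.le_log_iff_exp_le (by norm_num)]
      have : Real.exp 5 = Real.exp 1 ^ 5 := by rw [← Real.exp_nat_mul]; norm_num
      rw [this]
      calc Real.exp 1 ^ 5 ≤ 2.7182818286 ^ 5 :=
            pow_le_pow_left₀ (Real.exp_pos _).le Real.exp_one_lt_d9.le 5
        _ ≤ 250 := by norm_num
    have h2 : ε * 250 ≤ p * τ₀ := by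
      have : p * τ₀ = p * ε / (8 * R ^ 2) := by rw [hτ₀]; ring
      rw [this, le_div_iff₀ (by positivity)]
      nlinarith
    calc Real.log ε + 5 ≤ Real.log ε + Real.log 250 := by linarith
      _ = Real.log (ε * 250) := (Real.log_mul hε.ne' (by norm_num)).symm
      _ ≤ _ := Real.log_le_log (by positivity) h2
  have ha0 : 0 < a := by positivity
  have hfin : Real.exp (p * Real.log ε) * Real.exp (-(p * Real.log τ₀)) * a ≤
      X * Real.exp (-R ^ 2) := by
    have h1 : a ≤ Real.exp a := by linarith [Real.add_one_le_exp a]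
    calc _ ≤ Real.exp (p * Real.log ε) * Real.exp (-(p * Real.log τ₀)) * Real.exp a := by gcongr
      _ ≤ _ := by
        rw [hX, ← Real.exp_add, ← Real.exp_add, ← Real.exp_add]
        refine Real.exp_le_exp.2 ?_
        have := mul_le_mul_of_nonneg_left hlog hp0.le
        linarith
  have he : 2000 * R ^ 2 + n / 2 = p := by rw [hp, ha]; ring
  rw [he]
  have h1 := hfin.trans hmain
  have h2 : Real.exp (p * Real.log ε) * (Real.exp (-(p * Real.log τ₀)) * a) ≤
      gMass τ₀ U 0 * (Real.exp (-(p * Real.log τ₀)) * a) := by linarith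
  exact le_of_mul_le_mul_right h2 (by positivity)

end Doubling

section Maximum

variable {n : ℕ}

local notation "E" => EuclideanSpace ℝ (Fin n)

theorem deriv_deriv_nonpos_of_isLocalMax {g : ℝ → ℝ} {a : ℝ} (h : IsLocalMax g a)
    (hc : ContinuousAt g a) : deriv (deriv g) a ≤ 0 := by
  by_contra! hpos
  have hmin := isLocalMin_of_deriv_deriv_pos hpos h.deriv_eq_zero hc
  have heq : g =ᶠ[𝓝 a] fun _ => g a := by
    filter_upwards [h, hmin] with x h1 h2 using le_antisymm h1 h2
  have h0 : deriv g =ᶠ[𝓝 a] fun _ => 0 := heq.deriv.trans (by simp)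
  rw [h0.deriv_eq] at hpos
  simp at hpos

theorem hasDerivAt_line {f : E → ℝ} (hf : Differentiable ℝ f) (i : Fin n) (x : E) (r : ℝ) :
    HasDerivAt (fun s : ℝ => f (x + s • EuclideanSpace.single i (1 : ℝ)))
      (pd i f (x + r • EuclideanSpace.single i (1 : ℝ))) r := by
  have h1 : HasDerivAt (fun s : ℝ => x + s • (EuclideanSpace.single i (1 : ℝ) : E))
      (EuclideanSpace.single i (1 : ℝ)) r := by
    simpa using ((hasDerivAt_id r).smul_const (EuclideanSpace.single i (1 : ℝ) : E)).const_add x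
  exact (hf _).hasFDerivAt.comp_hasDerivAt r h1

theorem hasDerivAt_line_neg {f : E → ℝ} (hf : Differentiable ℝ f) (i : Fin n) (x : E) (r : ℝ) :
    HasDerivAt (fun s : ℝ => f (x - s • EuclideanSpace.single i (1 : ℝ)))
      (-pd i f (x - r • EuclideanSpace.single i (1 : ℝ))) r := by
  have h1 := (hasDerivAt_line hf i x (-r)).scomp r (hasDerivAt_neg r)
  simpa [Function.comp_def, sub_eq_add_neg] using h1

theorem pd_pd_nonpos_of_isLocalMax {f : E → ℝ} (hf : ContDiff ℝ 2 f) {x : E}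
    (h : IsLocalMax f x) (i : Fin n) : pd i (pd i f) x ≤ 0 := by
  have hd : Differentiable ℝ f := hf.differentiable (by norm_num)
  have hd' : Differentiable ℝ (pd i f) :=
    (hf.pd i (m := 1) (by norm_num)).differentiable (by norm_num)
  have h1 : deriv (fun s : ℝ => f (x + s • EuclideanSpace.single i (1 : ℝ))) =
      fun s => pd i f (x + s • EuclideanSpace.single i (1 : ℝ)) :=
    funext fun s => (hasDerivAt_line hd i x s).deriv
  have hcont : Continuous fun s : ℝ => x + s • (EuclideanSpace.single i (1 : ℝ) : E) := by
    fun_prop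
  have h2 := deriv_deriv_nonpos_of_isLocalMax
    (g := fun s : ℝ => f (x + s • EuclideanSpace.single i (1 : ℝ))) (a := 0) ?_
    (hf.continuous.comp hcont).continuousAt
  · rw [h1, (hasDerivAt_line hd' i x 0).deriv] at h2
    simpa using h2
  · have : IsLocalMax f (x + (0 : ℝ) • (EuclideanSpace.single i (1 : ℝ) : E)) := by simpa using h
    exact this.comp_continuous (g := fun s : ℝ => x + s • (EuclideanSpace.single i (1 : ℝ) : E))
      hcont.continuousAt

theorem slap_nonpos_of_isLocalMax {f : E → ℝ} (hf : ContDiff ℝ 2 f) {x : E}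
    (h : IsLocalMax f x) : slap f x ≤ 0 :=
  Finset.sum_nonpos fun i _ => pd_pd_nonpos_of_isLocalMax hf h i

theorem nonpos_of_hasDerivWithinAt_Ici {f : ℝ → ℝ} {f' t b : ℝ} (htb : t < b)
    (hf : HasDerivWithinAt f f' (Ici t) t) (hmax : ∀ s ∈ Ioo t b, f s ≤ f t) : f' ≤ 0 := by
  have h1 := (hasDerivWithinAt_iff_tendsto_slope' (by simp)).1 hf.Ioi_of_Ici
  refine le_of_tendsto h1 ?_
  filter_upwards [Ioo_mem_nhdsGT htb] with s hs
  rw [slope_def_field]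
  exact div_nonpos_of_nonpos_of_nonneg (sub_nonpos.2 (hmax s hs)) (sub_nonneg.2 hs.1.le)

end Maximum

section Strip

variable {n : ℕ}

local notation "E" => EuclideanSpace ℝ (Fin n)

/-- A function of space and time, `C²` in space, continuous and right differentiable in time,
and supported in a fixed ball. -/
structure Strip (a b : ℝ) (Z Zt : E × ℝ → ℝ) : Prop where
  smooth : ∀ t ∈ Icc a b, ContDiff ℝ 2 fun x => Z (x, t)
  deriv : ∀ x, ∀ t ∈ Ico a b, HasDerivWithinAt (fun s => Z (x, s)) (Zt (x, t)) (Ici t) t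
  zero : ∀ x t, 4 ≤ ‖x‖ → Z (x, t) = 0
  cont : Continuous Z

theorem pd_comp_add_right (i : Fin n) (f : E → ℝ) (v : E) :
    pd i (fun x => f (x + v)) = fun x => pd i f (x + v) := by
  ext x
  simp [pd, fderiv_comp_add_right]

theorem Strip.sub_le {a b η C B : ℝ} {Z Zt : E × ℝ → ℝ} (h : Strip a b Z Zt) (hab : a < b)
    (hη : 0 < η) (hZ : ∀ x, ∀ t ∈ Icc a b, |Z (x, t)| ≤ η)
    (hL : ∀ x, ∀ t ∈ Ico a b, |Zt (x, t) + slap (fun y => Z (y, t)) x| ≤ C)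
    (hB : 2 * C + 2 * η / (b - a) < 2 * B) (hB' : 2 * η ≤ B) (j : Fin n) (x : E) {r : ℝ}
    (hr : r ∈ Icc 0 (√(2 * η * B) / B)) :
    Z (x + r • EuclideanSpace.single j (1 : ℝ), a) -
      Z (x - r • EuclideanSpace.single j (1 : ℝ), a) ≤
      2 * √(2 * η * B) * r - B * r ^ 2 := by
  have hB0 : 0 < B := by linarith
  set S := √(2 * η * B) with hS
  have hS2 : S ^ 2 = 2 * η * B := Real.sq_sqrt (by positivity)
  have hS0 : 0 < S := Real.sqrt_pos.2 (by positivity)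
  set r₀ := S / B with hr₀
  have hr₀0 : 0 < r₀ := by positivity
  have hr₀1 : r₀ ≤ 1 := by
    rw [hr₀, div_le_one hB0]
    refine abs_le_of_sq_le_sq' ?_ hB0.le |>.2
    rw [hS2]; nlinarith
  set c := 2 * η / (b - a) with hc
  have hcb : c * (b - a) = 2 * η := div_mul_cancel₀ _ (by linarith)
  have hc0 : 0 < c := by rw [hc]; exact div_pos (by linarith) (by linarith)
  set e : E := EuclideanSpace.single j (1 : ℝ) with he
  have hne : ∀ s ∈ Icc 0 r₀, ‖s • e‖ ≤ 1 := fun s hs => by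
    rw [norm_smul, he, PiLp.norm_single, norm_one, mul_one, Real.norm_of_nonneg hs.1]
    exact hs.2.trans hr₀1
  have hfar : ∀ y : E, 6 ≤ ‖y‖ → ∀ s ∈ Icc 0 r₀, ∀ t,
      Z (y + s • e, t) = 0 ∧ Z (y - s • e, t) = 0 := fun y hy s hs t => by
    have h1 := hne s hs
    have h2 := norm_sub_norm_le y (-(s • e))
    have h3 := norm_sub_norm_le y (s • e)
    rw [norm_neg, sub_neg_eq_add] at h2
    exact ⟨h.zero _ _ (by linarith), h.zero _ _ (by linarith)⟩
  have hpar : ∀ s ∈ Icc 0 r₀, 0 ≤ 2 * S * s - B * s ^ 2 := fun s hs => by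
    have := hs.2
    rw [hr₀, le_div_iff₀ hB0] at this
    nlinarith [hs.1]
  have hpar₀ : 2 * S * r₀ - B * r₀ ^ 2 = 2 * η := by
    rw [hr₀]; field_simp; linarith
  set Ψ : E × ℝ × ℝ → ℝ := fun p => Z (p.1 + p.2.1 • e, p.2.2) - Z (p.1 - p.2.1 • e, p.2.2) -
    (2 * S * p.2.1 - B * p.2.1 ^ 2) - c * (p.2.2 - a) with hΨ
  have hΨc : Continuous Ψ := by
    have := h.cont
    fun_prop
  have hK : IsCompact (closedBall (0 : E) 6 ×ˢ Icc 0 r₀ ×ˢ Icc a b) :=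
    (isCompact_closedBall _ _).prod (isCompact_Icc.prod isCompact_Icc)
  obtain ⟨⟨y, s, t⟩, hmem, hmax⟩ := hK.exists_isMaxOn
    ⟨(0, 0, a), by simp [hr₀0.le, hab.le]⟩ hΨc.continuousOn
  obtain ⟨hy, hs, ht⟩ : y ∈ closedBall (0 : E) 6 ∧ s ∈ Icc 0 r₀ ∧ t ∈ Icc a b := hmem
  have hmax' : ∀ y' ∈ closedBall (0 : E) 6, ∀ s' ∈ Icc 0 r₀, ∀ t' ∈ Icc a b,
      Ψ (y', s', t') ≤ Ψ (y, s, t) := fun y' h1 s' h2 t' h3 => hmax ⟨h1, h2, h3⟩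
  by_cases hx : 6 ≤ ‖x‖
  · obtain ⟨h1, h2⟩ := hfar x hx r hr a
    rw [h1, h2]
    linarith [hpar r hr]
  suffices hneg : Ψ (y, s, t) ≤ 0 by
    have := (hmax' x (by simp; linarith) r hr a ⟨le_rfl, hab.le⟩).trans hneg
    simp only [hΨ, sub_self, mul_zero, sub_zero] at this
    linarith
  by_contra! hpos
  have hP := hpar s hs
  have hct : 0 ≤ c * (t - a) := mul_nonneg hc0.le (by linarith [ht.1])
  have hz1 := abs_le.1 (hZ (y + s • e) t ht)
  have hz2 := abs_le.1 (hZ (y - s • e) t ht)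
  have hpos' := hpos
  simp only [hΨ] at hpos'
  have hs0 : 0 < s := by
    refine lt_of_le_of_ne hs.1 fun h0 => ?_
    rw [← h0] at hpos'
    simp at hpos'
    linarith
  have hs1 : s < r₀ := by
    refine lt_of_le_of_ne hs.2 fun h0 => ?_
    rw [h0] at hP hpos' hz1 hz2
    linarith
  have htb : t < b := by
    refine lt_of_le_of_ne ht.2 fun h0 => ?_
    rw [h0] at hpos' hz1 hz2
    linarith
  have hy6 : ‖y‖ < 6 := by
    by_contra! h0
    obtain ⟨h1, h2⟩ := hfar y h0 s hs t
    rw [h1, h2] at hpos'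
    linarith
  have hsm := h.smooth t ht
  have hd : Differentiable ℝ fun x => Z (x, t) := hsm.differentiable (by norm_num)
  have hd' : Differentiable ℝ (pd j fun x => Z (x, t)) :=
    (hsm.pd j (m := 1) (by norm_num)).differentiable (by norm_num)
  have htime : Zt (y + s • e, t) - Zt (y - s • e, t) - c ≤ 0 := by
    have h1 := (((h.deriv (y + s • e) t ⟨ht.1, htb⟩).sub
      (h.deriv (y - s • e) t ⟨ht.1, htb⟩)).sub_const (2 * S * s - B * s ^ 2)).sub
      ((((hasDerivAt_id t).sub_const a).const_mul c).hasDerivWithinAt (s := Ici t))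
    rw [mul_one] at h1
    refine nonpos_of_hasDerivWithinAt_Ici htb h1 fun t' ht' => ?_
    exact hmax' y hy s hs t' ⟨ht.1.trans ht'.1.le, ht'.2.le⟩
  have hspace : ∀ i, pd i (pd i fun x => Z (x, t)) (y + s • e) -
      pd i (pd i fun x => Z (x, t)) (y - s • e) ≤ 0 := by
    intro i
    have hp : ContDiff ℝ 2 fun x => Z (x + s • e, t) :=
      hsm.comp (contDiff_id.add contDiff_const)
    have hq : ContDiff ℝ 2 fun x => Z (x + -(s • e), t) :=
      hsm.comp (contDiff_id.add contDiff_const)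
    have h1 : IsLocalMax (fun x => Z (x + s • e, t) - Z (x + -(s • e), t)) y := by
      filter_upwards [isOpen_ball.mem_nhds (show y ∈ ball (0 : E) 6 by simpa using hy6)]
        with y' hy'
      have := hmax' y' (ball_subset_closedBall hy') s hs t ht
      simp only [hΨ] at this
      simp only [← sub_eq_add_neg]
      linarith
    have h2 := pd_pd_nonpos_of_isLocalMax (hp.sub hq) h1 i
    have h3 : pd i (fun x => Z (x + s • e, t) - Z (x + -(s • e), t)) =
        fun x => pd i (fun x => Z (x, t)) (x + s • e) -
          pd i (fun x => Z (x, t)) (x + -(s • e)) := by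
      ext x
      rw [pd_sub i (hp.differentiable (by norm_num) x) (hq.differentiable (by norm_num) x),
        pd_comp_add_right i (fun x => Z (x, t)), pd_comp_add_right i (fun x => Z (x, t))]
    have hdi : ∀ v : E, Differentiable ℝ fun x' => pd i (fun x => Z (x, t)) (x' + v) := fun v =>
      ((hsm.pd i (m := 1) (by norm_num)).differentiable (by norm_num)).comp
        (differentiable_id.add_const v)
    rw [h3, pd_sub i (hdi _ y) (hdi _ y),
      pd_comp_add_right, pd_comp_add_right] at h2
    simpa only [← sub_eq_add_neg] using h2
  have hrad : pd j (pd j fun x => Z (x, t)) (y + s • e) -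
      pd j (pd j fun x => Z (x, t)) (y - s • e) + 2 * B ≤ 0 := by
    have h1 : ∀ s', HasDerivAt (fun s' : ℝ => Z (y + s' • e, t) - Z (y - s' • e, t) -
        (2 * S * s' - B * s' ^ 2))
        (pd j (fun x => Z (x, t)) (y + s' • e) + pd j (fun x => Z (x, t)) (y - s' • e) -
          (2 * S - 2 * B * s')) s' := fun s' => by
      have h2 := ((hasDerivAt_id s').const_mul (2 * S)).sub
        (((hasDerivAt_id s').pow 2).const_mul B)
      refine (((hasDerivAt_line hd j y s').sub (hasDerivAt_line_neg hd j y s')).sub h2).congr_deriv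
        ?_
      simp only [← he, id]; ring
    have h2 : HasDerivAt (fun s' => pd j (fun x => Z (x, t)) (y + s' • e) +
        pd j (fun x => Z (x, t)) (y - s' • e) - (2 * S - 2 * B * s'))
        (pd j (pd j fun x => Z (x, t)) (y + s • e) -
          pd j (pd j fun x => Z (x, t)) (y - s • e) + 2 * B) s := by
      have h2 := ((hasDerivAt_id s).const_mul (2 * B)).const_sub (2 * S)
      refine (((hasDerivAt_line hd' j y s).add (hasDerivAt_line_neg hd' j y s)).sub h2).congr_deriv
        ?_
      simp only [← he]; ring
    have h3 : IsLocalMax (fun s' : ℝ => Z (y + s' • e, t) - Z (y - s' • e, t) -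
        (2 * S * s' - B * s' ^ 2)) s := by
      filter_upwards [Ioo_mem_nhds hs0 hs1] with s' hs'
      have := hmax' y hy s' ⟨hs'.1.le, hs'.2.le⟩ t ht
      simp only [hΨ] at this
      linarith
    have h4 := deriv_deriv_nonpos_of_isLocalMax h3 (h1 s).continuousAt
    rwa [funext fun s' => (h1 s').deriv, h2.deriv] at h4
  have hsum : slap (fun x => Z (x, t)) (y + s • e) - slap (fun x => Z (x, t)) (y - s • e) ≤
      -(2 * B) := by
    rw [slap_eq_sum_pd, slap_eq_sum_pd, ← Finset.sum_sub_distrib,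
      ← Finset.add_sum_erase _ _ (Finset.mem_univ j)]
    have := Finset.sum_nonpos (s := Finset.univ.erase j) fun i _ => hspace i
    linarith
  have hL1 := abs_le.1 (hL (y + s • e) t ⟨ht.1, htb⟩)
  have hL2 := abs_le.1 (hL (y - s • e) t ⟨ht.1, htb⟩)
  linarith

theorem Strip.pd_le {a b η C B : ℝ} {Z Zt : E × ℝ → ℝ} (h : Strip a b Z Zt) (hab : a < b)
    (hη : 0 < η) (hZ : ∀ x, ∀ t ∈ Icc a b, |Z (x, t)| ≤ η)
    (hL : ∀ x, ∀ t ∈ Ico a b, |Zt (x, t) + slap (fun y => Z (y, t)) x| ≤ C)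
    (hB : 2 * C + 2 * η / (b - a) < 2 * B) (hB' : 2 * η ≤ B) (j : Fin n) (x : E) :
    pd j (fun y => Z (y, a)) x ≤ √(2 * η * B) := by
  have hB0 : 0 < B := by linarith
  have hd : Differentiable ℝ fun x => Z (x, a) :=
    (h.smooth a ⟨le_rfl, hab.le⟩).differentiable (by norm_num)
  have h1 := ((hasDerivAt_line hd j x 0).sub (hasDerivAt_line_neg hd j x 0)).sub
    ((hasDerivAt_id (0 : ℝ)).const_mul (2 * √(2 * η * B)))
  have h2 := nonpos_of_hasDerivWithinAt_Ici
    (show (0 : ℝ) < √(2 * η * B) / B from by positivity) h1.hasDerivWithinAt fun s hs => ?_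
  · simp at h2
    linarith
  · have := h.sub_le hab hη hZ hL hB hB' j x ⟨hs.1.le, hs.2.le⟩
    have : 0 ≤ B * s ^ 2 := by positivity
    simp
    linarith

end Strip

section Gradient

variable {n : ℕ}

local notation "E" => EuclideanSpace ℝ (Fin n)

theorem uniformContinuous_of_clamp {f : E × ℝ → ℝ} {T : ℝ} (hT : 0 ≤ T) (hf : Continuous f)
    (h0 : ∀ x t, 4 ≤ ‖x‖ → f (x, t) = 0) (hc : ∀ x t, f (x, t) = f (x, projIcc 0 T hT t)) :
    UniformContinuous f := by
  have h1 : UniformContinuous fun p : E × Icc (0 : ℝ) T => f (p.1, p.2) := by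
    refine HasCompactSupport.uniformContinuous_of_continuous ?_ (by fun_prop)
    refine HasCompactSupport.intro (K := closedBall (0 : E) 4 ×ˢ univ)
      ((isCompact_closedBall _ _).prod isCompact_univ) fun p hp => h0 _ _ ?_
    by_contra! h
    exact hp ⟨by simpa using h.le, mem_univ _⟩
  have h2 : UniformContinuous fun p : E × ℝ => (p.1, projIcc 0 T hT p.2) :=
    uniformContinuous_fst.prodMk
      ((LipschitzWith.projIcc hT).uniformContinuous.comp uniformContinuous_snd)
  have h3 : f = (fun p : E × Icc (0 : ℝ) T => f (p.1, p.2)) ∘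
      fun p : E × ℝ => (p.1, projIcc 0 T hT p.2) := funext fun p => hc p.1 p.2
  rw [h3]
  exact h1.comp h2

theorem Strip.shift_sub {T b s₁ s₂ : ℝ} {W Wt : E × ℝ → ℝ} (h : Strip 0 T W Wt)
    (h1 : 0 ≤ s₁) (h1' : b + s₁ ≤ T) (h2 : 0 ≤ s₂) (h2' : b + s₂ ≤ T) :
    Strip 0 b (fun p => W (p.1, p.2 + s₁) - W (p.1, p.2 + s₂))
      (fun p => Wt (p.1, p.2 + s₁) - Wt (p.1, p.2 + s₂)) where
  smooth t ht := (h.smooth (t + s₁) ⟨by linarith [ht.1], by linarith [ht.2]⟩).sub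
    (h.smooth (t + s₂) ⟨by linarith [ht.1], by linarith [ht.2]⟩)
  deriv x t ht := by
    have key : ∀ s, 0 ≤ s → b + s ≤ T →
        HasDerivWithinAt (fun r => W (x, r + s)) (Wt (x, t + s)) (Ici t) t := fun s hs hs' => by
      have hm : MapsTo (fun r => r + s) (Ici t) (Ici (t + s)) := fun r hr =>
        add_le_add_left (mem_Ici.1 hr) s
      have := (h.deriv x (t + s) ⟨by linarith [ht.1], by linarith [ht.2]⟩).scomp t
        ((hasDerivAt_id t).add_const s).hasDerivWithinAt hm
      rw [one_smul] at this
      exact this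
    exact (key s₁ h1 h1').sub (key s₂ h2 h2')
  zero x t hx := by simp [h.zero x _ hx]
  cont := by
    have := h.cont
    fun_prop

theorem slap_sub {f g : E → ℝ} (hf : ContDiff ℝ 2 f) (hg : ContDiff ℝ 2 g) (x : E) :
    slap (fun y => f y - g y) x = slap f x - slap g x := by
  simp only [slap_eq_sum_pd]
  rw [← Finset.sum_sub_distrib]
  refine Finset.sum_congr rfl fun i _ => ?_
  rw [show pd i (fun y => f y - g y) = fun y => pd i f y - pd i g y from funext fun y =>
    pd_sub i (hf.differentiable (by norm_num) y) (hg.differentiable (by norm_num) y)]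
  exact pd_sub i ((hf.pd i (m := 1) (by norm_num)).differentiable (by norm_num) x)
    ((hg.pd i (m := 1) (by norm_num)).differentiable (by norm_num) x)

theorem Strip.exists_pd_sub_le {T C ε : ℝ} {W Wt : E × ℝ → ℝ} (hT : 0 < T) (h : Strip 0 T W Wt)
    (hu : UniformContinuous W)
    (hL : ∀ x, ∀ t ∈ Ico 0 T, |Wt (x, t) + slap (fun y => W (y, t)) x| ≤ C) (j : Fin n)
    (hε : 0 < ε) : ∃ δ > 0, ∀ t ∈ Icc 0 (T / 2), ∀ s ∈ Icc 0 (T / 2), |t - s| < δ →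
      ∀ x, |pd j (fun y => W (y, t)) x - pd j (fun y => W (y, s)) x| ≤ ε := by
  have hC : 0 ≤ C := (abs_nonneg _).trans (hL 0 0 ⟨le_rfl, hT⟩)
  set B := 2 * C + 8 / T + 2 with hB
  have hB0 : 0 < B := by positivity
  set η := min 1 (ε ^ 2 / (2 * B)) with hη
  have hη0 : 0 < η := by positivity
  have hη1 : η ≤ 1 := min_le_left _ _
  have hηB : √(2 * η * B) ≤ ε := by
    refine Real.sqrt_le_iff.2 ⟨hε.le, ?_⟩
    have : η ≤ ε ^ 2 / (2 * B) := min_le_right _ _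
    rw [le_div_iff₀ (by positivity)] at this
    linarith
  obtain ⟨δ, hδ, hWδ⟩ := Metric.uniformContinuous_iff.1 hu η hη0
  have key : ∀ t ∈ Icc 0 (T / 2), ∀ s ∈ Icc 0 (T / 2), |t - s| < δ → ∀ x,
      pd j (fun y => W (y, t)) x - pd j (fun y => W (y, s)) x ≤ ε := by
    intro t ht s hs hts x
    have hZ := h.shift_sub (b := T / 4) ht.1 (by linarith [ht.2]) hs.1 (by linarith [hs.2])
    have hd : ∀ r ∈ Icc 0 (T / 2), ContDiff ℝ 2 fun y => W (y, r) := fun r hr =>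
      h.smooth r ⟨hr.1, by linarith [hr.2]⟩
    have h1 := hZ.pd_le (C := 2 * C) (B := B) (by linarith) hη0 (fun x r _ => ?_)
      (fun x r hr => ?_) ?_ ?_ j x
    · simp only [zero_add] at h1
      rw [pd_sub j ((hd t ht).differentiable (by norm_num) x)
        ((hd s hs).differentiable (by norm_num) x)] at h1
      exact h1.trans hηB
    · have := hWδ (a := (x, r + t)) (b := (x, r + s)) (by
        rw [Prod.dist_eq, dist_self, Real.dist_eq, add_sub_add_left_eq_sub]
        exact max_lt hδ hts)
      exact this.le
    · have h2 : ∀ q ∈ Icc 0 (T / 2), r + q ∈ Ico 0 T := fun q hq =>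
        ⟨by linarith [hr.1, hq.1], by linarith [hr.2, hq.2]⟩
      have h3 := hL x _ (h2 t ht)
      have h4 := hL x _ (h2 s hs)
      simp only
      rw [slap_sub (h.smooth _ (Ico_subset_Icc_self (h2 t ht)))
        (h.smooth _ (Ico_subset_Icc_self (h2 s hs)))]
      rw [abs_le] at *
      constructor <;> linarith
    · have : 2 * η / (T / 4 - 0) ≤ 8 / T := by
        rw [sub_zero, div_le_div_iff₀ (by positivity) hT]
        nlinarith
      have : 0 < 8 / T := by positivity
      linarith
    · have : 0 < 8 / T := by positivity
      linarith
  refine ⟨δ, hδ, fun t ht s hs hts x => abs_le.2 ⟨?_, key t ht s hs hts x⟩⟩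
  linarith [key s hs t ht (by rwa [abs_sub_comm]) x]

theorem Strip.continuous_pd {T C : ℝ} {W Wt : E × ℝ → ℝ} (hT : 0 < T) (h : Strip 0 T W Wt)
    (hu : UniformContinuous W)
    (hL : ∀ x, ∀ t ∈ Ico 0 T, |Wt (x, t) + slap (fun y => W (y, t)) x| ≤ C) (j : Fin n) :
    Continuous fun p : E × ℝ =>
      pd j (fun y => W (y, projIcc 0 (T / 2) (by positivity) p.2)) p.1 := by
  have hc : Continuous fun t : ℝ => (projIcc 0 (T / 2) (by positivity) t : ℝ) :=
    continuous_subtype_val.comp continuous_projIcc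
  refine Metric.continuous_iff.2 fun p ε hε => ?_
  set t := (projIcc 0 (T / 2) (by positivity) p.2 : ℝ)
  have ht : t ∈ Icc 0 (T / 2) := (projIcc 0 (T / 2) (by positivity) p.2).2
  obtain ⟨δ, hδ, h1⟩ := h.exists_pd_sub_le hT hu hL j (half_pos hε)
  have h2 : Continuous (pd j fun y => W (y, t)) :=
    ((h.smooth t ⟨ht.1, by linarith [ht.2]⟩).pd j (m := 1) (by norm_num)).continuous
  obtain ⟨δ₁, hδ₁, h3⟩ := Metric.continuous_iff.1 h2 p.1 (ε / 2) (half_pos hε)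
  obtain ⟨δ₂, hδ₂, h4⟩ := Metric.continuous_iff.1 hc p.2 δ hδ
  refine ⟨min δ₁ δ₂, lt_min hδ₁ hδ₂, fun q hq => ?_⟩
  rw [Prod.dist_eq, max_lt_iff] at hq
  have h5 := h3 q.1 (hq.1.trans_le (min_le_left _ _))
  have h6 := h1 _ (projIcc 0 (T / 2) (by positivity) q.2).2 t ht
    (h4 q.2 (hq.2.trans_le (min_le_right _ _))) q.1
  rw [← Real.dist_eq] at h6
  exact (dist_triangle _ (pd j (fun y => W (y, t)) q.1) _).trans_lt (by linarith)

end Gradient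

section Comparison

variable {n : ℕ}

local notation "E" => EuclideanSpace ℝ (Fin n)

theorem slap_eq_zero_of_lt {f : E → ℝ} {r : ℝ} (hf : ∀ x, r ≤ ‖x‖ → f x = 0) {x : E}
    (hx : r < ‖x‖) : slap f x = 0 := by
  have h : f =ᶠ[𝓝 x] fun _ => 0 := by
    filter_upwards [(isOpen_lt continuous_const continuous_norm).mem_nhds hx] with y hy
      using hf y (le_of_lt hy)
  rw [slap_congr h]
  simp [slap]

theorem ContDiff.continuous_slap {f : E → ℝ} (hf : ContDiff ℝ 2 f) : Continuous (slap f) :=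
  continuous_finsetSum _ fun i _ =>
    ((hf.pd i (m := 1) (by norm_num)).pd i (m := 0) (by norm_num)).continuous

theorem slap_add_const_mul {f g : E → ℝ} (hf : ContDiff ℝ 2 f) (hg : ContDiff ℝ 2 g) (c : ℝ)
    (x : E) : slap (fun y => f y + c * g y) x = slap f x + c * slap g x := by
  simp only [slap_eq_sum_pd]
  rw [Finset.mul_sum, ← Finset.sum_add_distrib]
  refine Finset.sum_congr rfl fun i _ => ?_
  have hfd := hf.differentiable (by norm_num)
  have hgd := hg.differentiable (by norm_num)
  have hfd' := (hf.pd i (m := 1) (by norm_num)).differentiable (by norm_num)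
  have hgd' := (hg.pd i (m := 1) (by norm_num)).differentiable (by norm_num)
  rw [show pd i (fun y => f y + c * g y) = fun y => pd i f y + c * pd i g y from funext fun y => by
    rw [pd_add i (hfd y) ((hgd y).const_mul c), pd_const_mul i c (hgd y)],
    pd_add i (hfd' x) ((hgd' x).const_mul c), pd_const_mul i c (hgd' x)]

theorem Strip.exists_sub_le {T η s : ℝ} {W Wt G : E × ℝ → ℝ} (h : Strip 0 T W Wt)
    (hG : UniformContinuous G) (hGz : ∀ x t, 4 ≤ ‖x‖ → G (x, t) = 0)
    (hL : ∀ x, ∀ t ∈ Ico 0 T, |Wt (x, t) + slap (fun y => W (y, t)) x| ≤ G (x, t))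
    (hs : s ∈ Ioc 0 T) (hη : 0 < η) : ∃ δ > 0, ∀ r ∈ Icc 0 δ, ∀ x,
      W (x, s - r) - W (x, s) ≤ r * (slap (fun y => W (y, s)) x + G (x, s) + 4 * η) := by
  have hsm := h.smooth s ⟨hs.1.le, hs.2⟩
  have hz : ∀ x, 4 < ‖x‖ → slap (fun y => W (y, s)) x = 0 := fun x hx =>
    slap_eq_zero_of_lt (h.zero · s) hx
  have hu : UniformContinuous fun x => slap (fun y => W (y, s)) x + G (x, s) := by
    refine HasCompactSupport.uniformContinuous_of_continuous
      (HasCompactSupport.intro (isCompact_closedBall (0 : E) 4) fun x hx => ?_) ?_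
    · have hx' : 4 < ‖x‖ := by simpa using hx
      rw [hz x hx', hGz x s hx'.le, add_zero]
    · have := hG.continuous
      exact hsm.continuous_slap.add (by fun_prop)
  obtain ⟨g, hg, hgd⟩ := (hu.add (uniformContinuous_const (b := 3 * η))).exists_contDiff_dist_le hη
  have hg2 : ContDiff ℝ 2 g := contDiff_infty.1 hg 2
  have hg1 : ∀ x, slap (fun y => W (y, s)) x + G (x, s) + 2 * η ≤ g x := fun x => by
    have := (abs_lt.1 (Real.dist_eq _ _ ▸ hgd x)).1
    linarith
  have hg1' : ∀ x, g x ≤ slap (fun y => W (y, s)) x + G (x, s) + 4 * η := fun x => by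
    have := (abs_lt.1 (Real.dist_eq _ _ ▸ hgd x)).2
    linarith
  obtain ⟨M, hM⟩ := (isCompact_closedBall (0 : E) 5).exists_bound_of_continuousOn
    hg2.continuous_slap.continuousOn
  have hM0 : 0 ≤ M := (norm_nonneg _).trans (hM 0 (by simp))
  obtain ⟨δ', hδ', hGδ⟩ := Metric.uniformContinuous_iff.1 hG η hη
  set δ := min s (min (δ' / 2) (η / (M + 1))) with hδ
  have hδ0 : 0 < δ := lt_min hs.1 (lt_min (by positivity) (by positivity))
  have hδs : δ ≤ s := min_le_left _ _
  have hδδ' : δ < δ' :=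
    ((min_le_right _ _).trans (min_le_left _ _)).trans_lt (half_lt_self hδ')
  have hδM : δ * M ≤ η := by
    have : δ ≤ η / (M + 1) := (min_le_right _ _).trans (min_le_right _ _)
    rw [le_div_iff₀ (by positivity)] at this
    linarith
  refine ⟨δ, hδ0, fun r hr x => ?_⟩
  by_cases hx : 4 < ‖x‖
  · rw [h.zero x _ hx.le, h.zero x _ hx.le, hz x hx, hGz x _ hx.le]
    have := hr.1
    simp
    positivity
  suffices hsuff : W (x, s - r) - W (x, s) - r * g x ≤ 0 by
    have := mul_le_mul_of_nonneg_left (hg1' x) hr.1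
    linarith
  set Φ : E × ℝ → ℝ := fun p => W p - W (p.1, s) - (s - p.2) * g p.1 with hΦ
  have hΦc : Continuous Φ := by
    have := h.cont
    have := hg.continuous
    fun_prop
  obtain ⟨⟨y, t⟩, hmem, hmax⟩ := ((isCompact_closedBall (0 : E) 5).prod
    (isCompact_Icc (a := s - δ) (b := s))).exists_isMaxOn ⟨(0, s), by simp [hδ0.le]⟩
    hΦc.continuousOn
  obtain ⟨hy, ht⟩ : y ∈ closedBall (0 : E) 5 ∧ t ∈ Icc (s - δ) s := hmem
  have hmax' : ∀ y' ∈ closedBall (0 : E) 5, ∀ t' ∈ Icc (s - δ) s, Φ (y', t') ≤ Φ (y, t) :=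
    fun y' h1 t' h2 => hmax ⟨h1, h2⟩
  suffices hneg : Φ (y, t) ≤ 0 by
    have := (hmax' x (by simp; linarith) (s - r) ⟨by linarith [hr.2], by linarith [hr.1]⟩).trans
      hneg
    simp only [hΦ, sub_sub_cancel] at this
    exact this
  by_contra! hpos
  have hpos' := hpos
  simp only [hΦ] at hpos'
  have hts : t < s := by
    refine lt_of_le_of_ne ht.2 fun h0 => ?_
    rw [h0] at hpos'
    simp at hpos'
  have ht0 : t ∈ Ico 0 T := ⟨by linarith [ht.1], hts.trans_le hs.2⟩
  have hy5 : ‖y‖ < 5 := by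
    by_contra! h0
    have h1 := hg1 y
    rw [hz y (by linarith), hGz y s (by linarith)] at h1
    rw [h.zero y t (by linarith), h.zero y s (by linarith)] at hpos'
    have : 0 ≤ (s - t) * g y := mul_nonneg (by linarith) (by linarith)
    linarith
  have htime : Wt (y, t) + g y ≤ 0 := by
    have h1 := ((h.deriv y t ht0).sub_const (W (y, s))).sub
      ((((hasDerivAt_id t).const_sub s).mul_const (g y)).hasDerivWithinAt (s := Ici t))
    have h2 := nonpos_of_hasDerivWithinAt_Ici hts h1 fun t' ht' =>
      hmax' y hy t' ⟨ht.1.trans ht'.1.le, ht'.2.le⟩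
    linarith
  have hsmt := h.smooth t (Ico_subset_Icc_self ht0)
  have hspace : slap (fun y => W (y, t)) y - slap (fun y => W (y, s)) y - (s - t) * slap g y ≤
      0 := by
    have h1 : IsLocalMax (fun x => (W (x, t) - W (x, s)) + (-(s - t)) * g x) y := by
      filter_upwards [isOpen_ball.mem_nhds (show y ∈ ball (0 : E) 5 by simpa using hy5)]
        with y' hy'
      have := hmax' y' (ball_subset_closedBall hy') t ht
      simp only [hΦ] at this
      linarith
    have h2 := slap_nonpos_of_isLocalMax ((hsmt.sub hsm).add (contDiff_const.mul hg2)) h1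
    rw [slap_add_const_mul (hsmt.sub hsm) hg2, slap_sub hsmt hsm] at h2
    linarith
  have h1 := (abs_le.1 (hL y t ht0)).1
  have h2 := hg1 y
  have h3 : (s - t) * slap g y ≤ η := by
    have h4 := (abs_le.1 (hM y hy)).2
    calc (s - t) * slap g y ≤ (s - t) * M := mul_le_mul_of_nonneg_left h4 (by linarith)
      _ ≤ δ * M := mul_le_mul_of_nonneg_right (by linarith [ht.1]) hM0
      _ ≤ η := hδM
  have h4 := hGδ (a := (y, t)) (b := (y, s)) (by
    rw [Prod.dist_eq, dist_self, Real.dist_eq, abs_sub_comm]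
    exact max_lt hδ' (abs_lt.2 ⟨by linarith, by linarith [ht.1]⟩))
  have h5 := (abs_lt.1 h4).2
  linarith

theorem sub_le_integral_of_left_slope {F q : ℝ → ℝ} {T : ℝ} (hT : 0 ≤ T) (hF : Continuous F)
    (hq : Continuous q) (h : ∀ s ∈ Ioc 0 T, ∀ r, q s < r →
      ∀ᶠ z in 𝓝[>] 0, F (s - z) - F s < z * r) : F 0 - F T ≤ ∫ s in 0..T, q s := by
  have hqc : Continuous fun s => q (T - s) := by fun_prop
  have hB : ∀ x, HasDerivAt (fun x => F T + ∫ s in 0..x, q (T - s)) (q (T - x)) x := fun x =>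
    (intervalIntegral.integral_hasDerivAt_right (hqc.intervalIntegrable _ _)
      (hqc.stronglyMeasurableAtFilter _ _) hqc.continuousAt).const_add _
  have h1 := image_le_of_liminf_slope_right_le_deriv_boundary (f := fun x => F (T - x))
    (a := 0) (b := T) (by fun_prop) (B := fun x => F T + ∫ s in 0..x, q (T - s)) (by simp)
    (fun x _ => (hB x).continuousAt.continuousWithinAt) (fun x _ => (hB x).hasDerivWithinAt)
    (fun x hx r hr => ?_) (right_mem_Icc.2 hT)
  · simp only [sub_self] at h1
    rw [intervalIntegral.integral_comp_sub_left q] at h1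
    simp only [sub_self, sub_zero] at h1
    linarith
  · have h2 := h (T - x) ⟨by linarith [hx.2], by linarith [hx.1]⟩ r hr
    have h3 : Filter.Tendsto (fun z => z - x) (𝓝[>] x) (𝓝[>] 0) := by
      refine tendsto_nhdsWithin_iff.2 ⟨?_, ?_⟩
      · have : Filter.Tendsto (fun z => z - x) (𝓝 x) (𝓝 (x - x)) :=
          (continuous_id.sub continuous_const).tendsto x
        rw [sub_self] at this
        exact this.mono_left nhdsWithin_le_nhds
      · filter_upwards [self_mem_nhdsWithin] with z hz using sub_pos.2 (mem_Ioi.1 hz)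
    refine Filter.Eventually.frequently ?_
    filter_upwards [h3.eventually h2, self_mem_nhdsWithin] with z hz hzx
    rw [slope_def_field, div_lt_iff₀ (sub_pos.2 (mem_Ioi.1 hzx))]
    rw [show T - x - (z - x) = T - z by ring] at hz
    linarith

end Comparison

section Weak

variable {n : ℕ}

local notation "E" => EuclideanSpace ℝ (Fin n)

theorem integrable_of_zero_of_lt {f : E → ℝ} {ρ : ℝ} (hf : Continuous f)
    (h0 : ∀ y, ρ < ‖y‖ → f y = 0) : Integrable f :=
  hf.integrable_of_hasCompactSupport
    (HasCompactSupport.intro (isCompact_closedBall (0 : E) ρ) fun y hy => h0 y (by simpa using hy))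

theorem continuous_integral_of_zero_of_lt {f : E × ℝ → ℝ} {ρ : ℝ} (hf : Continuous f)
    (h0 : ∀ y s, ρ < ‖y‖ → f (y, s) = 0) : Continuous fun s => ∫ y, f (y, s) := by
  rw [← continuousOn_univ]
  refine continuousOn_integral_of_compact_support (k := closedBall (0 : E) ρ)
    (isCompact_closedBall _ _) (f := fun s y => f (y, s)) ?_ fun s y _ hy => h0 y s (by simpa using hy)
  exact (hf.comp continuous_swap).continuousOn

theorem integral_mul_slap {f g : E → ℝ} (hf : ContDiff ℝ 2 f) (hg : ContDiff ℝ 2 g)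
    (hc : HasCompactSupport f) : ∫ y, f y * slap g y = ∫ y, slap f y * g y := by
  have hf' : ∀ i, ContDiff ℝ 1 (pd i f) := fun i => hf.pd i (by norm_num)
  have hg' : ∀ i, ContDiff ℝ 1 (pd i g) := fun i => hg.pd i (by norm_num)
  have hf1 : ContDiff ℝ 1 f := hf.of_le (by norm_num)
  have hg1 : ContDiff ℝ 1 g := hg.of_le (by norm_num)
  have h := integral_sum_pd_eq_zero (F := fun i y => f y * pd i g y - pd i f y * g y)
    (fun i => (hf1.mul (hg' i)).sub ((hf' i).mul hg1))
    (fun i => (hc.mul_right).sub ((hc.pd i).mul_right))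
  have h2 : ∀ y, ∑ i, pd i (fun y => f y * pd i g y - pd i f y * g y) y =
      f y * slap g y - slap f y * g y := by
    intro y
    rw [slap_eq_sum_pd, slap_eq_sum_pd, Finset.mul_sum, Finset.sum_mul, ← Finset.sum_sub_distrib]
    refine Finset.sum_congr rfl fun i _ => ?_
    have d1 := hf1.differentiable (by norm_num) y
    have d2 := hg1.differentiable (by norm_num) y
    have d3 := (hf' i).differentiable (by norm_num) y
    have d4 := (hg' i).differentiable (by norm_num) y
    rw [pd_sub (f := fun y => f y * pd i g y) (g := fun y => pd i f y * g y) i (d1.mul d4)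
      (d3.mul d2), pd_mul i d1 d4, pd_mul i d3 d2]
    ring
  simp only [h2] at h
  have hcs : HasCompactSupport (slap f) := by
    refine hc.mono' fun y hy => ?_
    by_contra hn
    exact hy (slap_eq_zero_of_notMem_tsupport hn)
  rw [integral_sub] at h
  · linarith
  · exact (hf.continuous.mul hg.continuous_slap).integrable_of_hasCompactSupport hc.mul_right
  · exact (hf.continuous_slap.mul hg.continuous).integrable_of_hasCompactSupport hcs.mul_right

theorem continuous_slap_slice {ψ : E × ℝ → ℝ} (hψ : ContDiff ℝ ∞ ψ) :
    Continuous fun p : E × ℝ => slap (fun y => ψ (y, p.2)) p.1 := by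
  have h : (fun p : E × ℝ => slap (fun y => ψ (y, p.2)) p.1) = fun p => ∑ i,
      dd (EuclideanSpace.single i 1, 0) (dd (EuclideanSpace.single i 1, 0) ψ) p := by
    ext p
    rw [slap_eq_sum_pd]
    refine Finset.sum_congr rfl fun i _ => ?_
    rw [show pd i (fun y => ψ (y, p.2)) =
      fun y => dd (EuclideanSpace.single i 1, 0) ψ (y, p.2) from
      funext fun y => pd_slice hψ i y p.2, pd_slice (hψ.dd _)]
  rw [h]
  exact continuous_finsetSum _ fun i _ => ((hψ.dd _).dd _).continuous

theorem Strip.weak_le {T ρ : ℝ} {W Wt G ψ : E × ℝ → ℝ} (hT : 0 ≤ T) (h : Strip 0 T W Wt)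
    (hG : UniformContinuous G) (hGz : ∀ x t, 4 ≤ ‖x‖ → G (x, t) = 0)
    (hL : ∀ x, ∀ t ∈ Ico 0 T, |Wt (x, t) + slap (fun y => W (y, t)) x| ≤ G (x, t))
    (hψ : ContDiff ℝ ∞ ψ) (hψ0 : ∀ p, 0 ≤ ψ p) (hψz : ∀ x t, ρ < ‖x‖ → ψ (x, t) = 0)
    (hψi : ∀ x, ψ (x, 0) = 0) (hψT : ∀ x, ψ (x, T) = 0) :
    0 ≤ ∫ s in 0..T, ∫ y, (W (y, s) * (slap (fun y => ψ (y, s)) y - dd (0, 1) ψ (y, s)) +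
      G (y, s) * ψ (y, s)) := by
  have hWc := h.cont
  have hψc := hψ.continuous
  have hGc := hG.continuous
  have hψd : Continuous (dd (0, 1) ψ) := (hψ.dd _).continuous
  have hψl := continuous_slap_slice hψ
  have hF : Continuous fun s => ∫ y, W (y, s) * ψ (y, s) :=
    continuous_integral_of_zero_of_lt (f := fun p => W p * ψ p) (ρ := 4) (by fun_prop)
      fun y s hy => by simp [h.zero y s hy.le]
  have hq : Continuous fun s => ∫ y, (W (y, s) * (slap (fun y => ψ (y, s)) y -
      dd (0, 1) ψ (y, s)) + G (y, s) * ψ (y, s)) :=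
    continuous_integral_of_zero_of_lt (f := fun p => W p * (slap (fun y => ψ (y, p.2)) p.1 -
      dd (0, 1) ψ p) + G p * ψ p) (ρ := 4) (by fun_prop)
      fun y s hy => by simp [h.zero y s hy.le, hGz y s hy.le]
  have hmain := sub_le_integral_of_left_slope hT hF hq fun s hs r hr => ?_
  · simpa [hψi, hψT] using hmain
  have hsm := h.smooth s ⟨hs.1.le, hs.2⟩
  have hψs : ∀ τ, Continuous fun y => ψ (y, τ) := fun τ => by fun_prop
  have hWs : ∀ τ, Continuous fun y => W (y, τ) := fun τ => by fun_prop
  have hGs : ∀ τ, Continuous fun y => G (y, τ) := fun τ => by fun_prop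
  set I := ∫ y, ψ (y, s) with hI
  have hI0 : 0 ≤ I := integral_nonneg fun y => hψ0 _
  set Q := ∫ y, (W (y, s) * (slap (fun y => ψ (y, s)) y - dd (0, 1) ψ (y, s)) +
    G (y, s) * ψ (y, s)) with hQ
  set η := (r - Q) / (8 * (I + 1)) with hη
  have hη0 : 0 < η := div_pos (by linarith) (by positivity)
  have hηI : 4 * η * I < r - Q := by
    have : 8 * (I + 1) * η = r - Q := by rw [hη]; field_simp
    nlinarith
  obtain ⟨δ, hδ, hcomp⟩ := h.exists_sub_le hG hGz hL hs hη0
  set g : E → ℝ := fun y => slap (fun y => W (y, s)) y + G (y, s) + 4 * η with hg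
  have hgc : Continuous g := (hsm.continuous_slap.add (hGs s)).add continuous_const
  have hP : Continuous fun τ => ∫ y, g y * ψ (y, τ) :=
    continuous_integral_of_zero_of_lt (f := fun p => g p.1 * ψ p) (ρ := ρ) (by fun_prop)
      fun y τ hy => by simp [hψz y τ hy]
  have hH : HasDerivAt (fun τ => ∫ y, W (y, s) * ψ (y, τ))
      (∫ y, W (y, s) * dd (0, 1) ψ (y, s)) s :=
    hasDerivAt_integral_of_compact (F := fun y τ => W (y, s) * ψ (y, τ))
      (F' := fun y τ => W (y, s) * dd (0, 1) ψ (y, τ)) (r := 4) one_pos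
      (fun τ => (hWs s).mul (hψs τ)) (by fun_prop)
      (fun y τ hy => by simp [h.zero y s hy.le]) (fun y τ hy => by simp [h.zero y s hy.le])
      fun y τ _ => (hasDerivAt_slice hψ y τ).const_mul _
  have hval : (∫ y, g y * ψ (y, s)) - (∫ y, W (y, s) * dd (0, 1) ψ (y, s)) = Q + 4 * η * I := by
    have i1 : Integrable fun y => slap (fun y => W (y, s)) y * ψ (y, s) :=
      integrable_of_zero_of_lt (ρ := ρ) (hsm.continuous_slap.mul (hψs s))
        fun y hy => by simp [hψz y s hy]
    have i2 : Integrable fun y => G (y, s) * ψ (y, s) :=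
      integrable_of_zero_of_lt (ρ := ρ) ((hGs s).mul (hψs s)) fun y hy => by simp [hψz y s hy]
    have i3 : Integrable fun y => 4 * η * ψ (y, s) :=
      integrable_of_zero_of_lt (ρ := ρ) (by fun_prop) fun y hy => by simp [hψz y s hy]
    have i4 : Integrable fun y => W (y, s) * slap (fun y => ψ (y, s)) y :=
      integrable_of_zero_of_lt (ρ := 4)
        ((hWs s).mul ((contDiff_infty.1 (contDiff_slice hψ s) 2).continuous_slap))
        fun y hy => by simp [h.zero y s hy.le]
    have i5 : Integrable fun y => W (y, s) * dd (0, 1) ψ (y, s) :=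
      integrable_of_zero_of_lt (ρ := 4) (by fun_prop) fun y hy => by simp [h.zero y s hy.le]
    have e1 : ∫ y, g y * ψ (y, s) = (∫ y, slap (fun y => W (y, s)) y * ψ (y, s)) +
        (∫ y, G (y, s) * ψ (y, s)) + 4 * η * I := by
      have i12 : Integrable fun y => slap (fun y => W (y, s)) y * ψ (y, s) + G (y, s) * ψ (y, s) :=
        i1.add i2
      rw [hI, ← integral_const_mul, ← integral_add i1 i2, ← integral_add i12 i3]
      exact integral_congr_ae (Filter.Eventually.of_forall fun y => by simp [hg]; ring)
    have e2 : Q = (∫ y, W (y, s) * slap (fun y => ψ (y, s)) y) -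
        (∫ y, W (y, s) * dd (0, 1) ψ (y, s)) + ∫ y, G (y, s) * ψ (y, s) := by
      have i45 : Integrable fun y => W (y, s) * slap (fun y => ψ (y, s)) y -
          W (y, s) * dd (0, 1) ψ (y, s) := i4.sub i5
      rw [hQ, ← integral_sub i4 i5, ← integral_add i45 i2]
      exact integral_congr_ae (Filter.Eventually.of_forall fun y => by simp; ring)
    rw [e1, e2, integral_mul_slap hsm (contDiff_infty.1 (contDiff_slice hψ s) 2)
      (HasCompactSupport.intro (isCompact_closedBall (0 : E) 4)
        fun y hy => h.zero y s (by simpa using (le_of_lt (by simpa using hy))))]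
    ring
  have hslope : Filter.Tendsto (fun z => (∫ y, g y * ψ (y, s - z)) +
      ((∫ y, W (y, s) * ψ (y, s - z)) - ∫ y, W (y, s) * ψ (y, s)) / z) (𝓝[>] 0)
      (𝓝 ((∫ y, g y * ψ (y, s)) - ∫ y, W (y, s) * dd (0, 1) ψ (y, s))) := by
    have hH' : HasDerivAt (fun z => ∫ y, W (y, s) * ψ (y, s - z))
        (-∫ y, W (y, s) * dd (0, 1) ψ (y, s)) 0 := by
      have h1 : HasDerivAt (fun z : ℝ => s - z) (-1) 0 := (hasDerivAt_id 0).const_sub s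
      have h2 := HasDerivAt.scomp (h := fun z : ℝ => s - z) (0 : ℝ) (by simpa using hH) h1
      simpa [Function.comp_def] using h2
    rw [sub_eq_add_neg]
    refine Filter.Tendsto.add ?_ ?_
    · have h1 : Continuous fun z => ∫ y, g y * ψ (y, s - z) :=
        hP.comp (continuous_const.sub continuous_id)
      have h2 := h1.tendsto 0
      rw [sub_zero] at h2
      exact h2.mono_left nhdsWithin_le_nhds
    · have h1 := (hasDerivWithinAt_iff_tendsto_slope' (by simp)).1
        (hH'.hasDerivWithinAt (s := Ioi 0))
      refine h1.congr fun z => ?_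
      rw [slope_def_field]
      simp
  rw [hval] at hslope
  filter_upwards [hslope.eventually_lt_const (show Q + 4 * η * I < r by linarith),
    Ioc_mem_nhdsGT hδ] with z hz hzδ
  have hz0 : 0 < z := hzδ.1
  have hz' := mul_lt_mul_of_pos_left hz hz0
  rw [mul_add, mul_div_cancel₀ _ hz0.ne'] at hz'
  refine lt_of_le_of_lt ?_ hz'
  have j1 : Integrable fun y => (W (y, s - z) - W (y, s)) * ψ (y, s - z) :=
    integrable_of_zero_of_lt (ρ := ρ) (by fun_prop) fun y hy => by simp [hψz y _ hy]
  have j2 : Integrable fun y => W (y, s) * ψ (y, s - z) :=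
    integrable_of_zero_of_lt (ρ := ρ) (by fun_prop) fun y hy => by simp [hψz y _ hy]
  have j3 : Integrable fun y => z * (g y * ψ (y, s - z)) :=
    integrable_of_zero_of_lt (ρ := ρ) (by fun_prop) fun y hy => by simp [hψz y _ hy]
  have e3 : ∫ y, W (y, s - z) * ψ (y, s - z) =
      (∫ y, (W (y, s - z) - W (y, s)) * ψ (y, s - z)) + ∫ y, W (y, s) * ψ (y, s - z) := by
    rw [← integral_add j1 j2]
    exact integral_congr_ae (Filter.Eventually.of_forall fun y => by simp; ring)
  have e4 : (∫ y, (W (y, s - z) - W (y, s)) * ψ (y, s - z)) ≤ z * ∫ y, g y * ψ (y, s - z) := by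
    rw [← integral_const_mul]
    refine integral_mono j1 j3 fun y => ?_
    have := mul_le_mul_of_nonneg_right (hcomp z ⟨hz0.le, hzδ.2⟩ y) (hψ0 (y, s - z))
    simp only [hg]
    linarith
  linarith

end Weak

section Smear

variable {n : ℕ}

local notation "E" => EuclideanSpace ℝ (Fin n)

instance isAddHaarMeasure_volume_prod : (volume : Measure (E × ℝ)).IsAddHaarMeasure :=
  inferInstanceAs (Measure.IsAddHaarMeasure ((volume : Measure E).prod (volume : Measure ℝ)))

/-- The convolution of `W` and `Ψ` on `ℝⁿ × ℝ`. -/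
noncomputable def smear (W Ψ : E × ℝ → ℝ) (p : E × ℝ) : ℝ := ∫ q, W q * Ψ (p - q)

theorem smear_eq_convolution (W Ψ : E × ℝ → ℝ) :
    smear W Ψ = convolution W Ψ (ContinuousLinearMap.mul ℝ ℝ) volume := rfl

theorem integrable_smear {W Ψ : E × ℝ → ℝ} (hW : Continuous W) (hΨ : Continuous Ψ)
    (hc : HasCompactSupport Ψ) (p : E × ℝ) : Integrable fun q => W q * Ψ (p - q) := by
  refine Continuous.integrable_of_hasCompactSupport (by fun_prop) (HasCompactSupport.mul_left ?_)
  exact hc.comp_homeomorph (Homeomorph.subLeft p)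

theorem contDiff_smear {W Ψ : E × ℝ → ℝ} (hW : Continuous W) (hΨ : ContDiff ℝ ∞ Ψ)
    (hc : HasCompactSupport Ψ) : ContDiff ℝ ∞ (smear W Ψ) :=
  hc.contDiff_convolution_right (ContinuousLinearMap.mul ℝ ℝ) hW.locallyIntegrable hΨ

theorem HasCompactSupport.dd {Ψ : E × ℝ → ℝ} (hc : HasCompactSupport Ψ) (a : E × ℝ) :
    HasCompactSupport (dd a Ψ) :=
  (hc.fderiv ℝ).mono fun z hz h0 => hz (by simp only [_root_.dd]; rw [h0]; rfl)

theorem dd_smear {W Ψ : E × ℝ → ℝ} (hW : Continuous W) (hΨ : ContDiff ℝ ∞ Ψ)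
    (hc : HasCompactSupport Ψ) (a : E × ℝ) : dd a (smear W Ψ) = smear W (dd a Ψ) := by
  ext p
  have h1 := hc.hasFDerivAt_convolution_right (μ := volume) (ContinuousLinearMap.mul ℝ ℝ)
    hW.locallyIntegrable (hΨ.of_le (by exact_mod_cast le_top)) p
  rw [dd, smear_eq_convolution, h1.fderiv, convolution_precompR_apply _ hW.locallyIntegrable
    (hc.fderiv ℝ) (hΨ.continuous_fderiv (by simp))]
  rfl

/-- A smooth mollifier supported in the ball of radius `δ` around `(0, -2δ)`. -/
structure BackwardKernel (δ : ℝ) (Ψ : E × ℝ → ℝ) : Prop where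
  smooth : ContDiff ℝ ∞ Ψ
  nonneg : ∀ z, 0 ≤ Ψ z
  integral_eq_one : ∫ z, Ψ z = 1
  zero : ∀ z, δ < dist z (0, -(2 * δ)) → Ψ z = 0

theorem exists_backwardKernel {δ : ℝ} (hδ : 0 < δ) :
    ∃ Ψ : E × ℝ → ℝ, BackwardKernel δ Ψ := by
  let φ : ContDiffBump ((0, -(2 * δ)) : E × ℝ) := ⟨δ / 2, δ, by positivity, by linarith⟩
  refine ⟨φ.normed volume, φ.contDiff_normed, fun z => φ.nonneg_normed z, φ.integral_normed,
    fun z hz => ?_⟩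
  rw [← Function.notMem_support, φ.support_normed_eq]
  simpa using hz.le

namespace BackwardKernel

variable {δ : ℝ} {Ψ : EuclideanSpace ℝ (Fin n) × ℝ → ℝ}

theorem hasCompactSupport (h : BackwardKernel δ Ψ) : HasCompactSupport Ψ :=
  HasCompactSupport.intro (isCompact_closedBall (0, -(2 * δ)) δ) fun z hz =>
    h.zero z (by simpa using hz)

theorem dd_eq_zero (h : BackwardKernel δ Ψ) (a : E × ℝ) {z : E × ℝ}
    (hz : δ < dist z (0, -(2 * δ))) : dd a Ψ z = 0 := by
  have : Ψ =ᶠ[𝓝 z] fun _ => 0 := by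
    filter_upwards [(isOpen_lt continuous_const (continuous_id.dist continuous_const)).mem_nhds hz]
      with w hw using h.zero w hw
  simp [dd, this.fderiv_eq]

theorem smear_le (h : BackwardKernel δ Ψ) {f : E × ℝ → ℝ} (hf : Continuous f) {p : E × ℝ} {c : ℝ}
    (hc : ∀ q, dist q p ≤ 3 * δ → f q ≤ c) (hδ : 0 < δ) : smear f Ψ p ≤ c := by
  have h1 : ∫ q, c * Ψ (p - q) = c := by
    rw [integral_const_mul, integral_sub_left_eq_self Ψ volume p, h.integral_eq_one, mul_one]
  rw [← h1]
  refine integral_mono (integrable_smear hf h.smooth.continuous h.hasCompactSupport p)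
    (integrable_smear continuous_const h.smooth.continuous h.hasCompactSupport p) fun q => ?_
  rcases le_or_gt (dist (p - q) (0, -(2 * δ))) δ with hq | hq
  · refine mul_le_mul_of_nonneg_right (hc q ?_) (h.nonneg _)
    have h2 : dist q p = dist (p - q) 0 := by rw [dist_zero_right, dist_comm, dist_eq_norm]
    have h3 : dist ((0, -(2 * δ)) : E × ℝ) 0 = 2 * δ := by
      simp [abs_of_pos hδ, hδ.le]
    rw [h2]
    linarith [dist_triangle (p - q) (0, -(2 * δ)) 0]
  · simp [h.zero _ hq]

theorem abs_smear_sub_le (h : BackwardKernel δ Ψ) {f : E × ℝ → ℝ} (hf : Continuous f) {p : E × ℝ}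
    {c η : ℝ} (hc : ∀ q, dist q p ≤ 3 * δ → |f q - c| ≤ η) (hδ : 0 < δ) :
    |smear f Ψ p - c| ≤ η := by
  have h1 := h.smear_le hf (c := c + η) (fun q hq => by linarith [(abs_le.1 (hc q hq)).2]) hδ
  have h2 := h.smear_le (f := fun q => -f q) hf.neg (c := η - c)
    (fun q hq => by linarith [(abs_le.1 (hc q hq)).1]) hδ
  have h3 : smear (fun q => -f q) Ψ p = -smear f Ψ p := by
    simp [smear, integral_neg]
  rw [abs_le]
  constructor <;> linarith

end BackwardKernel

theorem pd_comp_sub_left (i : Fin n) (f : E → ℝ) (x y : E) :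
    pd i (fun y => f (x - y)) y = -pd i f (x - y) := by
  have h := congrFun (pd_comp_add_right i (fun y => f (-y)) (-x)) y
  have h2 := (ContinuousLinearEquiv.neg ℝ (M := E)).comp_right_fderiv (f := f) (x := y + -x)
  have h3 : (fun z : E => f (-(z + -x))) = fun y => f (x - y) := by
    ext z
    congr 1
    abel
  have h4 : (f ∘ (ContinuousLinearEquiv.neg ℝ (M := E))) = fun y => f (-y) := rfl
  rw [h3] at h
  rw [h4] at h2
  rw [h, pd, h2, pd, show x - y = -(y + -x) by abel]
  simp

theorem smear_dd_eq_smear_pd {W Ψ : E × ℝ → ℝ} (hW : Continuous W)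
    (hS : ∀ t, ContDiff ℝ 1 fun x => W (x, t)) (i : Fin n)
    (hP : Continuous fun p : E × ℝ => pd i (fun y => W (y, p.2)) p.1)
    (hΨ : ContDiff ℝ ∞ Ψ) (hc : HasCompactSupport Ψ) (p : E × ℝ) :
    smear W (dd (EuclideanSpace.single i 1, 0) Ψ) p =
      smear (fun p => pd i (fun y => W (y, p.2)) p.1) Ψ p := by
  have hΨc := hΨ.continuous
  have hdc := (hΨ.dd (EuclideanSpace.single i 1, 0)).continuous
  have I1 := integrable_smear hW hdc (hc.dd _) p
  have I2 := integrable_smear hP hΨc hc p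
  rw [← sub_eq_zero, smear, smear, ← integral_sub I1 I2]
  have I3 : Integrable fun q : E × ℝ => W q * dd (EuclideanSpace.single i 1, 0) Ψ (p - q) -
      pd i (fun y => W (y, q.2)) q.1 * Ψ (p - q) := I1.sub I2
  rw [Measure.volume_eq_prod] at I3 ⊢
  rw [integral_prod_symm _ I3]
  have hz : ∀ s, ∫ y, (W (y, s) * dd (EuclideanSpace.single i 1, 0) Ψ (p - (y, s)) -
      pd i (fun y => W (y, s)) y * Ψ (p - (y, s))) = 0 := by
    intro s
    have hΨs : ContDiff ℝ 1 fun y : E => Ψ (p - (y, s)) :=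
      (contDiff_infty.1 hΨ 1).comp (by fun_prop)
    have hcs : HasCompactSupport fun y : E => Ψ (p - (y, s)) := by
      refine HasCompactSupport.intro (K := (fun z => p.1 - z.1) '' tsupport Ψ)
        (IsCompact.image hc (by fun_prop)) fun y hy => ?_
      by_contra h0
      exact hy ⟨p - (y, s), subset_tsupport _ h0, by simp⟩
    have h0 := integral_pd_eq_zero (F := fun y => W (y, s) * Ψ (p - (y, s)))
      ((hS s).mul hΨs) (hcs.mul_left) i
    rw [← neg_eq_zero, ← integral_neg]
    refine Eq.trans ?_ h0
    refine integral_congr_ae (Filter.Eventually.of_forall fun y => ?_)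
    have h1 : pd i (fun y : E => Ψ (p - (y, s))) y =
        -dd (EuclideanSpace.single i 1, 0) Ψ (p - (y, s)) := by
      have := pd_comp_sub_left i (fun z => Ψ (z, p.2 - s)) p.1 y
      rw [pd_slice hΨ] at this
      exact this
    rw [pd_mul i ((hS s).differentiable (by norm_num) y) (hΨs.differentiable (by norm_num) y), h1]
    simp
    ring
  exact (integral_congr_ae (Filter.Eventually.of_forall hz)).trans (by simp)

theorem bheat_eq_sum {U : E × ℝ → ℝ} (hU : ContDiff ℝ ∞ U) (x : E) (t : ℝ) :
    bheat U t x = dd (0, 1) U (x, t) + ∑ i,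
      dd (EuclideanSpace.single i 1, 0) (dd (EuclideanSpace.single i 1, 0) U) (x, t) := by
  rw [bheat, slap_eq_sum_pd]
  congr 1
  refine Finset.sum_congr rfl fun i _ => ?_
  rw [show pd i (fun y => U (y, t)) =
    fun y => dd (EuclideanSpace.single i 1, 0) U (y, t) from
    funext fun y => pd_slice hU i y t, pd_slice (hU.dd _)]

end Smear

section SmearBounds

variable {n : ℕ}

local notation "E" => EuclideanSpace ℝ (Fin n)

theorem slap_neg (f : E → ℝ) (x : E) : slap (fun y => -f y) x = -slap f x := by
  simp only [slap_eq_sum_pd, ← Finset.sum_neg_distrib]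
  refine Finset.sum_congr rfl fun i _ => ?_
  rw [show (pd i fun y => -f y) = fun y => -pd i f y from funext fun y => pd_neg i, pd_neg]

theorem Strip.neg {a b : ℝ} {W Wt : E × ℝ → ℝ} (h : Strip a b W Wt) :
    Strip a b (fun p => -W p) fun p => -Wt p where
  smooth t ht := (h.smooth t ht).neg
  deriv x t ht := (h.deriv x t ht).neg
  zero x t hx := by simp [h.zero x t hx]
  cont := h.cont.neg

theorem dd_comp_sub_left {Ψ : E × ℝ → ℝ} (hΨ : ContDiff ℝ ∞ Ψ) (a p q : E × ℝ) :
    dd a (fun q => Ψ (p - q)) q = -dd a Ψ (p - q) := by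
  have h1 := (hΨ.differentiable (by simp) (p - q)).hasFDerivAt.comp q
    ((hasFDerivAt_id q).const_sub p)
  have h2 : fderiv ℝ (fun q => Ψ (p - q)) q = _ := h1.fderiv
  rw [dd, h2]
  simp [dd]

theorem slap_comp_sub_left {Ψ : E × ℝ → ℝ} (hΨ : ContDiff ℝ ∞ Ψ) (p : E × ℝ) (y : E) (s : ℝ) :
    slap (fun y => Ψ (p - (y, s))) y = ∑ i,
      dd (EuclideanSpace.single i 1, 0) (dd (EuclideanSpace.single i 1, 0) Ψ) (p - (y, s)) := by
  have hψ : ContDiff ℝ ∞ fun q => Ψ (p - q) := hΨ.comp (by fun_prop)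
  rw [slap_eq_sum_pd]
  refine Finset.sum_congr rfl fun i _ => ?_
  rw [show pd i (fun y => Ψ (p - (y, s))) =
    fun y => -dd (EuclideanSpace.single i 1, 0) Ψ (p - (y, s)) from
    funext fun y => (pd_slice hψ i y s).trans (dd_comp_sub_left hΨ _ _ _), pd_neg,
    pd_slice (U := fun q => dd (EuclideanSpace.single i 1, 0) Ψ (p - q))
      ((hΨ.dd _).comp (by fun_prop)), dd_comp_sub_left (hΨ.dd _), neg_neg]

theorem BackwardKernel.eq_zero_of_notMem {δ s : ℝ} {K : E × ℝ → ℝ} {p : E × ℝ} {y : E}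
    (h : ∀ z, δ < dist z (0, -(2 * δ)) → K z = 0)
    (hs : δ < ‖p.1 - y‖ ∨ s < p.2 + δ ∨ p.2 + 3 * δ < s) : K (p - (y, s)) = 0 := by
  refine h _ ?_
  rw [Prod.dist_eq, lt_max_iff]
  rcases hs with hs | hs | hs
  · exact Or.inl (by simpa [dist_eq_norm] using hs)
  · right
    rw [Real.dist_eq, lt_abs]
    left
    simp
    linarith
  · right
    rw [Real.dist_eq, lt_abs]
    right
    simp
    linarith

theorem Strip.neg_smear_le_bheat {T δ : ℝ} {W Wt G Ψ : E × ℝ → ℝ} (hT : 0 ≤ T)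
    (h : Strip 0 T W Wt) (hG : UniformContinuous G)
    (hGz : ∀ x t, 4 ≤ ‖x‖ → G (x, t) = 0)
    (hL : ∀ x, ∀ t ∈ Ico 0 T, |Wt (x, t) + slap (fun y => W (y, t)) x| ≤ G (x, t))
    (hΨ : BackwardKernel δ Ψ) (x : E) {t : ℝ} (ht : 0 < t + δ) (htT : t + 3 * δ < T) :
    -smear G Ψ (x, t) ≤ bheat (smear W Ψ) t x := by
  set p : E × ℝ := (x, t) with hp
  have hs := hΨ.smooth
  have hc := hΨ.hasCompactSupport
  have hz1 := fun z => hΨ.dd_eq_zero (0, 1) (z := z)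
  have hz2 : ∀ i : Fin n, ∀ z, δ < dist z (0, -(2 * δ)) →
      dd (EuclideanSpace.single i 1, 0) (dd (EuclideanSpace.single i 1, 0) Ψ) z = 0 := by
    intro i z hz
    have : dd (EuclideanSpace.single i 1, 0) Ψ =ᶠ[𝓝 z] fun _ => 0 := by
      filter_upwards [(isOpen_lt continuous_const (continuous_id.dist continuous_const)).mem_nhds
        hz] with w hw using hΨ.dd_eq_zero _ hw
    simp [dd, this.fderiv_eq]
  have hweak := h.weak_le (ψ := fun q => Ψ (p - q)) (ρ := ‖x‖ + δ) hT hG hGz hL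
    (hs.comp (by fun_prop)) (fun q => hΨ.nonneg _)
    (fun y s hy => BackwardKernel.eq_zero_of_notMem hΨ.zero (Or.inl (by
      have := norm_sub_norm_le y x
      rw [norm_sub_rev] at this
      simp only [hp]
      linarith)))
    (fun y => BackwardKernel.eq_zero_of_notMem hΨ.zero (Or.inr (Or.inl (by simpa [hp] using ht))))
    (fun y => BackwardKernel.eq_zero_of_notMem hΨ.zero (Or.inr (Or.inr (by simpa [hp] using htT))))
  set K : E × ℝ → ℝ := fun z => dd (0, 1) Ψ z + ∑ i,
      dd (EuclideanSpace.single i 1, 0) (dd (EuclideanSpace.single i 1, 0) Ψ) z with hK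
  have hF : ∀ y s, W (y, s) * (slap (fun y => Ψ (p - (y, s))) y -
      dd (0, 1) (fun q => Ψ (p - q)) (y, s)) + G (y, s) * Ψ (p - (y, s)) =
      W (y, s) * K (p - (y, s)) + G (y, s) * Ψ (p - (y, s)) := by
    intro y s
    rw [slap_comp_sub_left hs, dd_comp_sub_left hs]
    simp only [hK]
    ring
  simp only [hF] at hweak
  rw [intervalIntegral.integral_of_le hT, setIntegral_eq_integral_of_forall_compl_eq_zero] at hweak
  · have i1 := integrable_smear h.cont (hs.dd (0, 1)).continuous (hc.dd _) p
    have i2 := fun i : Fin n => integrable_smear h.cont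
      ((hs.dd (EuclideanSpace.single i 1, 0)).dd (EuclideanSpace.single i 1, 0)).continuous
      ((hc.dd _).dd _) p
    have i3 := integrable_smear hG.continuous hs.continuous hc p
    have i4 : Integrable fun q => W q * K (p - q) := by
      have : (fun q => W q * K (p - q)) = fun q => W q * dd (0, 1) Ψ (p - q) + ∑ i, W q *
          dd (EuclideanSpace.single i 1, 0) (dd (EuclideanSpace.single i 1, 0) Ψ) (p - q) := by
        ext q
        simp only [hK, mul_add, Finset.mul_sum]
      rw [this]
      exact i1.add (integrable_finsetSum _ fun i _ => i2 i)
    have i5 : Integrable fun q => W q * K (p - q) + G q * Ψ (p - q) := i4.add i3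
    have e1 : ∫ q, W q * K (p - q) = bheat (smear W Ψ) t x := by
      rw [bheat_eq_sum (contDiff_smear h.cont hs hc), dd_smear h.cont hs hc, smear]
      simp only [dd_smear h.cont hs hc, dd_smear h.cont (hs.dd _) (hc.dd _)]
      simp only [smear]
      rw [← integral_finsetSum _ fun i _ => i2 i,
        ← integral_add i1 (integrable_finsetSum _ fun i _ => i2 i)]
      simp only [hK, mul_add, Finset.mul_sum]
    have e2 : ∫ s, ∫ y, (W (y, s) * K (p - (y, s)) + G (y, s) * Ψ (p - (y, s))) =
        ∫ q, (W q * K (p - q) + G q * Ψ (p - q)) := by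
      rw [Measure.volume_eq_prod] at i5 ⊢
      exact (integral_prod_symm _ i5).symm
    rw [e2, integral_add i4 i3, e1] at hweak
    simp only [smear] at hweak ⊢
    linarith
  · intro s hs'
    have hor : s < p.2 + δ ∨ p.2 + 3 * δ < s := by
      by_contra! hcon
      simp only [hp] at hcon
      exact hs' ⟨by linarith [hcon.1], by linarith [hcon.2]⟩
    have : ∀ y, W (y, s) * K (p - (y, s)) + G (y, s) * Ψ (p - (y, s)) = 0 := by
      intro y
      rw [BackwardKernel.eq_zero_of_notMem hΨ.zero (Or.inr hor)]
      simp only [hK]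
      rw [BackwardKernel.eq_zero_of_notMem hz1 (Or.inr hor), Finset.sum_eq_zero fun i _ =>
        BackwardKernel.eq_zero_of_notMem (hz2 i) (Or.inr hor)]
      simp
    simp [this]

theorem Strip.abs_bheat_smear_le {T δ : ℝ} {W Wt G Ψ : E × ℝ → ℝ} (hT : 0 ≤ T)
    (h : Strip 0 T W Wt) (hG : UniformContinuous G)
    (hGz : ∀ x t, 4 ≤ ‖x‖ → G (x, t) = 0)
    (hL : ∀ x, ∀ t ∈ Ico 0 T, |Wt (x, t) + slap (fun y => W (y, t)) x| ≤ G (x, t))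
    (hΨ : BackwardKernel δ Ψ) (x : E) {t : ℝ} (ht : 0 < t + δ) (htT : t + 3 * δ < T) :
    |bheat (smear W Ψ) t x| ≤ smear G Ψ (x, t) := by
  have h1 := h.neg_smear_le_bheat hT hG hGz hL hΨ x ht htT
  have h2 := h.neg.neg_smear_le_bheat hT hG hGz (fun x t ht => by
    rw [slap_neg, ← neg_add, abs_neg]
    exact hL x t ht) hΨ x ht htT
  have hs := contDiff_smear h.cont hΨ.smooth hΨ.hasCompactSupport
  have h3 : smear (fun p => -W p) Ψ = fun p => -smear W Ψ p := by
    ext p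
    simp [smear, integral_neg]
  have h4 : bheat (fun p => -smear W Ψ p) t x = -bheat (smear W Ψ) t x := by
    have : dd (0, 1) (fun p => -smear W Ψ p) (x, t) = -dd (0, 1) (smear W Ψ) (x, t) := by
      simp [dd, fderiv_fun_neg]
    rw [bheat, bheat, slap_neg, this]
    ring
  rw [h3, h4] at h2
  rw [abs_le]
  constructor <;> linarith

end SmearBounds

section Approximation

variable {n : ℕ}

local notation "E" => EuclideanSpace ℝ (Fin n)

theorem UniformContinuous.eventually_abs_sub_le {f : E × ℝ → ℝ} (hf : UniformContinuous f) {η : ℝ}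
    (hη : 0 < η) : ∀ᶠ δ in 𝓝[>] (0 : ℝ), ∀ q p, dist q p ≤ 3 * δ → |f q - f p| ≤ η := by
  obtain ⟨δ₀, hδ₀, h⟩ := Metric.uniformContinuous_iff.1 hf η hη
  filter_upwards [Ioo_mem_nhdsGT (show (0 : ℝ) < δ₀ / 3 by positivity)] with δ hδ q p hqp
  have := h (a := q) (b := p) (by linarith [hδ.2])
  rw [Real.dist_eq] at this
  exact this.le

theorem Strip.exists_smooth_approx {T η : ℝ} {W Wt G : E × ℝ → ℝ} (hT : 0 < T)
    (h : Strip 0 T W Wt) (hW : UniformContinuous W)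
    (hP : ∀ i, UniformContinuous fun p : E × ℝ => pd i (fun y => W (y, p.2)) p.1)
    (hS : ∀ t, ContDiff ℝ 1 fun x => W (x, t)) (hz : ∀ x t, 7 / 2 ≤ ‖x‖ → W (x, t) = 0)
    (hG : UniformContinuous G) (hGz : ∀ x t, 4 ≤ ‖x‖ → G (x, t) = 0)
    (hL : ∀ x, ∀ t ∈ Ico 0 T, |Wt (x, t) + slap (fun y => W (y, t)) x| ≤ G (x, t))
    (hW1 : ∀ p, |W p| ≤ 1) (hη : 0 < η) :
    ∃ V : E × ℝ → ℝ, ContDiff ℝ ∞ V ∧ (∀ x t, 4 < ‖x‖ → V (x, t) = 0) ∧ (∀ p, |V p| ≤ 1) ∧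
      (∀ p, |V p - W p| ≤ η) ∧
      (∀ x t, ‖fderiv ℝ (fun y => V (y, t)) x - fderiv ℝ (fun y => W (y, t)) x‖ ≤ η) ∧
      ∀ x, ∀ t ∈ Icc 0 (T / 2), |bheat V t x| ≤ G (x, t) + η := by
  have hη' : 0 < η / (n + 1) := by positivity
  obtain ⟨δ, hδW, hδG, hδP, hδ⟩ := ((hW.eventually_abs_sub_le hη).and
    ((hG.eventually_abs_sub_le hη).and ((Filter.eventually_all.2
      fun i => (hP i).eventually_abs_sub_le hη').and
      (Ioo_mem_nhdsGT (show (0 : ℝ) < min (T / 6) (1 / 6) by positivity))))).exists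
  obtain ⟨Ψ, hΨ⟩ := exists_backwardKernel (n := n) hδ.1
  have hδT : δ < T / 6 := hδ.2.trans_le (min_le_left _ _)
  have hδ1 : δ < 1 / 6 := hδ.2.trans_le (min_le_right _ _)
  have hsm := contDiff_smear hW.continuous hΨ.smooth hΨ.hasCompactSupport
  refine ⟨smear W Ψ, hsm, fun x t hx => ?_, fun p => ?_,
    fun p => hΨ.abs_smear_sub_le hW.continuous (fun q hq => hδW q p hq) hδ.1, fun x t => ?_,
    fun x t ht => ?_⟩
  · have := hΨ.abs_smear_sub_le hW.continuous (p := (x, t)) (c := 0) (η := 0) (fun q hq => ?_) hδ.1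
    · simpa using abs_nonpos_iff.1 this
    · have h1 : ‖x‖ - ‖q.1‖ ≤ dist q (x, t) := by
        rw [Prod.dist_eq]
        refine le_trans ?_ (le_max_left _ _)
        rw [dist_comm, dist_eq_norm]
        exact norm_sub_norm_le _ _
      rw [show W q = 0 from hz q.1 q.2 (by linarith)]
      simp
  · simpa using hΨ.abs_smear_sub_le hW.continuous (p := p) (c := 0) (η := 1)
      (fun q _ => by simpa using hW1 q) hδ.1
  · have d1 : DifferentiableAt ℝ (fun y => smear W Ψ (y, t)) x :=
      (contDiff_slice hsm t).differentiable (by simp) x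
    have d2 : DifferentiableAt ℝ (fun y => W (y, t)) x := (hS t).differentiable (by simp) x
    have h1 : fderiv ℝ (fun y => smear W Ψ (y, t)) x - fderiv ℝ (fun y => W (y, t)) x =
        fderiv ℝ (fun y => smear W Ψ (y, t) - W (y, t)) x := (fderiv_fun_sub d1 d2).symm
    rw [h1]
    refine le_of_sq_le_sq ?_ hη.le
    rw [← sum_pd_sq]
    have h2 : ∀ i, pd i (fun y => smear W Ψ (y, t) - W (y, t)) x ^ 2 ≤ (η / (n + 1)) ^ 2 := by
      intro i
      rw [pd_sub i d1 d2, pd_slice hsm, dd_smear hW.continuous hΨ.smooth hΨ.hasCompactSupport,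
        smear_dd_eq_smear_pd hW.continuous hS i (hP i).continuous hΨ.smooth hΨ.hasCompactSupport]
      rw [sq_le_sq, abs_of_pos hη']
      exact hΨ.abs_smear_sub_le (hP i).continuous (fun q hq => hδP i q (x, t) hq) hδ.1
    calc _ ≤ ∑ _i : Fin n, (η / (n + 1)) ^ 2 := Finset.sum_le_sum fun i _ => h2 i
      _ = n / (n + 1) ^ 2 * η ^ 2 := by simp [div_pow]; ring
      _ ≤ 1 * η ^ 2 := by
        gcongr
        rw [div_le_one (by positivity)]
        nlinarith [(n.cast_nonneg : (0 : ℝ) ≤ n)]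
      _ = η ^ 2 := one_mul _
  · refine (h.abs_bheat_smear_le hT.le hG hGz hL hΨ x (by linarith [ht.1, hδ.1])
      (by linarith [ht.2])).trans ?_
    have := hΨ.abs_smear_sub_le hG.continuous (fun q hq => hδG q (x, t) hq) hδ.1
    linarith [(abs_le.1 this).2]

theorem Strip.exists_approx {R A τ₀ η : ℝ} {W Wt : E × ℝ → ℝ} {k : E → ℝ} (hR : 1 ≤ R) (hA : 0 ≤ A)
    (hτ₀ : 0 < τ₀) (hη : 0 < η)
    (h : Strip 0 (1 / (2 * R ^ 2)) W Wt) (hW : UniformContinuous W)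
    (hP : ∀ i, UniformContinuous fun p : E × ℝ => pd i (fun y => W (y, p.2)) p.1)
    (hS : ∀ t, ContDiff ℝ 1 fun x => W (x, t)) (hz : ∀ x t, 7 / 2 ≤ ‖x‖ → W (x, t) = 0)
    (hW1 : ∀ p, |W p| ≤ 1) (hWA : ∀ x t, ‖fderiv ℝ (fun y => W (y, t)) x‖ ≤ A * R)
    (hk : Continuous k) (hk0 : ∀ x, 0 ≤ k x) (hkA : ∀ x, k x ≤ A * R)
    (hk3 : ∀ x, ‖x‖ < 3 → k x = 0) (hk4 : ∀ x, 4 ≤ ‖x‖ → k x = 0)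
    (hG : UniformContinuous fun p : E × ℝ =>
      R ^ 2 * |W p| + R * ‖fderiv ℝ (fun y => W (y, p.2)) p.1‖ + k p.1)
    (hL : ∀ x, ∀ t ∈ Ico 0 (1 / (2 * R ^ 2)), |Wt (x, t) + slap (fun y => W (y, t)) x| ≤
      R ^ 2 * |W (x, t)| + R * ‖fderiv ℝ (fun y => W (y, t)) x‖ + k x) :
    ∃ U κ, Approx R ((A + 1) ^ 2 * volume.real (closedBall (0 : E) 5)) τ₀ U κ ∧
      ∀ p, |U p - W p| ≤ η := by
  have hR0 : 0 < R := by linarith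
  set v := volume.real (closedBall (0 : E) 5)
  set η₁ := min 1 (min η (exp (-9 / (8 * τ₀)))) with hη₁
  have hη₁0 : 0 < η₁ := lt_min one_pos (lt_min hη (exp_pos _))
  have hη₁1 : η₁ ≤ 1 := min_le_left _ _
  have hη₁η : η₁ ≤ η := (min_le_right _ _).trans (min_le_left _ _)
  have hη₁e : η₁ ^ 2 ≤ exp (-9 / (4 * τ₀)) := by
    have h1 : η₁ ≤ exp (-9 / (8 * τ₀)) := (min_le_right _ _).trans (min_le_right _ _)
    calc η₁ ^ 2 ≤ exp (-9 / (8 * τ₀)) ^ 2 := by gcongr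
      _ = exp (-9 / (4 * τ₀)) := by
        rw [← exp_nat_mul]
        congr 1
        push_cast
        field_simp
        norm_num
  set η₀ := η₁ / (R ^ 2 + R + 1) with hη₀
  have hη₀0 : 0 < η₀ := by positivity
  have hη₀e : (R ^ 2 + R + 1) * η₀ = η₁ := by
    rw [hη₀]
    field_simp
  have hη₀1 : η₀ ≤ η₁ := by nlinarith [mul_pos (show 0 < R ^ 2 + R by positivity) hη₀0]
  obtain ⟨V, hV, hV4, hV1, hVW, hVd, hVb⟩ := h.exists_smooth_approx (η := η₀) (by positivity) hW hP
    hS hz hG (fun x t hx => by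
      have h1 : fderiv ℝ (fun y => W (y, t)) x = 0 := by
        have : (fun y => W (y, t)) =ᶠ[𝓝 x] fun _ => 0 := by
          filter_upwards [(isOpen_lt continuous_const continuous_norm).mem_nhds
            (show 7 / 2 < ‖x‖ by linarith)] with y hy using hz y t (le_of_lt hy)
        rw [this.fderiv_eq]
        simp
      simp [h1, hz x t (by linarith), hk4 x hx]) hL hW1 hη₀0
  have hVfd : ∀ x t, ‖fderiv ℝ (fun y => V (y, t)) x‖ ≤ (A + 1) * R := by
    intro x t
    have h1 := norm_sub_norm_le (fderiv ℝ (fun y => V (y, t)) x) (fderiv ℝ (fun y => W (y, t)) x)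
    nlinarith [hVd x t, hWA x t]
  have hT : 1 / (2 * R ^ 2) / 2 = 1 / (4 * R ^ 2) := by
    field_simp
    norm_num
  rw [hT] at hVb
  set κ : E → ℝ := fun x => k x + η₁ * max 0 (min 1 (5 - ‖x‖)) with hκ
  have hκ0 : ∀ x, 0 ≤ κ x := fun x => add_nonneg (hk0 x) (by positivity)
  have hκk : ∀ x, κ x ≤ k x + η₁ := fun x => by
    have : max 0 (min 1 (5 - ‖x‖)) ≤ 1 := max_le zero_le_one (min_le_left _ _)
    simp only [hκ]
    nlinarith
  have hκ5 : ∀ x, 5 < ‖x‖ → κ x = 0 := fun x hx => by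
    simp [hκ, hk4 x (by linarith), hx.le]
  have hκc : Continuous κ := by fun_prop
  have hdom : ∀ {f : E → ℝ} {B : ℝ}, (∀ x, 0 ≤ f x) → (∀ x, ‖x‖ ≤ 5 → f x ≤ B) →
      (∀ x, 5 < ‖x‖ → f x = 0) → ∫ x, f x ≤ B * v := by
    intro f B hf0 hfB hf5
    rw [← setIntegral_eq_integral_of_forall_compl_eq_zero (s := closedBall (0 : E) 5)
      fun x hx => hf5 x (by simpa using hx)]
    have h1 := norm_setIntegral_le_of_norm_le_const (f := f) (C := B) (s := closedBall (0 : E) 5)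
      (measure_closedBall_lt_top (μ := volume)) fun x hx => by
        rw [norm_of_nonneg (hf0 x)]
        exact hfB x (by simpa using hx)
    exact (le_norm_self _).trans h1
  refine ⟨V, κ, ⟨hV, hV4, hκc, hκ5, fun t ht x => ?_, fun τ hτ => ?_, fun t _ x => hV1 _,
    fun t ht => ?_⟩, fun p => (hVW p).trans (hη₀1.trans hη₁η)⟩
  · rcases lt_or_ge 4 ‖x‖ with hx | hx
    · rw [bheat_eq_zero hV4 t hx, abs_zero]
      have := hκ0 x
      positivity
    · have h1 : κ x = k x + η₁ := by
        simp only [hκ]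
        rw [min_eq_left (by linarith), max_eq_right zero_le_one, mul_one]
      have h2 : |W (x, t)| ≤ |V (x, t)| + η₀ := by
        have := abs_sub_abs_le_abs_sub (W (x, t)) (V (x, t))
        rw [abs_sub_comm] at this
        linarith [hVW (x, t)]
      have h3 : ‖fderiv ℝ (fun y => W (y, t)) x‖ ≤ ‖fderiv ℝ (fun y => V (y, t)) x‖ + η₀ := by
        have := norm_sub_norm_le (fderiv ℝ (fun y => W (y, t)) x) (fderiv ℝ (fun y => V (y, t)) x)
        rw [norm_sub_rev] at this
        linarith [hVd x t]
      have h4 := hVb x t ht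
      have h5 := mul_le_mul_of_nonneg_left h2 (sq_nonneg R)
      have h6 := mul_le_mul_of_nonneg_left h3 hR0.le
      simp only at h4
      rw [h1]
      linarith
  · have hτ0 : 0 < τ := hτ₀.trans_le hτ
    have h1 : η₁ ^ 2 ≤ exp (-9 / (4 * τ)) := by
      refine hη₁e.trans (exp_le_exp.2 ?_)
      rw [div_le_div_iff₀ (by positivity) (by positivity)]
      linarith
    refine (hdom (B := (A + 1) ^ 2 * R ^ 2 * exp (-9 / (4 * τ)))
      (fun x => mul_nonneg (sq_nonneg _) (gauss_pos _ _).le) (fun x _ => ?_)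
      fun x hx => by simp [hκ5 x hx]).trans_eq (by ring)
    have hAR : 1 ≤ (A + 1) ^ 2 * R ^ 2 := by
      have : 1 ≤ (A + 1) * R := by nlinarith
      rw [← mul_pow]
      exact one_le_pow₀ this
    rcases lt_or_ge ‖x‖ 3 with hx | hx
    · have h2 : κ x ^ 2 ≤ exp (-9 / (4 * τ)) := by
        refine le_trans ?_ h1
        have := hκk x
        rw [hk3 x hx, zero_add] at this
        exact pow_le_pow_left₀ (hκ0 x) this 2
      have h3 : gauss τ x ≤ 1 := by
        rw [gauss, exp_le_one_iff]
        exact div_nonpos_of_nonpos_of_nonneg (by nlinarith [norm_nonneg x]) (by positivity)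
      calc κ x ^ 2 * gauss τ x ≤ exp (-9 / (4 * τ)) * 1 := by
            gcongr
            exact (gauss_pos _ _).le
        _ ≤ (A + 1) ^ 2 * R ^ 2 * exp (-9 / (4 * τ)) := by nlinarith [exp_pos (-9 / (4 * τ))]
    · have h2 : κ x ^ 2 ≤ (A + 1) ^ 2 * R ^ 2 := by
        rw [← mul_pow]
        exact pow_le_pow_left₀ (hκ0 x) (by nlinarith [hκk x, hkA x]) 2
      exact mul_le_mul h2 (gauss_le_gauss hτ0 (by nlinarith)) (gauss_pos _ _).le (by positivity)
  · refine (hdom (B := ((A + 1) * R) ^ 2) (fun x => mul_nonneg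
      (Finset.sum_nonneg fun i _ => sq_nonneg _) (gauss_pos _ _).le) (fun x _ => ?_)
      fun x hx => ?_).trans_eq (by ring)
    · rw [sum_pd_sq]
      have h3 : gauss (t + τ₀) x ≤ 1 := by
        rw [gauss, exp_le_one_iff]
        exact div_nonpos_of_nonpos_of_nonneg (by nlinarith [norm_nonneg x])
          (by have := ht.1; positivity)
      calc _ ≤ ((A + 1) * R) ^ 2 * 1 := by
            gcongr
            · exact (gauss_pos _ _).le
            · exact hVfd x t
        _ = _ := mul_one _
    · rw [Finset.sum_eq_zero fun i _ => ?_, zero_mul]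
      rw [pd_slice hV, dd_eq_zero hV4 _ x t (by linarith)]
      simp

end Approximation

section Clamp

variable {n : ℕ}

local notation "E" => EuclideanSpace ℝ (Fin n)

theorem Strip.clamp {T S : ℝ} {W Wt : E × ℝ → ℝ} (hS : 0 ≤ S) (hST : S ≤ T)
    (h : Strip 0 T W Wt) : Strip 0 S (fun p => W (p.1, projIcc 0 S hS p.2)) Wt where
  smooth t ht := by
    simp only
    rw [projIcc_of_mem hS ht]
    exact h.smooth t ⟨ht.1, ht.2.trans hST⟩
  deriv x t ht := by
    refine (h.deriv x t ⟨ht.1, ht.2.trans_le hST⟩).congr_of_eventuallyEq ?_ ?_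
    · filter_upwards [Icc_mem_nhdsGE ht.2] with s hs
      rw [projIcc_of_mem hS ⟨ht.1.trans hs.1, hs.2⟩]
    · rw [projIcc_of_mem hS ⟨ht.1, ht.2.le⟩]
  zero x t hx := h.zero x _ hx
  cont := h.cont.comp (continuous_fst.prodMk
    (continuous_subtype_val.comp (continuous_projIcc.comp continuous_snd)))

theorem Strip.exists_approx_of_bound {R A τ₀ η : ℝ} {W Wt : E × ℝ → ℝ} {k : E → ℝ} (hR : 1 ≤ R)
    (hA : 0 ≤ A) (hτ₀ : 0 < τ₀) (hη : 0 < η)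
    (h : Strip 0 (1 / R ^ 2) W Wt) (hW : UniformContinuous W)
    (hz : ∀ x t, 7 / 2 ≤ ‖x‖ → W (x, t) = 0) (hW1 : ∀ p, |W p| ≤ 1)
    (hWA : ∀ x, ∀ t ∈ Icc 0 (1 / R ^ 2), ‖fderiv ℝ (fun y => W (y, t)) x‖ ≤ A * R)
    (hk : Continuous k) (hk0 : ∀ x, 0 ≤ k x) (hkA : ∀ x, k x ≤ A * R)
    (hk3 : ∀ x, ‖x‖ < 3 → k x = 0) (hk4 : ∀ x, 4 ≤ ‖x‖ → k x = 0)
    (hL : ∀ x, ∀ t ∈ Ico 0 (1 / R ^ 2), |Wt (x, t) + slap (fun y => W (y, t)) x| ≤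
      R ^ 2 * |W (x, t)| + R * ‖fderiv ℝ (fun y => W (y, t)) x‖ + k x) :
    ∃ U κ, Approx R ((A + 1) ^ 2 * volume.real (closedBall (0 : E) 5)) τ₀ U κ ∧
      ∀ x, |U (x, 0) - W (x, 0)| ≤ η := by
  have hR0 : 0 < R := by linarith
  have hT : 0 < 1 / R ^ 2 := by positivity
  have hT2 : 1 / (2 * R ^ 2) = 1 / R ^ 2 / 2 := by field_simp
  have hS : 0 ≤ 1 / R ^ 2 / 2 := by positivity
  have hST : 1 / R ^ 2 / 2 ≤ 1 / R ^ 2 := by linarith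
  have hLC : ∀ x, ∀ t ∈ Ico 0 (1 / R ^ 2), |Wt (x, t) + slap (fun y => W (y, t)) x| ≤
      R ^ 2 * 1 + R * (A * R) + A * R := fun x t ht => (hL x t ht).trans
    (add_le_add (add_le_add (mul_le_mul_of_nonneg_left (hW1 _) (by positivity))
      (mul_le_mul_of_nonneg_left (hWA x t ⟨ht.1, ht.2.le⟩) hR0.le)) (hkA x))
  have hP := fun j => h.continuous_pd hT hW hLC j
  have hmem : ∀ t, (projIcc 0 (1 / R ^ 2 / 2) hS t : ℝ) ∈ Icc 0 (1 / R ^ 2) := fun t =>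
    ⟨(projIcc 0 _ hS t).2.1, (projIcc 0 _ hS t).2.2.trans hST⟩
  have hcl : ∀ t, projIcc 0 (1 / R ^ 2 / 2) hS (projIcc 0 (1 / R ^ 2 / 2) hS t) =
      projIcc 0 (1 / R ^ 2 / 2) hS t := fun t => projIcc_val _ _
  have hc := h.clamp hS hST
  have hfd0 : ∀ x s, 4 ≤ ‖x‖ → fderiv ℝ (fun y => W (y, s)) x = 0 := fun x s hx => by
    have : (fun y => W (y, s)) =ᶠ[𝓝 x] fun _ => 0 := by
      filter_upwards [(isOpen_lt continuous_const continuous_norm).mem_nhds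
        (show 7 / 2 < ‖x‖ by linarith)] with y hy using hz y s (le_of_lt hy)
    rw [this.fderiv_eq]
    simp
  have hnorm : Continuous fun p : E × ℝ =>
      ‖fderiv ℝ (fun y => W (y, projIcc 0 (1 / R ^ 2 / 2) hS p.2)) p.1‖ := by
    have : (fun p : E × ℝ => ‖fderiv ℝ (fun y => W (y, projIcc 0 (1 / R ^ 2 / 2) hS p.2)) p.1‖) =
        fun p => √(∑ i, pd i (fun y => W (y, projIcc 0 (1 / R ^ 2 / 2) hS p.2)) p.1 ^ 2) := by
      ext p
      rw [sum_pd_sq, sqrt_sq (norm_nonneg _)]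
    rw [this]
    exact (continuous_finsetSum _ fun i _ => (hP i).pow 2).sqrt
  obtain ⟨U, κ, hU, hUW⟩ := Strip.exists_approx (Wt := Wt) hR hA hτ₀ hη (by rw [hT2]; exact hc)
    (uniformContinuous_of_clamp hS hc.cont hc.zero fun x t => by simp only [hcl])
    (fun i => uniformContinuous_of_clamp hS (hP i)
      (fun x t hx => by simp [pd, hfd0 x _ hx]) fun x t => by simp only [hcl])
    (fun t => (h.smooth _ (hmem t)).of_le (by norm_num)) (fun x t hx => hz x _ hx)
    (fun p => hW1 _) (fun x t => hWA x _ (hmem t)) hk hk0 hkA hk3 hk4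
    (uniformContinuous_of_clamp hS (((hc.cont.abs.const_mul _).add (hnorm.const_mul _)).add
        (hk.comp continuous_fst))
      (fun x t hx => by simp [hfd0 x _ hx, h.zero x _ hx, hk4 x hx])
      fun x t => by simp only [hcl])
    (fun x t ht => by
      rw [hT2] at ht
      simp only
      rw [projIcc_of_mem hS ⟨ht.1, ht.2.le⟩]
      exact hL x t ⟨ht.1, ht.2.trans_le hST⟩)
  refine ⟨U, κ, hU, fun x => ?_⟩
  have := hUW (x, 0)
  simp only at this
  rwa [projIcc_of_mem hS ⟨le_rfl, hS⟩] at this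

end Clamp

section Limit

variable {n : ℕ}

local notation "E" => EuclideanSpace ℝ (Fin n)

theorem integral_mul_gauss_ge {R C θ ε : ℝ} {w : E → ℝ} (hw : Continuous w) (hw1 : ∀ x, |w x| ≤ 1)
    (hw4 : ∀ x, 4 ≤ ‖x‖ → w x = 0)
    (happ : ∀ η > 0, ∃ U κ, Approx R C (ε / (8 * R ^ 2)) U κ ∧ ∀ x : E, |U (x, 0) - w x| ≤ η)
    (hR : 1 ≤ R) (hC : volume.real (closedBall (0 : E) 4) ≤ C) (hθ : 0 < θ)
    (hmass : θ ^ 2 * (R ^ n)⁻¹ ≤ ∫ x in ball 0 1, w x ^ 2) (hRn : (n : ℝ) / 2 ≤ R ^ 2)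
    (hR1 : (1 + 2 * C) * R ^ n ≤ θ ^ 2 / 6 * exp (R ^ 2 / 12))
    (hR2 : 5 * (1 + 2 * C) * R ^ 2 ≤ exp (2 * R ^ 2 / 3)) (hε : 0 < ε) (hε' : ε ≤ 1 / 600) :
    exp ((2000 * R ^ 2 + n / 2) * log ε) ≤ ∫ x, w x ^ 2 * gauss (ε / (8 * R ^ 2)) x := by
  have hR0 : 0 < R := by linarith
  set v := volume.real (closedBall (0 : E) 4) with hv
  have hv0 : 0 ≤ v := measureReal_nonneg
  refine le_of_forall_pos_le_add fun e he => ?_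
  set m := θ ^ 2 * (R ^ n)⁻¹ with hm
  have hm0 : 0 < m := by positivity
  set η := min (e / (2 * (v + 1))) (m / (4 * (v + 1))) with hη
  have hη0 : 0 < η := lt_min (by positivity) (by positivity)
  have hηe : 2 * η * v ≤ e := by
    have : η ≤ e / (2 * (v + 1)) := min_le_left _ _
    rw [le_div_iff₀ (by positivity)] at this
    nlinarith
  have hηm : 2 * η * v ≤ m / 2 := by
    have : η ≤ m / (4 * (v + 1)) := min_le_right _ _
    rw [le_div_iff₀ (by positivity)] at this
    nlinarith
  obtain ⟨U, κ, hU, hUw⟩ := happ η hη0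
  have h0 : (0 : ℝ) ∈ Icc 0 (1 / (4 * R ^ 2)) := ⟨le_rfl, by positivity⟩
  have hsq : ∀ x, |U (x, 0) ^ 2 - w x ^ 2| ≤ 2 * η := by
    intro x
    rw [sq_sub_sq, abs_mul]
    have h1 := abs_add_le (U (x, 0)) (w x)
    nlinarith [hU.le_one 0 h0 x, hw1 x, hUw x, abs_nonneg (U (x, 0) - w x)]
  have hUc : Continuous fun x => U (x, 0) := (contDiff_slice hU.smooth 0).continuous
  have hmassU : θ ^ 2 / 2 * (R ^ n)⁻¹ ≤ ∫ x in ball 0 1, U (x, 0) ^ 2 := by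
    have i1 : IntegrableOn (fun x => w x ^ 2) (ball 0 1) :=
      ((hw.pow 2).continuousOn.integrableOn_compact (isCompact_closedBall (0 : E) 1)).mono_set
        ball_subset_closedBall
    have i2 : IntegrableOn (fun x => U (x, 0) ^ 2) (ball 0 1) :=
      ((hUc.pow 2).continuousOn.integrableOn_compact (isCompact_closedBall (0 : E) 1)).mono_set
        ball_subset_closedBall
    have h1 := norm_setIntegral_le_of_norm_le_const (f := fun x => U (x, 0) ^ 2 - w x ^ 2)
      (C := 2 * η) (s := ball (0 : E) 1) (measure_ball_lt_top (μ := volume)) fun x _ => hsq x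
    rw [integral_sub i2 i1, norm_eq_abs, abs_le] at h1
    have h2 : volume.real (ball (0 : E) 1) ≤ v :=
      measureReal_mono ((ball_subset_ball (by norm_num)).trans ball_subset_closedBall)
        (measure_closedBall_lt_top (μ := volume)).ne
    have h3 := mul_le_mul_of_nonneg_left h2 (show 0 ≤ 2 * η by positivity)
    have h4 : θ ^ 2 / 2 * (R ^ n)⁻¹ = m / 2 := by rw [hm]; ring
    linarith [h1.1]
  refine (hU.gMass_zero_ge hR hC hmassU hRn hR1 hR2 hε hε').trans ?_
  set τ := ε / (8 * R ^ 2) with hτ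
  have hτ0 : 0 < τ := by positivity
  have hg1 : ∀ x : E, gauss τ x ≤ 1 := fun x => by
    rw [gauss, exp_le_one_iff]
    exact div_nonpos_of_nonpos_of_nonneg (by nlinarith [norm_nonneg x]) (by positivity)
  have hgc : Continuous (gauss τ : E → ℝ) := (contDiff_gauss τ (k := 0)).continuous
  have i1 : Integrable fun x => w x ^ 2 * gauss τ x :=
    integrable_of_zero_of_lt (ρ := 4) ((hw.pow 2).mul hgc) fun y hy => by simp [hw4 y hy.le]
  have i2 : Integrable fun x => U (x, 0) ^ 2 * gauss τ x :=
    integrable_of_zero_of_lt (ρ := 4) ((hUc.pow 2).mul hgc) fun y hy => by simp [hU.zero y 0 hy]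
  have h1 := norm_setIntegral_le_of_norm_le_const
    (f := fun x => U (x, 0) ^ 2 * gauss τ x - w x ^ 2 * gauss τ x)
    (C := 2 * η) (s := closedBall (0 : E) 4) (measure_closedBall_lt_top (μ := volume)) fun x _ => by
      rw [← sub_mul, norm_mul, norm_eq_abs, norm_of_nonneg (gauss_pos τ x).le]
      nlinarith [hsq x, hg1 x, gauss_pos τ x, abs_nonneg (U (x, 0) ^ 2 - w x ^ 2)]
  rw [setIntegral_eq_integral_of_forall_compl_eq_zero fun x hx => by
    have hx' : 4 < ‖x‖ := by simpa using hx
    simp [hU.zero x 0 hx', hw4 x hx'.le], integral_sub i2 i1, norm_eq_abs, abs_le] at h1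
  rw [gMass, zero_add]
  linarith [h1.2]

end Limit

section Localization

variable {n : ℕ}

local notation "E" => EuclideanSpace ℝ (Fin n)

theorem slap_mul {f g : E → ℝ} {x : E} (hf : ContDiffAt ℝ 2 f x) (hg : ContDiffAt ℝ 2 g x) :
    slap (fun y => f y * g y) x =
      f x * slap g x + 2 * ∑ i, pd i f x * pd i g x + slap f x * g x := by
  simp only [slap_eq_sum_pd]
  rw [Finset.mul_sum, Finset.mul_sum, Finset.sum_mul, ← Finset.sum_add_distrib,
    ← Finset.sum_add_distrib]
  refine Finset.sum_congr rfl fun i _ => ?_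
  have h1 : pd i (fun y => f y * g y) =ᶠ[𝓝 x] fun y => pd i f y * g y + f y * pd i g y := by
    filter_upwards [hf.eventually (by simp), hg.eventually (by simp)] with y hfy hgy
    exact pd_mul i (hfy.differentiableAt (by norm_num)) (hgy.differentiableAt (by norm_num))
  have df := hf.differentiableAt (by norm_num)
  have dg := hg.differentiableAt (by norm_num)
  have df' := (hf.pd i (m := 1) (by norm_num)).differentiableAt (by norm_num)
  have dg' := (hg.pd i (m := 1) (by norm_num)).differentiableAt (by norm_num)
  rw [pd_congr i h1, pd_add (f := fun y => pd i f y * g y)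
    (g := fun y => f y * pd i g y) i (df'.mul dg) (df.mul dg'), pd_mul i df' dg, pd_mul i df dg']
  ring

theorem abs_sum_pd_mul_le (f g : E → ℝ) (x : E) :
    |∑ i, pd i f x * pd i g x| ≤ ‖fderiv ℝ f x‖ * ‖fderiv ℝ g x‖ := by
  refine abs_le_of_sq_le_sq ?_ (by positivity)
  rw [mul_pow, ← sum_pd_sq, ← sum_pd_sq]
  exact Finset.sum_mul_sq_le_sq_mul_sq _ _ _

theorem slap_const (c : ℝ) (x : E) : slap (fun _ => c) x = 0 := by
  simp [slap]

theorem norm_gradient (f : E → ℝ) (x : E) : ‖gradient f x‖ = ‖fderiv ℝ f x‖ := by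
  rw [gradient, LinearIsometryEquiv.norm_map]

/-- A smooth cutoff equal to `1` on `B₃` and supported in `B_{7/2}`, with derivative bounds. -/
structure Cutoff (A : ℝ) (χ : E → ℝ) : Prop where
  smooth : ContDiff ℝ ∞ χ
  nonneg : ∀ x, 0 ≤ χ x
  le_one : ∀ x, χ x ≤ 1
  eq_one : ∀ x, ‖x‖ ≤ 3 → χ x = 1
  zero : ∀ x, 7 / 2 ≤ ‖x‖ → χ x = 0
  fderiv_le : ∀ x, ‖fderiv ℝ χ x‖ ≤ A
  slap_le : ∀ x, |slap χ x| ≤ A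

theorem exists_cutoff (n : ℕ) :
    ∃ A : ℝ, 0 ≤ A ∧ ∃ χ : EuclideanSpace ℝ (Fin n) → ℝ, Cutoff A χ := by
  let φ : ContDiffBump (0 : EuclideanSpace ℝ (Fin n)) := ⟨3, 7 / 2, by norm_num, by norm_num⟩
  have hφ : ContDiff ℝ ∞ φ := φ.contDiff
  have h2 : ContDiff ℝ 2 φ := φ.contDiff
  obtain ⟨B, hB⟩ := (φ.hasCompactSupport.fderiv ℝ).exists_bound_of_continuous
    (hφ.continuous_fderiv (by simp))
  have hs : HasCompactSupport (slap φ) := φ.hasCompactSupport.mono' fun y hy => by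
    by_contra hn
    exact hy (slap_eq_zero_of_notMem_tsupport hn)
  obtain ⟨D, hD⟩ := hs.exists_bound_of_continuous h2.continuous_slap
  refine ⟨max B D, ((norm_nonneg _).trans (hB 0)).trans (le_max_left _ _), φ, hφ,
    fun x => φ.nonneg, fun x => φ.le_one, fun x hx => φ.one_of_mem_closedBall (by simpa using hx),
    fun x hx => φ.zero_of_le_dist (by simpa using hx), fun x => (hB x).trans (le_max_left _ _),
    fun x => (hD x).trans (le_max_right _ _)⟩

namespace Cutoff

variable {A : ℝ} {χ : EuclideanSpace ℝ (Fin n) → ℝ}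

theorem eventually_eq_zero (h : Cutoff A χ) {x : E} (hx : 4 ≤ ‖x‖) : χ =ᶠ[𝓝 x] fun _ => 0 := by
  filter_upwards [(isOpen_lt continuous_const continuous_norm).mem_nhds
    (show 7 / 2 < ‖x‖ by linarith)] with y hy using h.zero y (le_of_lt hy)

theorem eventually_eq_one (h : Cutoff A χ) {x : E} (hx : ‖x‖ < 3) : χ =ᶠ[𝓝 x] fun _ => 1 := by
  filter_upwards [(isOpen_lt continuous_norm continuous_const).mem_nhds hx] with y hy
    using h.eq_one y (le_of_lt hy)

theorem contDiff_mul (h : Cutoff A χ) {f : E → ℝ} (hf : ContDiffOn ℝ 2 f (ball 0 4)) :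
    ContDiff ℝ 2 fun x => χ x * f x := by
  refine contDiff_iff_contDiffAt.2 fun x => ?_
  by_cases hx : x ∈ ball (0 : E) 4
  · exact (contDiff_infty.1 h.smooth 2).contDiffAt.mul (hf.contDiffAt (isOpen_ball.mem_nhds hx))
  · refine (contDiffAt_const (c := (0 : ℝ))).congr_of_eventuallyEq ?_
    filter_upwards [h.eventually_eq_zero (by simpa using hx)] with y hy
    rw [hy, zero_mul]

theorem fderiv_mul (h : Cutoff A χ) {f : E → ℝ} (hf : ContDiffOn ℝ 2 f (ball 0 4)) {x : E}
    (hx : x ∈ ball (0 : E) 4) :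
    fderiv ℝ (fun y => χ y * f y) x = χ x • fderiv ℝ f x + f x • fderiv ℝ χ x :=
  fderiv_fun_mul (h.smooth.differentiable (by simp) x)
    ((hf.contDiffAt (isOpen_ball.mem_nhds hx)).differentiableAt (by norm_num))

theorem norm_fderiv_mul_le (h : Cutoff A χ) (hA : 0 ≤ A) {R : ℝ} (hR : 1 ≤ R) {f : E → ℝ}
    (hf : ContDiffOn ℝ 2 f (ball 0 4)) (hf1 : ∀ x ∈ ball (0 : E) 4, |f x| ≤ 1)
    (hfR : ∀ x ∈ ball (0 : E) 4, ‖fderiv ℝ f x‖ ≤ R) (x : E) :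
    ‖fderiv ℝ (fun y => χ y * f y) x‖ ≤ (1 + A) * R := by
  by_cases hx : x ∈ ball (0 : E) 4
  · rw [h.fderiv_mul hf hx]
    refine (norm_add_le _ _).trans ?_
    rw [norm_smul, norm_smul, norm_of_nonneg (h.nonneg x), norm_eq_abs]
    have h1 := mul_le_mul (h.le_one x) (hfR x hx) (norm_nonneg _) zero_le_one
    have h2 := mul_le_mul (hf1 x hx) (h.fderiv_le x) (norm_nonneg _) zero_le_one
    nlinarith
  · have : (fun y => χ y * f y) =ᶠ[𝓝 x] fun _ => 0 := by
      filter_upwards [h.eventually_eq_zero (by simpa using hx)] with y hy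
      rw [hy, zero_mul]
    rw [this.fderiv_eq]
    simp
    positivity

theorem abs_mul_add_slap_le (h : Cutoff A χ) {R d : ℝ} (hR : 1 ≤ R) {f : E → ℝ}
    (hf : ContDiffOn ℝ 2 f (ball 0 4)) {x : E} (hx : x ∈ ball (0 : E) 4) (hf1 : |f x| ≤ 1)
    (hfR : ‖fderiv ℝ f x‖ ≤ R)
    (hL : |slap f x + d| ≤ R ^ 2 * |f x| + R * ‖fderiv ℝ f x‖) :
    |χ x * d + slap (fun y => χ y * f y) x| ≤ R ^ 2 * |χ x * f x| +
      R * ‖fderiv ℝ (fun y => χ y * f y) x‖ + (3 * R * ‖fderiv ℝ χ x‖ + |slap χ x|) := by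
  rw [slap_mul (contDiff_infty.1 h.smooth 2).contDiffAt (hf.contDiffAt (isOpen_ball.mem_nhds hx))]
  have hχ0 := h.nonneg x
  have h1 : χ x * ‖fderiv ℝ f x‖ ≤ ‖fderiv ℝ (fun y => χ y * f y) x‖ + ‖fderiv ℝ χ x‖ := by
    have h2 : χ x • fderiv ℝ f x = fderiv ℝ (fun y => χ y * f y) x - f x • fderiv ℝ χ x := by
      rw [h.fderiv_mul hf hx]
      abel
    have h3 : χ x * ‖fderiv ℝ f x‖ = ‖χ x • fderiv ℝ f x‖ := by
      rw [norm_smul, norm_of_nonneg hχ0]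
    rw [h3, h2]
    refine (norm_sub_le _ _).trans (add_le_add le_rfl ?_)
    rw [norm_smul, norm_eq_abs]
    exact mul_le_of_le_one_left (norm_nonneg _) hf1
  have h4 := abs_sum_pd_mul_le χ f x
  have h5 := mul_le_mul_of_nonneg_left hfR (norm_nonneg (fderiv ℝ χ x))
  have h6 := mul_le_mul_of_nonneg_left hL hχ0
  have h7 := mul_le_mul_of_nonneg_left h1 (show 0 ≤ R by linarith)
  have h8 : |slap χ x * f x| ≤ |slap χ x| := by
    rw [abs_mul]
    exact mul_le_of_le_one_right (abs_nonneg _) hf1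
  have h9 : |χ x * f x| = χ x * |f x| := by rw [abs_mul, abs_of_nonneg hχ0]
  have h10 : |χ x * (slap f x + d)| = χ x * |slap f x + d| := by rw [abs_mul, abs_of_nonneg hχ0]
  calc |χ x * d + (χ x * slap f x + 2 * ∑ i, pd i χ x * pd i f x + slap χ x * f x)|
      = |χ x * (slap f x + d) + 2 * ∑ i, pd i χ x * pd i f x + slap χ x * f x| := by
        congr 1
        ring
    _ ≤ |χ x * (slap f x + d)| + |2 * ∑ i, pd i χ x * pd i f x| + |slap χ x * f x| :=
        abs_add_three _ _ _
    _ ≤ _ := by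
        rw [abs_mul 2, abs_two, h10, h9]
        linarith

end Cutoff

end Localization

section Setup

variable {n : ℕ}

local notation "E" => EuclideanSpace ℝ (Fin n)

/-- A `C^{2,1}` solution of the backward parabolic differential inequality on
`B₄ × [0, 1/R²]`, bounded by `1` and with gradient bounded by `R`. -/
structure IsSolution (R : ℝ) (u : E → ℝ → ℝ) : Prop where
  smooth : ∀ t ∈ Icc 0 (1 / R ^ 2), ContDiffOn ℝ 2 (fun x => u x t) (ball 0 4)
  smooth_time : ∀ x ∈ ball (0 : E) 4, ContDiffOn ℝ 1 (u x) (Icc 0 (1 / R ^ 2))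
  ineq : ∀ x ∈ ball (0 : E) 4, ∀ t ∈ Icc 0 (1 / R ^ 2),
    |slap (fun y => u y t) x + derivWithin (u x) (Icc 0 (1 / R ^ 2)) t| ≤
      R ^ 2 * |u x t| + R * ‖gradient (fun y => u y t) x‖
  le_one : ∀ x ∈ ball (0 : E) 4, ∀ t ∈ Icc 0 (1 / R ^ 2), |u x t| ≤ 1
  gradient_le : ∀ x ∈ ball (0 : E) 4, ∀ t ∈ Icc 0 (1 / R ^ 2),
    ‖gradient (fun y => u y t) x‖ ≤ R

namespace IsSolution

variable {R A : ℝ} {u : EuclideanSpace ℝ (Fin n) → ℝ → ℝ} {χ : EuclideanSpace ℝ (Fin n) → ℝ}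

theorem hasDerivWithinAt (h : IsSolution R u) {x : E} (hx : x ∈ ball (0 : E) 4) {t : ℝ}
    (ht : t ∈ Ico 0 (1 / R ^ 2)) :
    HasDerivWithinAt (u x) (derivWithin (u x) (Icc 0 (1 / R ^ 2)) t) (Ici t) t :=
  (((h.smooth_time x hx).differentiableOn (by norm_num) t
    ⟨ht.1, ht.2.le⟩).hasDerivWithinAt).mono_of_mem_nhdsWithin
    (Filter.mem_of_superset (Icc_mem_nhdsGE ht.2) (Icc_subset_Icc_left ht.1))

theorem exists_approx (h : IsSolution R u) (hχ : Cutoff A χ) (hA : 0 ≤ A) (hR : 1 ≤ R)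
    {τ₀ η : ℝ} (hτ₀ : 0 < τ₀) (hη : 0 < η) :
    ∃ U κ, Approx R ((1 + 4 * A + 1) ^ 2 * volume.real (closedBall (0 : E) 5)) τ₀ U κ ∧
      ∀ x, |U (x, 0) - χ x * u x 0| ≤ η := by
  have hR0 : 0 < R := by linarith
  have hT : 0 ≤ 1 / R ^ 2 := by positivity
  set T := 1 / R ^ 2 with hTdef
  have hmem : ∀ t, (projIcc 0 T hT t : ℝ) ∈ Icc 0 T := fun t => (projIcc 0 T hT t).2
  have hproj : ∀ t (ht : t ∈ Icc 0 T), (projIcc 0 T hT t : ℝ) = t := fun t ht => by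
    rw [projIcc_of_mem hT ht]
  let W : E × ℝ → ℝ := fun p => χ p.1 * u p.1 (projIcc 0 T hT p.2)
  let Wt : E × ℝ → ℝ := fun p => χ p.1 * derivWithin (u p.1) (Icc 0 T) p.2
  have hz : ∀ x t, 7 / 2 ≤ ‖x‖ → W (x, t) = 0 := fun x t hx => by
    simp [W, hχ.zero x hx]
  have hsm : ∀ t, ContDiff ℝ 2 fun x => W (x, t) := fun t =>
    hχ.contDiff_mul (h.smooth _ (hmem t))
  have hgr : ∀ t ∈ Icc 0 T, ∀ x ∈ ball (0 : E) 4, ‖fderiv ℝ (fun y => u y t) x‖ ≤ R :=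
    fun t ht x hx => norm_gradient (fun y => u y t) x ▸ h.gradient_le x hx t ht
  have hWA : ∀ x t, ‖fderiv ℝ (fun y => W (y, t)) x‖ ≤ (1 + A) * R := fun x t =>
    hχ.norm_fderiv_mul_le hA hR (h.smooth _ (hmem t)) (fun y hy => h.le_one y hy _ (hmem t))
      (hgr _ (hmem t)) x
  have hWc : Continuous W := by
    refine continuous_prod_of_continuous_lipschitzWith W ((1 + A) * R).toNNReal
      (fun x => ?_) (fun t => ?_)
    · by_cases hx : x ∈ ball (0 : E) 4
      · have hc : Continuous fun t => u x (projIcc 0 T hT t) :=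
          (h.smooth_time x hx).continuousOn.comp_continuous
            (continuous_subtype_val.comp continuous_projIcc) hmem
        exact (continuous_const (y := χ x)).mul hc
      · have : (fun t => W (x, t)) = fun _ => 0 := funext fun t =>
          hz x t (by simp at hx; linarith)
        rw [this]
        exact continuous_const
    · refine lipschitzWith_of_nnnorm_fderiv_le ((hsm t).differentiable (by norm_num)) fun x => ?_
      rw [← NNReal.coe_le_coe, Real.coe_toNNReal _ (by positivity)]
      exact hWA x t
  have hS : Strip 0 T W Wt := by
    refine ⟨fun t _ => hsm t, fun x t ht => ?_, fun x t hx => hz x t (by linarith), hWc⟩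
    by_cases hx : x ∈ ball (0 : E) 4
    · refine ((h.hasDerivWithinAt hx ht).const_mul (χ x)).congr_of_eventuallyEq ?_ ?_
      · filter_upwards [Icc_mem_nhdsGE ht.2] with s hs
        simp only [W]
        rw [hproj s ⟨ht.1.trans hs.1, hs.2⟩]
      · simp only [W]
        rw [hproj t ⟨ht.1, ht.2.le⟩]
    · have hχ0 : χ x = 0 := hχ.zero x (by simp at hx; linarith)
      simp only [W, Wt, hχ0, zero_mul]
      exact hasDerivWithinAt_const _ _ _
  have hW0 : ∀ x, W (x, 0) = χ x * u x 0 := fun x => by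
    simp only [W]
    rw [hproj 0 ⟨le_rfl, hT⟩]
  simp only [← hW0]
  refine hS.exists_approx_of_bound (A := 1 + 4 * A) (W := W) (Wt := Wt)
    (k := fun x => 3 * R * ‖fderiv ℝ χ x‖ + |slap χ x|) hR (by linarith) hτ₀ hη
    (uniformContinuous_of_clamp hT hWc (fun x t hx => hz x t (by linarith)) fun x t => by
      simp only [W]
      rw [hproj _ (hmem t)])
    hz ?_ ?_ ?_ ?_ ?_ ?_ ?_ ?_
  · rintro ⟨x, t⟩
    by_cases hx : x ∈ ball (0 : E) 4
    · simp only [W]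
      rw [abs_mul, abs_of_nonneg (hχ.nonneg x)]
      exact mul_le_one₀ (hχ.le_one x) (abs_nonneg _) (h.le_one x hx _ (hmem t))
    · rw [hz x t (by simp at hx; linarith)]
      simp
  · exact fun x t _ => (hWA x t).trans (mul_le_mul_of_nonneg_right (by linarith) hR0.le)
  · have h2 : ContDiff ℝ 2 χ := contDiff_infty.1 hχ.smooth 2
    exact (continuous_const.mul (h2.continuous_fderiv (by norm_num)).norm).add
      h2.continuous_slap.abs
  · intro x
    positivity
  · intro x
    have h1 := mul_le_mul_of_nonneg_left (hχ.fderiv_le x) hR0.le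
    have h2 := hχ.slap_le x
    nlinarith
  · intro x hx
    have h1 := hχ.eventually_eq_one hx
    simp only [h1.fderiv_eq, slap_congr h1, slap_const]
    simp
  · intro x hx
    have h1 := hχ.eventually_eq_zero hx
    simp only [h1.fderiv_eq, slap_congr h1, slap_const]
    simp
  · intro x t ht
    have ht' : t ∈ Icc 0 T := ⟨ht.1, ht.2.le⟩
    simp only [W, Wt]
    rw [hproj t ht']
    by_cases hx : x ∈ ball (0 : E) 4
    · refine hχ.abs_mul_add_slap_le hR (h.smooth t ht') hx (h.le_one x hx t ht') (hgr t ht' x hx) ?_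
      rw [← norm_gradient]
      exact h.ineq x hx t ht'
    · have hx4 : 4 ≤ ‖x‖ := by simpa using hx
      have h1 : (fun y => χ y * u y t) =ᶠ[𝓝 x] fun _ => 0 := by
        filter_upwards [hχ.eventually_eq_zero hx4] with y hy
        rw [hy, zero_mul]
      rw [slap_congr h1, slap_const, hχ.zero x (by linarith)]
      simp only [zero_mul, add_zero, abs_zero]
      positivity

end IsSolution

end Setup

section Bounds

variable {n : ℕ}

local notation "E" => EuclideanSpace ℝ (Fin n)

theorem integrableOn_ball_of_abs_le_one {f : E → ℝ} {r : ℝ} (hf : ContinuousOn f (ball 0 r))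
    (hf1 : ∀ x ∈ ball (0 : E) r, |f x| ≤ 1) : IntegrableOn f (ball 0 r) :=
  .of_bound measure_ball_lt_top (hf.aestronglyMeasurable measurableSet_ball) 1
    ((ae_restrict_iff' measurableSet_ball).2 (Filter.Eventually.of_forall hf1))

theorem sq_exp_neg_eq_gauss {R ε : ℝ} (hR : 0 < R) (hε : 0 < ε) (x : E) :
    exp (-(R ^ 2 * ‖x‖ ^ 2) / ε) ^ 2 = gauss (ε / (8 * R ^ 2)) x := by
  rw [gauss, ← Real.exp_nat_mul]
  congr 1
  push_cast
  field_simp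
  ring

theorem IsSolution.integral_mul_exp_ge {R A θ ε : ℝ} {u : E → ℝ → ℝ} {χ : E → ℝ}
    (h : IsSolution R u) (hχ : Cutoff A χ) (hA : 0 ≤ A) (hR : 1 ≤ R) (hθ : 0 < θ)
    (hmass : θ * R ^ (-(n : ℝ) / 2) ≤ √(∫ x in ball (0 : E) 1, u x 0 ^ 2))
    {C : ℝ} (hC : C = (1 + 4 * A + 1) ^ 2 * volume.real (closedBall (0 : E) 5))
    (hRn : (n : ℝ) / 2 ≤ R ^ 2)
    (hR1 : (1 + 2 * C) * R ^ n ≤ θ ^ 2 / 6 * exp (R ^ 2 / 12))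
    (hR2 : 5 * (1 + 2 * C) * R ^ 2 ≤ exp (2 * R ^ 2 / 3)) (hε : 0 < ε) (hε' : ε ≤ 1 / 600) :
    exp ((2000 * R ^ 2 + n / 2) * log ε) ≤
      ∫ x in ball (0 : E) 4, (u x 0 * exp (-(R ^ 2 * ‖x‖ ^ 2) / ε)) ^ 2 := by
  have hR0 : 0 < R := by linarith
  have h0 : (0 : ℝ) ∈ Icc 0 (1 / R ^ 2) := ⟨le_rfl, by positivity⟩
  have hw0 : ∀ x : E, 4 ≤ ‖x‖ → χ x * u x 0 = 0 := fun x hx => by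
    rw [hχ.zero x (by linarith), zero_mul]
  have hw : Continuous fun x => χ x * u x 0 := (hχ.contDiff_mul (h.smooth 0 h0)).continuous
  have hwu : ∀ x ∈ ball (0 : E) 4, (χ x * u x 0) ^ 2 ≤ u x 0 ^ 2 := fun x _ => by
    rw [mul_pow]
    exact mul_le_of_le_one_left (sq_nonneg _) (pow_le_one₀ (hχ.nonneg x) (hχ.le_one x))
  have hcu := (h.smooth 0 h0).continuousOn
  refine (integral_mul_gauss_ge (C := C) (θ := θ) hw (fun x => ?_) hw0
    (fun η hη => ?_) hR ?_ hθ ?_ hRn hR1 hR2 hε hε').trans ?_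
  · by_cases hx : x ∈ ball (0 : E) 4
    · rw [← sq_le_one_iff_abs_le_one]
      exact (hwu x hx).trans ((sq_le_one_iff_abs_le_one _).2 (h.le_one x hx 0 h0))
    · rw [hw0 x (by simpa using hx)]
      simp
  · rw [hC]
    exact h.exists_approx hχ hA hR (by positivity) hη
  · rw [hC]
    have h1 : volume.real (closedBall (0 : E) 4) ≤ volume.real (closedBall (0 : E) 5) :=
      measureReal_mono (closedBall_subset_closedBall (by norm_num))
        measure_closedBall_lt_top.ne
    refine h1.trans (le_mul_of_one_le_left measureReal_nonneg ?_)
    exact one_le_pow₀ (by linarith)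
  · have h1 : ∫ x in ball (0 : E) 1, (χ x * u x 0) ^ 2 = ∫ x in ball (0 : E) 1, u x 0 ^ 2 :=
      setIntegral_congr_fun measurableSet_ball fun x hx => by
        have : ‖x‖ ≤ 3 := by
          have := mem_ball_zero_iff.1 hx
          linarith
        simp only [hχ.eq_one x this, one_mul]
    rw [h1]
    have h2 : (θ * R ^ (-(n : ℝ) / 2)) ^ 2 = θ ^ 2 * (R ^ n)⁻¹ := by
      rw [mul_pow, ← Real.rpow_natCast (R ^ _), ← Real.rpow_mul hR0.le, Nat.cast_ofNat,
        div_mul_cancel₀ _ two_ne_zero, Real.rpow_neg hR0.le, Real.rpow_natCast]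
    rw [← h2]
    exact (Real.le_sqrt' (by positivity)).1 hmass
  · have h1 : ∀ x, x ∉ ball (0 : E) 4 →
        (χ x * u x 0) ^ 2 * gauss (ε / (8 * R ^ 2)) x = 0 := fun x hx => by
      rw [hw0 x (by simpa using hx)]
      simp
    rw [← setIntegral_eq_integral_of_forall_compl_eq_zero h1]
    simp only [mul_pow (u _ _), sq_exp_neg_eq_gauss hR0 hε]
    have hg1 : ∀ x : E, gauss (ε / (8 * R ^ 2)) x ≤ 1 := fun x => by
      rw [gauss]
      exact exp_le_one_iff.2 (div_nonpos_of_nonpos_of_nonneg (by simp) (by positivity))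
    have hint : ∀ f : E → ℝ, ContinuousOn f (ball 0 4) →
        (∀ x ∈ ball (0 : E) 4, f x ^ 2 ≤ u x 0 ^ 2) →
        IntegrableOn (fun x => f x ^ 2 * gauss (ε / (8 * R ^ 2)) x) (ball 0 4) := by
      intro f hf hfu
      refine integrableOn_ball_of_abs_le_one
        ((hf.pow 2).mul (contDiff_gauss (k := 0) _).continuous.continuousOn) fun x hx => ?_
      rw [abs_of_nonneg (mul_nonneg (sq_nonneg _) (gauss_pos _ x).le)]
      exact mul_le_one₀ ((hfu x hx).trans ((sq_le_one_iff_abs_le_one _).2 (h.le_one x hx 0 h0)))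
        (gauss_pos _ x).le (hg1 x)
    exact setIntegral_mono_on (hint _ hw.continuousOn hwu) (hint _ hcu fun _ _ => le_rfl)
      measurableSet_ball fun x hx =>
        mul_le_mul_of_nonneg_right (hwu x hx) (gauss_pos _ x).le

theorem integral_mul_exp_le {R r ε : ℝ} {f : E → ℝ} (hf : ContinuousOn f (ball 0 4))
    (hf1 : ∀ x ∈ ball (0 : E) 4, |f x| ≤ 1) (hε : 0 < ε) (hr : 0 ≤ r) (hr4 : r ≤ 4) :
    ∫ x in ball (0 : E) 4, (f x * exp (-(R ^ 2 * ‖x‖ ^ 2) / ε)) ^ 2 ≤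
      (∫ x in ball (0 : E) r, f x ^ 2) +
        volume.real (ball (0 : E) 4) * exp (-(2 * R ^ 2 * r ^ 2 / ε)) := by
  have hsub : ball (0 : E) r ⊆ ball 0 4 := ball_subset_ball hr4
  have h1 : ∀ x ∈ ball (0 : E) 4, |f x ^ 2| ≤ 1 := fun x hx => by
    rw [abs_of_nonneg (sq_nonneg _)]
    exact (sq_le_one_iff_abs_le_one _).2 (hf1 x hx)
  have hi : IntegrableOn (fun x => f x ^ 2) (ball 0 4) :=
    integrableOn_ball_of_abs_le_one (hf.pow 2) h1
  have hle1 : ∀ x : E, exp (-(R ^ 2 * ‖x‖ ^ 2) / ε) ^ 2 ≤ 1 := fun x =>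
    pow_le_one₀ (exp_pos _).le (exp_le_one_iff.2
      (div_nonpos_of_nonpos_of_nonneg (neg_nonpos.2 (by positivity)) hε.le))
  have hpt : ∀ x ∈ ball (0 : E) 4, (f x * exp (-(R ^ 2 * ‖x‖ ^ 2) / ε)) ^ 2 ≤
      (ball (0 : E) r).indicator (fun x => f x ^ 2) x + exp (-(2 * R ^ 2 * r ^ 2 / ε)) := by
    intro x hx
    rw [mul_pow]
    by_cases hxr : x ∈ ball (0 : E) r
    · rw [indicator_of_mem hxr]
      have := mul_le_of_le_one_right (sq_nonneg (f x)) (hle1 x)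
      have := exp_pos (-(2 * R ^ 2 * r ^ 2 / ε))
      linarith
    · rw [indicator_of_notMem hxr, zero_add]
      refine (mul_le_of_le_one_left (sq_nonneg _) ((sq_le_one_iff_abs_le_one _).2
        (hf1 x hx))).trans ?_
      rw [← Real.exp_nat_mul, exp_le_exp]
      have hxr' : r ≤ ‖x‖ := by simpa using hxr
      have : R ^ 2 * r ^ 2 / ε ≤ R ^ 2 * ‖x‖ ^ 2 / ε := by gcongr
      push_cast
      rw [neg_div, mul_assoc 2, mul_div_assoc 2]
      linarith
  have hi2 : IntegrableOn ((ball (0 : E) r).indicator fun x => f x ^ 2) (ball 0 4) :=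
    hi.indicator measurableSet_ball
  have hi3 : IntegrableOn (fun _ : E => exp (-(2 * R ^ 2 * r ^ 2 / ε))) (ball 0 4) :=
    integrableOn_const measure_ball_lt_top.ne
  have hi1 : IntegrableOn (fun x => (f x * exp (-(R ^ 2 * ‖x‖ ^ 2) / ε)) ^ 2)
      (ball (0 : E) 4) := by
    refine integrableOn_ball_of_abs_le_one ((hf.mul (by fun_prop)).pow 2) fun x hx => ?_
    rw [abs_of_nonneg (sq_nonneg _), mul_pow]
    exact mul_le_one₀ ((sq_le_one_iff_abs_le_one _).2 (hf1 x hx)) (sq_nonneg _) (hle1 x)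
  refine (setIntegral_mono_on hi1 (hi2.add hi3) measurableSet_ball hpt).trans (le_of_eq ?_)
  simp only [Pi.add_apply]
  rw [integral_add hi2 hi3, setIntegral_indicator measurableSet_ball,
    inter_eq_self_of_subset_right hsub, setIntegral_const, smul_eq_mul]

end Bounds

section Conclusion

open Filter in
theorem exists_large (n : ℕ) {C θ : ℝ} (hθ : 0 < θ) : ∃ N₀ : ℝ, ∀ R ≥ N₀,
    (n : ℝ) / 2 ≤ R ^ 2 ∧ (1 + 2 * C) * R ^ n ≤ θ ^ 2 / 6 * exp (R ^ 2 / 12) ∧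
      5 * (1 + 2 * C) * R ^ 2 ≤ exp (2 * R ^ 2 / 3) := by
  have key : ∀ (k : ℕ) (c a b : ℝ), 0 < a → 0 < b →
      ∀ᶠ R : ℝ in atTop, c * R ^ k ≤ b * exp (a * R ^ 2) := by
    intro k c a b ha hb
    have h1 := (isLittleO_pow_exp_pos_mul_atTop k ha).const_mul_left c
    filter_upwards [h1.bound hb, eventually_ge_atTop 1] with R hR hR1
    rw [norm_of_nonneg (exp_pos _).le] at hR
    refine (le_norm_self _).trans (hR.trans ?_)
    gcongr
    nlinarith
  have h1 := key n (1 + 2 * C) (1 / 12) (θ ^ 2 / 6) (by norm_num) (by positivity)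
  have h2 := key 2 (5 * (1 + 2 * C)) (2 / 3) 1 (by norm_num) one_pos
  have h3 : ∀ᶠ R : ℝ in atTop, (n : ℝ) / 2 ≤ R ^ 2 :=
    (tendsto_pow_atTop two_ne_zero).eventually_ge_atTop _
  obtain ⟨N₀, h⟩ := eventually_atTop.1 (h1.and (h2.and h3))
  refine ⟨N₀, fun R hR => ⟨(h R hR).2.2, ?_, ?_⟩⟩
  · convert (h R hR).1 using 3
    ring
  · convert (h R hR).2.1 using 1
    rw [one_mul]
    congr 1
    ring

theorem exp_neg_le_sqrt_of_exp_mul_log_le {R ε q M J : ℝ} (hε : 0 < ε)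
    (hε1 : ε ≤ 1) (hM : q ≤ 2 * M) (h : exp (q * R ^ 2 * log ε) ≤ J) :
    exp (-(M * R ^ 2 * log (1 / ε))) ≤ √J := by
  refine Real.le_sqrt_of_sq_le (le_trans ?_ h)
  rw [← Real.exp_nat_mul, exp_le_exp, one_div, Real.log_inv]
  have h1 : 0 ≤ (2 * M - q) * R ^ 2 * -log ε :=
    mul_nonneg (mul_nonneg (by linarith) (sq_nonneg _)) (neg_nonneg.2 (log_nonpos hε.le hε1))
  push_cast
  linarith

theorem mul_exp_neg_le_half {R r v q M : ℝ} (hR : 1 ≤ R) (hr : 0 < r) (hr1 : r ≤ 1)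
    (hq : 1 ≤ q) (hv : 0 ≤ v) (hM : 4 * q + 2 * v + 2 ≤ M) :
    v * exp (-(2 * R ^ 2 * r ^ 2 / (r / M) ^ 4)) ≤
      1 / 2 * exp (q * R ^ 2 * log ((r / M) ^ 4)) := by
  have hM0 : 0 < M := by linarith
  have hlog : log ((r / M) ^ 4) = -(4 * log (M / r)) := by
    rw [Real.log_pow, ← inv_div M r, Real.log_inv]
    push_cast
    ring
  have h1 : log (M / r) ≤ M / r := (Real.log_le_sub_one_of_pos (by positivity)).trans (by linarith)
  have h2 : 2 * v ≤ exp (M / r) := by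
    have : M ≤ M / r := le_div_self hM0.le hr hr1
    have := add_one_le_exp (M / r)
    linarith
  have h3 : 2 * R ^ 2 * r ^ 2 / (r / M) ^ 4 = 2 * R ^ 2 * (M ^ 3 * (M / r)) / r := by
    field_simp
  have h4 : R ^ 2 * (2 * (M ^ 3 * (M / r))) ≤ 2 * R ^ 2 * (M ^ 3 * (M / r)) / r := by
    rw [le_div_iff₀ hr]
    have : 0 ≤ R ^ 2 * (2 * (M ^ 3 * (M / r))) := by positivity
    nlinarith
  have h5 : M ≤ M ^ 3 := le_self_pow₀ (by linarith) (by norm_num)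
  have h6 : 0 < M / r := by positivity
  have h7 : 1 ≤ R ^ 2 := one_le_pow₀ hR
  have h8 : M / r + q * R ^ 2 * (4 * log (M / r)) ≤ 2 * R ^ 2 * r ^ 2 / (r / M) ^ 4 := by
    rw [h3]
    refine le_trans ?_ h4
    have h9 : q * R ^ 2 * (4 * log (M / r)) ≤ q * R ^ 2 * (4 * (M / r)) := by gcongr
    have h10 : (4 * q + 1) * (M / r) ≤ 2 * (M ^ 3 * (M / r)) := by
      rw [← mul_assoc]
      exact mul_le_mul_of_nonneg_right (by linarith) h6.le
    have h11 := mul_le_mul_of_nonneg_left h10 (sq_nonneg R)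
    nlinarith
  have h12 : 2 * v * exp (-(2 * R ^ 2 * r ^ 2 / (r / M) ^ 4)) ≤
      exp (q * R ^ 2 * log ((r / M) ^ 4)) := by
    refine (mul_le_mul h2 (exp_le_exp.2 (neg_le_neg h8)) (exp_pos _).le (exp_pos _).le).trans
      (le_of_eq ?_)
    rw [← exp_add, hlog]
    congr 1
    ring
  linarith

end Conclusion

/-- if `θ ∈ (0,1]` and `u` is `C^{2,1}` on `B₄ × [0,1/R²]` with
`|Δu + ∂ₜu| ≤ R²|u| + R|∇u|`, `‖u‖_∞ ≤ 1`, `‖∇u‖_∞ ≤ R` and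
`‖u(·,0)‖_{L²(B₁)} ≥ θ R^{-n/2}`, then there is `N = N(n,θ)` with
(i) `‖u(·,0) e^{-R²|x|²/ε}‖_{L²(B₄)} ≥ e^{-N R² log(1/ε)}` for `0 < ε ≤ 1/(3N)`, `R ≥ N`, and
(ii) `‖u(·,0)‖_{L²(B_r)} ≥ e^{-N R² log(N/r)}` for `0 < r ≤ 1/2`, `R ≥ N`. -/
theorem stmt_15 (n : ℕ) : ∀ θ : ℝ, θ ∈ Ioc (0 : ℝ) 1 →
    ∃ N > (0 : ℝ), ∀ R : ℝ, 0 < R →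
    ∀ u : EuclideanSpace ℝ (Fin n) → ℝ → ℝ,
    (∀ t ∈ Icc (0 : ℝ) (1 / R ^ 2),
      ContDiffOn ℝ 2 (fun x => u x t) (ball (0 : EuclideanSpace ℝ (Fin n)) 4)) →
    (∀ x ∈ ball (0 : EuclideanSpace ℝ (Fin n)) 4,
      ContDiffOn ℝ 1 (u x) (Icc (0 : ℝ) (1 / R ^ 2))) →
    (∀ x ∈ ball (0 : EuclideanSpace ℝ (Fin n)) 4, ∀ t ∈ Icc (0 : ℝ) (1 / R ^ 2),
      |slap (fun y => u y t) x + derivWithin (u x) (Icc (0 : ℝ) (1 / R ^ 2)) t| ≤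
        R ^ 2 * |u x t| + R * ‖gradient (fun y => u y t) x‖) →
    (∀ x ∈ ball (0 : EuclideanSpace ℝ (Fin n)) 4, ∀ t ∈ Icc (0 : ℝ) (1 / R ^ 2),
      |u x t| ≤ 1) →
    (∀ x ∈ ball (0 : EuclideanSpace ℝ (Fin n)) 4, ∀ t ∈ Icc (0 : ℝ) (1 / R ^ 2),
      ‖gradient (fun y => u y t) x‖ ≤ R) →
    Real.sqrt (∫ x in ball (0 : EuclideanSpace ℝ (Fin n)) 1, u x 0 ^ 2) ≥
      θ * R ^ (-(n : ℝ) / 2) →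
    (∀ ε : ℝ, 0 < ε → ε ≤ 1 / (3 * N) → R ≥ N →
      Real.sqrt (∫ x in ball (0 : EuclideanSpace ℝ (Fin n)) 4,
          (u x 0 * Real.exp (-(R ^ 2 * ‖x‖ ^ 2) / ε)) ^ 2) ≥
        Real.exp (-(N * R ^ 2 * Real.log (1 / ε)))) ∧
    (∀ r : ℝ, 0 < r → r ≤ 1 / 2 → R ≥ N →
      Real.sqrt (∫ x in ball (0 : EuclideanSpace ℝ (Fin n)) r, u x 0 ^ 2) ≥
        Real.exp (-(N * R ^ 2 * Real.log (N / r)))) := by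
  intro θ hθ
  obtain ⟨A, hA, χ, hχ⟩ := exists_cutoff n
  set C := (1 + 4 * A + 1) ^ 2 * volume.real (closedBall (0 : EuclideanSpace ℝ (Fin n)) 5)
    with hC
  obtain ⟨N₀, hN₀⟩ := exists_large n (C := C) hθ.1
  set v := volume.real (ball (0 : EuclideanSpace ℝ (Fin n)) 4)
  have hv : 0 ≤ v := measureReal_nonneg
  have hn : (0 : ℝ) ≤ n := n.cast_nonneg
  set M : ℝ := 4 * (2000 + n) + 2 * v + 2 with hM
  have hM1 : 8000 ≤ M := by linarith
  have hMN : M ≤ M + |N₀| := le_add_of_nonneg_right (abs_nonneg _)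
  have hN0 : 0 < M + |N₀| := by linarith
  refine ⟨M + |N₀|, hN0, fun R hR0 u h1 h2 h3 h4 h5 h6 => ?_⟩
  have hu : IsSolution R u := ⟨h1, h2, h3, h4, h5⟩
  have hlow : M + |N₀| ≤ R → ∀ ε, 0 < ε → ε ≤ 1 / 600 → exp ((2000 + n) * R ^ 2 * log ε) ≤
      ∫ x in ball (0 : EuclideanSpace ℝ (Fin n)) 4,
        (u x 0 * exp (-(R ^ 2 * ‖x‖ ^ 2) / ε)) ^ 2 := by
    intro hNR ε hε hε'
    obtain ⟨hR1, hR2, hR3⟩ := hN₀ R (by linarith [le_abs_self N₀])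
    have hR : 1 ≤ R := by linarith
    refine le_trans ?_ (hu.integral_mul_exp_ge hχ hA hR hθ.1 h6 hC hR1 hR2 hR3 hε hε')
    refine exp_le_exp.2 (mul_le_mul_of_nonpos_right ?_ (log_nonpos hε.le (by linarith)))
    nlinarith [one_le_pow₀ hR (n := 2)]
  refine ⟨fun ε hε hεN hNR => ?_, fun r hr hr2 hNR => ?_⟩
  · have hε' : ε ≤ 1 / 600 :=
      hεN.trans (one_div_le_one_div_of_le (by norm_num) (by linarith))
    exact exp_neg_le_sqrt_of_exp_mul_log_le hε (by linarith) (by linarith)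
      (hlow hNR ε hε hε')
  · have hR : 1 ≤ R := by linarith
    have hM0 : 0 < M := by linarith
    have hrM0 : 0 < r / M := by positivity
    have hε : 0 < (r / M) ^ 4 := by positivity
    have hrM : r / M ≤ 1 / 600 := by
      rw [div_le_iff₀ hM0]
      linarith
    have hε' : (r / M) ^ 4 ≤ 1 / 600 :=
      (pow_le_of_le_one hrM0.le (by linarith) (by norm_num)).trans hrM
    have hJ := (hlow hNR _ hε hε').trans (integral_mul_exp_le (f := fun x => u x 0) (R := R)
      (h1 0 ⟨le_rfl, by positivity⟩).continuousOn
      (fun x hx => h4 x hx 0 ⟨le_rfl, by positivity⟩) hε hr.le (by linarith))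
    have hhalf := mul_exp_neg_le_half (v := v) (q := 2000 + n) (M := M) hR hr (by linarith)
      (by linarith) hv hM.ge
    have hsmall : exp (R ^ 2 * log ((r / M) ^ 4)) ≤ 1 / 2 := by
      have h7 : log ((r / M) ^ 4) ≤ 0 := log_nonpos hε.le (by linarith)
      calc exp (R ^ 2 * log ((r / M) ^ 4)) ≤ exp (log ((r / M) ^ 4)) :=
            exp_le_exp.2 (by nlinarith [one_le_pow₀ hR (n := 2)])
        _ ≤ 1 / 2 := by
            rw [exp_log hε]
            linarith
    have hB : exp ((2001 + n) * R ^ 2 * log ((r / M) ^ 4)) ≤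
        ∫ x in ball (0 : EuclideanSpace ℝ (Fin n)) r, u x 0 ^ 2 := by
      have h7 : exp ((2001 + n) * R ^ 2 * log ((r / M) ^ 4)) =
          exp (R ^ 2 * log ((r / M) ^ 4)) * exp ((2000 + n) * R ^ 2 * log ((r / M) ^ 4)) := by
        rw [← exp_add]
        congr 1
        ring
      rw [h7]
      have := mul_le_mul_of_nonneg_right hsmall
        (exp_pos ((2000 + n) * R ^ 2 * log ((r / M) ^ 4))).le
      linarith
    refine le_trans (exp_le_exp.2 (neg_le_neg ?_)) (exp_neg_le_sqrt_of_exp_mul_log_le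
      (M := M / 4) hε (by linarith) (by linarith) hB)
    have h8 : log (1 / (r / M) ^ 4) = 4 * log (M / r) := by
      rw [one_div, ← inv_pow, inv_div, Real.log_pow]
      norm_num
    have h9 : log (M / r) ≤ log ((M + |N₀|) / r) := by gcongr
    have h10 : 0 ≤ log (M / r) := log_nonneg (by
      rw [le_div_iff₀ hr]
      linarith)
    rw [h8]
    calc M / 4 * R ^ 2 * (4 * log (M / r)) = M * R ^ 2 * log (M / r) := by ring
      _ ≤ (M + |N₀|) * R ^ 2 * log ((M + |N₀|) / r) := by gcongr
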